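/- Displacement energy of polydisks in a cylinder (Theorem 1.2 / thm:hindpoly): Let n ≥ 2, S > 1 and 0 < ε < 1. Let D = D(1, S, …, S) = {z ∈ ℂⁿ : π|z₁|² < 1 and π|zⱼ|² < S for 2 ≤ j ≤ n}, and let Z = Z_{1,n−1}(1+ε) = {z ∈ ℂⁿ : π|z₁|² < 1+ε}. Then for every smooth Hamiltonian H : [0,1] × ℂⁿ → ℝ whose support is compact and contained in [0,1] × Z, if the time-one map ψ = φ_H^1 of its Hamiltonian isotopy satisfies ψ(D) ∩ closure(D) = ∅, then ‖H‖ ≥ S. Equivalently, the displacement energy of D(1,S,…,S) inside the cylinder Z_{1,n−1}(1+ε) is at least S. -/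

import Mathlib

open MeasureTheory Set Filter

noncomputable section

abbrev CE (n : ℕ) : Type := EuclideanSpace ℂ (Fin n)

/-- The standard symplectic form `ω(v, w) = ⟨i • v, w⟩_ℝ` on `ℂⁿ ≅ ℝ²ⁿ`. -/
def symp {n : ℕ} (v w : CE n) : ℝ := inner (𝕜 := ℝ) ((Complex.I : ℂ) • v) w

/-- The Hamiltonian vector field `X_{H_t}(x) = -i ∇H_t(x)`. -/
def hamVF {n : ℕ} (H : ℝ → CE n → ℝ) (t : ℝ) (x : CE n) : CE n :=
  (-Complex.I : ℂ) • gradient (H t) x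

/-- ∂u/∂τ. -/
def d1 {n : ℕ} (u : ℝ × ℝ → CE n) (p : ℝ × ℝ) : CE n := deriv (fun s => u (s, p.2)) p.1

/-- ∂u/∂t. -/
def d2 {n : ℕ} (u : ℝ × ℝ → CE n) (p : ℝ × ℝ) : CE n := deriv (fun s => u (p.1, s)) p.2

/-- The strip `ℝ × [0,1]`. -/
def strip : Set (ℝ × ℝ) := Set.univ ×ˢ Set.Icc (0 : ℝ) 1

/-- The energy density `|∂u/∂τ|² + |∂u/∂t − ρ(τ) X_{H_t}(u)|²`. -/
def enDensity {n : ℕ} (H : ℝ → CE n → ℝ) (ρ : ℝ → ℝ) (u : ℝ × ℝ → CE n) (p : ℝ × ℝ) : ℝ :=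
  ‖d1 u p‖ ^ 2 + ‖d2 u p - ρ p.1 • hamVF H p.2 (u p)‖ ^ 2

/-- The energy `E_{(H,ρ)}(u)`. -/
def energy {n : ℕ} (H : ℝ → CE n → ℝ) (ρ : ℝ → ℝ) (u : ℝ × ℝ → CE n) : ℝ :=
  (1 / 2) * ∫ p in strip, enDensity H ρ u p

/-- The symplectic area `∫ u*ω`. -/
def area {n : ℕ} (u : ℝ × ℝ → CE n) : ℝ := ∫ p in strip, symp (d1 u p) (d2 u p)

def Eplus {n : ℕ} (H : ℝ → CE n → ℝ) : ℝ := ∫ t in (0:ℝ)..1, ⨆ x : CE n, H t x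
def Eminus {n : ℕ} (H : ℝ → CE n → ℝ) : ℝ := -∫ t in (0:ℝ)..1, ⨅ x : CE n, H t x
def hoferNorm {n : ℕ} (H : ℝ → CE n → ℝ) : ℝ := Eplus H + Eminus H

/-- An elongation function of type `ρ₊`. -/
structure IsElongationPlus (ρ : ℝ → ℝ) : Prop where
  smooth : ContDiff ℝ (⊤ : ℕ∞) ρ
  mono : Monotone ρ
  mem : ∀ τ : ℝ, ρ τ ∈ Set.Icc (0:ℝ) 1
  zero : ∀ τ : ℝ, τ ≤ 0 → ρ τ = 0
  one : ∀ τ : ℝ, 1 ≤ τ → ρ τ = 1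

/-- An elongation function of type `ρ_K`. -/
structure IsElongationK (K : ℝ) (ρ : ℝ → ℝ) : Prop where
  smooth : ContDiff ℝ (⊤ : ℕ∞) ρ
  mem : ∀ τ : ℝ, ρ τ ∈ Set.Icc (0:ℝ) 1
  zero : ∀ τ : ℝ, K ≤ |τ| → ρ τ = 0
  one : ∀ τ : ℝ, |τ| ≤ K - 1 → ρ τ = 1
  incr : ∀ τ ∈ Set.Icc (-K) (-K + 1), 0 ≤ deriv ρ τ
  decr : ∀ τ ∈ Set.Icc (K - 1) K, deriv ρ τ ≤ 0

/-- `u` solves the `ρ`-perturbed Cauchy–Riemann equation on `ℝ × [0,1]`. -/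
def SolvesCR {n : ℕ} (H : ℝ → CE n → ℝ) (ρ : ℝ → ℝ) (u : ℝ × ℝ → CE n) : Prop :=
  ∀ p : ℝ × ℝ, p.2 ∈ Set.Icc (0:ℝ) 1 →
    d1 u p + (Complex.I : ℂ) • (d2 u p - ρ p.1 • hamVF H p.2 (u p)) = 0

/-- `φ` is the Hamiltonian flow of `H`. -/
structure IsHamFlow {n : ℕ} (H : ℝ → CE n → ℝ) (φ : ℝ → CE n ≃ CE n) : Prop where
  init : ∀ x, φ 0 x = x
  isFlow : ∀ t x, HasDerivAt (fun s => φ s x) (hamVF H t (φ t x)) t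
  smooth : ContDiff ℝ (⊤ : ℕ∞) fun p : ℝ × CE n => φ p.1 p.2
  smooth_symm : ContDiff ℝ (⊤ : ℕ∞) fun p : ℝ × CE n => (φ p.1).symm p.2

namespace SignCochain

variable {X : Type*}

/-- The product of the first `n` sign coboundaries along the vertex sequence `y`. -/
def edgeProd (s : ℕ → X → ZMod 2) (n : ℕ) (y : ℕ → X) : ZMod 2 :=
  ∏ i ∈ Finset.range n, (s i (y i) + s i (y (i + 1)))

/-- The increasing map `ℕ → ℕ` that omits the value `j`. -/
def skip (j k : ℕ) : ℕ := if k < j then k else k + 1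

lemma edgeProd_congr (s : ℕ → X → ZMod 2) (n : ℕ) {y y' : ℕ → X}
    (h : ∀ k ≤ n, y k = y' k) : edgeProd s n y = edgeProd s n y' := by
  refine Finset.prod_congr rfl fun i hi => ?_
  have := Finset.mem_range.1 hi
  rw [h i (by omega), h (i + 1) (by omega)]

lemma edgeProd_skip_last (s : ℕ → X → ZMod 2) (n : ℕ) (y : ℕ → X) :
    edgeProd s n (y ∘ skip (n + 1)) = edgeProd s n y :=
  edgeProd_congr s n fun k hk => by simp [skip, Nat.lt_succ_of_le hk]

lemma sum_edgeProd_skip (s : ℕ → X → ZMod 2) (n : ℕ) (y : ℕ → X) :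
    ∑ j ∈ Finset.range (n + 2), edgeProd s n (y ∘ skip j) = 0 := by
  induction n with
  | zero => simp [edgeProd]; decide
  | succ n ih =>
    have key : ∀ j, edgeProd s (n + 1) (y ∘ skip j) = edgeProd s n (y ∘ skip j) *
        (s n (y (skip j n)) + s n (y (skip j (n + 1)))) := fun j => by
      simp [edgeProd, Finset.prod_range_succ]
    have h1 : ∀ j ∈ Finset.range (n + 1), edgeProd s (n + 1) (y ∘ skip j) =
        edgeProd s n (y ∘ skip j) * (s n (y (n + 1)) + s n (y (n + 2))) := fun j hj => by
      have := Finset.mem_range.1 hj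
      rw [key, show skip j n = n + 1 by simp [skip]; omega,
        show skip j (n + 1) = n + 2 by simp [skip]; omega]
    have h2 : edgeProd s n (y ∘ skip (n + 2)) = edgeProd s n y :=
      edgeProd_congr s n fun k hk => by simp [skip, show k < n + 2 by omega]
    rw [Finset.sum_range_succ, Finset.sum_range_succ, Finset.sum_congr rfl h1, ← Finset.sum_mul,
      key, key, h2]
    rw [Finset.sum_range_succ] at ih
    rw [edgeProd_skip_last] at ih ⊢
    have e := eq_neg_of_add_eq_zero_left ih
    rw [CharTwo.neg_eq] at e
    simp only [skip, Nat.lt_succ_self, if_true, lt_irrefl, if_false, e,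
      show n < n + 2 by omega, show n + 1 < n + 2 by omega]
    have := CharTwo.add_self_eq_zero (edgeProd s n y)
    have a1 := CharTwo.add_self_eq_zero (edgeProd s n y * s n (y n))
    have a2 := CharTwo.add_self_eq_zero (edgeProd s n y * s n (y (n+1)))
    have a3 := CharTwo.add_self_eq_zero (edgeProd s n y * s n (y (n+2)))
    linear_combination a1 + a2 + a3

/-- The cochain whose coboundary is the product of all sign coboundaries. -/
def face (s : ℕ → X → ZMod 2) (n : ℕ) (y : ℕ → X) : ZMod 2 := edgeProd s n y * s n (y n)

lemma sum_face_skip (s : ℕ → X → ZMod 2) (n : ℕ) (y : ℕ → X) :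
    ∑ j ∈ Finset.range (n + 2), face s n (y ∘ skip j) = edgeProd s (n + 1) y := by
  have h1 : ∀ j ∈ Finset.range (n + 1), face s n (y ∘ skip j) =
      edgeProd s n (y ∘ skip j) * s n (y (n + 1)) := fun j hj => by
    have := Finset.mem_range.1 hj
    simp only [face, Function.comp, show skip j n = n + 1 by simp [skip]; omega]
  have ih := sum_edgeProd_skip s n y
  rw [Finset.sum_range_succ, edgeProd_skip_last] at ih
  have e := eq_neg_of_add_eq_zero_left ih
  rw [CharTwo.neg_eq] at e
  rw [Finset.sum_range_succ, Finset.sum_congr rfl h1, ← Finset.sum_mul, e, face,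
    edgeProd_skip_last, edgeProd, edgeProd, Finset.prod_range_succ]
  simp only [Function.comp, skip, Nat.lt_succ_self, if_true]
  ring

variable {D M : ℕ}

/-- A top simplex of the fence triangulation: a cube of the grid (each side given by its odd
endpoint `2 * q + 1 - M` and a direction) and an order of the coordinates. -/
abbrev Simp (D M : ℕ) := (Fin (D + 1) → Fin M × Bool) × Equiv.Perm (Fin (D + 1))

def oddEnd (c : Fin M × Bool) : ℤ := 2 * (c.1 : ℤ) + 1 - M
def evenEnd (c : Fin M × Bool) : ℤ := 2 * (c.1 : ℤ) + (if c.2 then 2 else 0) - M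

/-- The vertices of a simplex. -/
def vert (σ : Simp D M) (k : ℕ) (i : Fin (D + 1)) : ℤ :=
  if (σ.2.symm i : ℕ) < k then oddEnd (σ.1 i) else evenEnd (σ.1 i)

lemma abs_vert_le (σ : Simp D M) (k : ℕ) (i : Fin (D + 1)) : |vert σ k i| ≤ M := by
  have := (σ.1 i).1.2
  unfold vert oddEnd evenEnd
  rw [abs_le]
  split_ifs <;> constructor <;> omega

lemma abs_vert_sub_le (σ : Simp D M) (k l : ℕ) (i : Fin (D + 1)) :
    |vert σ k i - vert σ l i| ≤ 1 := by
  unfold vert oddEnd evenEnd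
  rw [abs_le]
  split_ifs <;> constructor <;> omega

lemma sum_face_skip_zero (s : ℕ → (Fin (D + 1) → ℤ) → ZMod 2) :
    ∑ σ : Simp D M, face s D (vert σ ∘ skip 0) = 0 := by
  refine Finset.sum_involution
    (fun σ _ => (Function.update σ.1 (σ.2 0) ((σ.1 (σ.2 0)).1, !(σ.1 (σ.2 0)).2), σ.2)) ?_ ?_ ?_ ?_
  · intro σ _
    have : (vert (Function.update σ.1 (σ.2 0) ((σ.1 (σ.2 0)).1, !(σ.1 (σ.2 0)).2), σ.2) ∘ skip 0)
        = vert σ ∘ skip 0 := by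
      funext k i
      simp only [Function.comp, vert, skip, Nat.not_lt_zero, if_false]
      by_cases hi : i = σ.2 0
      · subst hi
        simp [oddEnd]
      · simp [Function.update_of_ne hi]
    rw [this]
    exact CharTwo.add_self_eq_zero _
  · intro σ _ _ h
    have := congrFun (congrArg Prod.fst h) (σ.2 0)
    simp only [Function.update_self] at this
    have := congrArg Prod.snd this
    simp at this
  · simp
  · intro σ _
    ext1
    · simp
    · rfl

lemma sum_face_skip_mid (s : ℕ → (Fin (D + 1) → ℤ) → ZMod 2) (j : ℕ) (hj : j < D) :
    ∑ σ : Simp D M, face s D (vert σ ∘ skip (j + 1)) = 0 := by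
  set a : Fin (D + 1) := ⟨j, by omega⟩ with ha
  set b : Fin (D + 1) := ⟨j + 1, by omega⟩ with hb
  have hab : a ≠ b := by simp [ha, hb]
  refine Finset.sum_involution (fun σ _ => (σ.1, σ.2 * Equiv.swap a b)) ?_ ?_ ?_ ?_
  · intro σ _
    have : vert (σ.1, σ.2 * Equiv.swap a b) ∘ skip (j + 1) = vert σ ∘ skip (j + 1) := by
      funext k i
      have e : ((σ.2 * Equiv.swap a b).symm i) = Equiv.swap a b (σ.2.symm i) := by
        rw [Equiv.symm_apply_eq]; simp
      simp only [Function.comp, vert, e]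
      congr 1
      generalize σ.2.symm i = c
      have h1 : skip (j + 1) k ≠ j + 1 := by unfold skip; split_ifs <;> omega
      rw [Equiv.swap_apply_def]
      split_ifs with hc hc
      · subst hc; simp only [ha, hb, eq_iff_iff]; omega
      · subst hc; simp only [ha, hb, eq_iff_iff]; omega
      · rfl
    rw [this]
    exact CharTwo.add_self_eq_zero _
  · intro σ _ _ h
    have := congrArg Prod.snd h
    simp only [mul_eq_left, Equiv.swap_eq_one_iff] at this
    exact hab this
  · simp
  · intro σ _
    ext1
    · rfl
    · simp [mul_assoc]

/-- The neighbouring grid interval across the even endpoint (itself, at the two ends). -/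
def neighbor (c : Fin M × Bool) : Fin M × Bool :=
  if c.2 then (if h : (c.1 : ℕ) + 1 < M then (⟨c.1 + 1, h⟩, false) else c)
  else (if 0 < (c.1 : ℕ) then (⟨c.1 - 1, by omega⟩, true) else c)

lemma neighbor_neighbor (c : Fin M × Bool) : neighbor (neighbor c) = c := by
  obtain ⟨⟨q, hq⟩, b⟩ := c
  cases b
  · rcases Nat.eq_zero_or_pos q with rfl | h0
    · simp [neighbor]
    · have : q - 1 + 1 = q := by omega
      simp [neighbor, h0, this, hq]
  · by_cases h : q + 1 < M <;> simp [neighbor, h]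

lemma evenEnd_neighbor (c : Fin M × Bool) : evenEnd (neighbor c) = evenEnd c := by
  obtain ⟨⟨q, hq⟩, b⟩ := c
  cases b
  · rcases Nat.eq_zero_or_pos q with rfl | h0
    · simp [neighbor]
    · simp [neighbor, h0, evenEnd]; omega
  · by_cases h : q + 1 < M
    · simp [neighbor, h, evenEnd]; omega
    · simp [neighbor, h]

lemma abs_evenEnd_of_neighbor_eq {c : Fin M × Bool} (hc : neighbor c = c) :
    |evenEnd c| = M := by
  obtain ⟨⟨q, hq⟩, b⟩ := c
  cases b
  · rcases Nat.eq_zero_or_pos q with rfl | h0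
    · simp [evenEnd]
    · simp [neighbor, h0] at hc
  · by_cases h : q + 1 < M
    · simp [neighbor, h] at hc
    · rw [abs_of_nonneg] <;> simp [evenEnd] <;> omega

/-- Reflection of a grid interval in the origin. -/
def mirror (c : Fin M × Bool) : Fin M × Bool := (Fin.rev c.1, !c.2)

lemma mirror_mirror (c : Fin M × Bool) : mirror (mirror c) = c := by simp [mirror]

lemma mirror_ne (c : Fin M × Bool) : mirror c ≠ c := fun h => by
  have := congrArg Prod.snd h
  simp [mirror] at this

lemma evenEnd_mirror (c : Fin M × Bool) : evenEnd (mirror c) = -evenEnd c := by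
  obtain ⟨⟨q, hq⟩, b⟩ := c
  cases b <;> simp [mirror, evenEnd, Fin.val_rev] <;> omega

lemma oddEnd_mirror (c : Fin M × Bool) : oddEnd (mirror c) = -oddEnd c := by
  obtain ⟨⟨q, hq⟩, b⟩ := c
  simp [mirror, oddEnd, Fin.val_rev]; omega

lemma neighbor_mirror (c : Fin M × Bool) (hc : neighbor c = c) :
    neighbor (mirror c) = mirror c := by
  obtain ⟨⟨q, hq⟩, b⟩ := c
  cases b
  · rcases Nat.eq_zero_or_pos q with rfl | h0
    · simp [neighbor, mirror]; omega
    · simp [neighbor, h0] at hc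
  · by_cases h : q + 1 < M
    · simp [neighbor, h] at hc
    · simp [neighbor, mirror]; omega

/-- Negate the coordinates in `A`. -/
def flip (A : Finset (Fin (D + 1))) (x : Fin (D + 1) → ℤ) : Fin (D + 1) → ℤ :=
  fun i => if i ∈ A then -x i else x i

def flipSimp (A : Finset (Fin (D + 1))) (σ : Simp D M) : Simp D M :=
  (fun i => if i ∈ A then mirror (σ.1 i) else σ.1 i, σ.2)

lemma vert_flipSimp (A : Finset (Fin (D + 1))) (σ : Simp D M) (k : ℕ) :
    vert (flipSimp A σ) k = flip A (vert σ k) := by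
  funext i
  by_cases h : i ∈ A <;> by_cases h' : (σ.2.symm i : ℕ) < k <;>
    simp [vert, flip, h, h', flipSimp, evenEnd_mirror, oddEnd_mirror]

/-- Sign data adapted to the boundary of the grid: odd on the `A`-faces, standard near the other
faces. -/
structure SignAdapted (M : ℕ) (A : Finset (Fin (D + 1))) (s : ℕ → (Fin (D + 1) → ℤ) → ZMod 2) :
    Prop where
  odd : ∀ x, (∀ k, |x k| ≤ (M : ℤ)) → (∃ k ∈ A, |x k| = (M : ℤ)) → (∀ k ∉ A, |x k| < (M : ℤ)) → ∀ i : Fin (D + 1),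
    s i (flip A x) = s i x + if i ∈ A then 1 else 0
  collar : ∀ x, (∀ k, |x k| ≤ (M : ℤ)) → (∃ k ∉ A, (M : ℤ) - 1 ≤ |x k|) → ∀ i ∈ A, |x i| = (M : ℤ) →
    s i x = if 0 < x i then 1 else 0
  standard : ∀ x, (∀ k, |x k| ≤ (M : ℤ)) → (∃ k ∉ A, |x k| = (M : ℤ)) →
    ∀ i : Fin (D + 1), s i x = if 0 < x i then 1 else 0

variable {A : Finset (Fin (D + 1))} {s : ℕ → (Fin (D + 1) → ℤ) → ZMod 2}

lemma edgeProd_eq_zero {X : Type*} {s : ℕ → X → ZMod 2} {n : ℕ} {y : ℕ → X} (i : ℕ) (hi : i < n)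
    (h : s i (y i) = s i (y (i + 1))) : edgeProd s n y = 0 :=
  Finset.prod_eq_zero (Finset.mem_range.2 hi) (by rw [h]; exact CharTwo.add_self_eq_zero _)

lemma vert_last (σ : Simp D M) {k : ℕ} (hk : k ≤ D) :
    vert σ k (σ.2 (Fin.last D)) = evenEnd (σ.1 (σ.2 (Fin.last D))) := by
  simp [vert, hk]

lemma face_flipSimp (hs : SignAdapted M A s) (hA : Fin.last D ∉ A) (σ : Simp D M)
    (hb : neighbor (σ.1 (σ.2 (Fin.last D))) = σ.1 (σ.2 (Fin.last D)))
    (hi : σ.2 (Fin.last D) ∈ A) : face s D (vert (flipSimp A σ)) = face s D (vert σ) := by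
  have hval := abs_evenEnd_of_neighbor_eq hb
  set j := σ.2 (Fin.last D) with hj
  have hjD : (j : ℕ) < D := by
    have : j ≠ Fin.last D := fun h => hA (h ▸ hi)
    have := Fin.val_lt_last this
    simpa using this
  by_cases hw : ∃ k ≤ D, ∃ i ∉ A, |vert σ k i| = M
  · obtain ⟨k, hk, i, hiA, hki⟩ := hw
    have hcol : ∀ l, (M : ℤ) - 1 ≤ |vert σ l i| := fun l => by
      have h1 := abs_vert_sub_le σ k l i
      have h2 := abs_sub_abs_le_abs_sub (vert σ k i) (vert σ l i)
      linarith
    have z1 : edgeProd s D (vert σ) = 0 := by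
      refine edgeProd_eq_zero j hjD ?_
      rw [hs.collar _ (abs_vert_le _ _) ⟨i, hiA, hcol _⟩ j hi (by rw [hj, vert_last σ hjD.le, ← hj, hval]),
        hs.collar _ (abs_vert_le _ _) ⟨i, hiA, hcol _⟩ j hi (by rw [hj, vert_last σ hjD, ← hj, hval])]
      rw [hj, vert_last σ hjD.le, vert_last σ hjD]
    have hcol' : ∀ l, (M : ℤ) - 1 ≤ |vert (flipSimp A σ) l i| := fun l => by
      rw [vert_flipSimp]; simpa [flip, hiA] using hcol l
    have hj' : ∀ l ≤ D, vert (flipSimp A σ) l j = -evenEnd (σ.1 j) := fun l hl => by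
      rw [vert_flipSimp, flip, if_pos hi, hj, vert_last σ hl]
    have z2 : edgeProd s D (vert (flipSimp A σ)) = 0 := by
      refine edgeProd_eq_zero j hjD ?_
      rw [hs.collar _ (abs_vert_le _ _) ⟨i, hiA, hcol' _⟩ j hi (by rw [hj' _ hjD.le, abs_neg, hval]),
        hs.collar _ (abs_vert_le _ _) ⟨i, hiA, hcol' _⟩ j hi (by rw [hj' _ hjD, abs_neg, hval]),
        hj' _ hjD.le, hj' _ hjD]
    simp [face, z1, z2]
  · push Not at hw
    have key : ∀ l ≤ D, ∀ i : Fin (D + 1), s i (vert (flipSimp A σ) l) =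
        s i (vert σ l) + if i ∈ A then 1 else 0 := fun l hl i => by
      rw [vert_flipSimp]
      refine hs.odd _ (abs_vert_le _ _) ⟨j, hi, ?_⟩ (fun k hk => ?_) i
      · rw [hj, vert_last σ hl, ← hj, hval]
      · exact lt_of_le_of_ne (abs_vert_le _ _ _) (hw l hl k hk)
    unfold face edgeProd
    congr 1
    · refine Finset.prod_congr rfl fun i hi' => ?_
      have hiD := Finset.mem_range.1 hi'
      have k1 := key i hiD.le ⟨i, by omega⟩
      have k2 := key (i + 1) hiD ⟨i, by omega⟩
      simp only at k1 k2
      rw [k1, k2]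
      split_ifs
      · have : (1 : ZMod 2) + 1 = 0 := by decide
        linear_combination this
      · simp
    · have := key D le_rfl (Fin.last D)
      simpa [hA] using this

lemma symm_one_apply (i : Fin (D + 1)) : Equiv.symm (1 : Equiv.Perm (Fin (D + 1))) i = i := rfl

/-- The only boundary facet that contributes. -/
def base (D L : ℕ) (hL : 0 < L) : Simp D (2 * L) :=
  (fun i => if i = Fin.last D then (⟨2 * L - 1, by omega⟩, true) else (⟨L, by omega⟩, false), 1)

lemma face_base {L : ℕ} (hL : 0 < L) (hs : SignAdapted (2 * L) A s) (hA : Fin.last D ∉ A) :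
    face s D (vert (base D L hL)) = 1 := by
  have hlast : ∀ k ≤ D, vert (base D L hL) k (Fin.last D) = (2 * L : ℕ) := fun k hk => by
    have := vert_last (base D L hL) hk
    simp only [base, Equiv.Perm.coe_one, id, if_true, evenEnd] at this ⊢
    rw [this]; push_cast; omega
  have hst : ∀ k ≤ D, ∀ i : Fin (D + 1), s i (vert (base D L hL) k) =
      if 0 < vert (base D L hL) k i then 1 else 0 := fun k hk =>
    hs.standard _ (abs_vert_le _ _) ⟨_, hA, by rw [hlast k hk]; exact abs_of_nonneg (by positivity)⟩
  have h1 : edgeProd s D (vert (base D L hL)) = 1 := by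
    refine Finset.prod_eq_one fun i hi => ?_
    have hiD := Finset.mem_range.1 hi
    have k1 := hst i hiD.le ⟨i, by omega⟩
    have k2 := hst (i + 1) hiD ⟨i, by omega⟩
    have hne : (⟨i, by omega⟩ : Fin (D + 1)) ≠ Fin.last D := by
      intro h; have := congrArg Fin.val h; simp at this; omega
    have v1 : vert (base D L hL) i ⟨i, by omega⟩ = 0 := by
      simp [vert, base, hne, evenEnd, symm_one_apply]
    have v2 : vert (base D L hL) (i + 1) ⟨i, by omega⟩ = 1 := by
      simp [vert, base, hne, oddEnd, symm_one_apply]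
    simp only [v1, v2] at k1 k2
    rw [k1, k2]; decide
  have h2 := hst D le_rfl (Fin.last D)
  rw [hlast D le_rfl] at h2
  rw [face, h1]
  simpa [hL] using h2

lemma face_eq_zero {L : ℕ} (hL : 0 < L) (hs : SignAdapted (2 * L) A s)
    (σ : Simp D (2 * L)) (hσ : σ ≠ base D L hL)
    (hb : neighbor (σ.1 (σ.2 (Fin.last D))) = σ.1 (σ.2 (Fin.last D)))
    (hi : σ.2 (Fin.last D) ∉ A) : face s D (vert σ) = 0 := by
  have hval := abs_evenEnd_of_neighbor_eq hb
  have hst : ∀ k ≤ D, ∀ i : Fin (D + 1), s i (vert σ k) =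
      if 0 < vert σ k i then 1 else 0 := fun k hk =>
    hs.standard _ (abs_vert_le _ _) ⟨_, hi, by rw [vert_last σ hk, hval]⟩
  by_cases hj : σ.2 (Fin.last D) = Fin.last D
  swap
  · have hjD : (σ.2 (Fin.last D) : ℕ) < D := by simpa using Fin.val_lt_last hj
    rw [face, edgeProd_eq_zero _ hjD, zero_mul]
    rw [hst _ hjD.le, hst _ hjD, vert_last σ hjD.le, vert_last σ hjD]
  by_contra hne
  apply hσ
  have hne1 := left_ne_zero_of_mul hne
  have hne2 := right_ne_zero_of_mul hne
  have hflip : ∀ i : Fin (D + 1), (i : ℕ) < D →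
      ¬ (0 < vert σ i i ↔ 0 < vert σ (i + 1) i) := fun i hiD h => by
    refine hne1 (edgeProd_eq_zero i hiD ?_)
    rw [hst i hiD.le i, hst (i + 1) hiD i]
    simp only [h]
  have hperm : ∀ i : Fin (D + 1), (i : ℕ) < D → σ.2.symm i = i := fun i hiD => by
    by_contra h
    apply hflip i hiD
    have : (σ.2.symm i : ℕ) ≠ i := fun h' => h (Fin.ext h')
    have : vert σ i i = vert σ (i + 1) i := by
      unfold vert
      split_ifs <;> first | rfl | omega
    rw [this]
  have hone : σ.2 = 1 := by
    ext1 i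
    by_cases hiD : (i : ℕ) < D
    · have := hperm i hiD
      rw [Equiv.symm_apply_eq] at this
      simpa using this.symm
    · have : i = Fin.last D := Fin.ext (by simp; omega)
      rw [this, hj]; rfl
  have hlast := hst D le_rfl (Fin.last D)
  have hDl : vert σ D (Fin.last D) = evenEnd (σ.1 (Fin.last D)) := by
    have := vert_last σ le_rfl
    rwa [hj] at this
  rw [hDl] at hlast
  have hpos : 0 < evenEnd (σ.1 (Fin.last D)) := by
    by_contra h
    rw [if_neg h] at hlast
    exact hne2 (by simpa using hlast)
  rw [hj] at hval
  ext1
  · funext i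
    by_cases hiD : (i : ℕ) < D
    · have h := hflip i hiD
      have hne : i ≠ Fin.last D := by rintro rfl; simp at hiD
      simp only [vert, hone, symm_one_apply, lt_irrefl, if_false,
        Nat.lt_succ_self, if_true] at h
      simp only [base, hne, if_false]
      generalize σ.1 i = c at h
      obtain ⟨⟨q, hq⟩, b⟩ := c
      cases b
      · simp [evenEnd, oddEnd] at h
        simp; omega
      · simp [evenEnd, oddEnd] at h
        omega
    · have : i = Fin.last D := Fin.ext (by simp; omega)
      subst this
      simp only [base, if_true]
      generalize σ.1 (Fin.last D) = c at hval hpos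
      rw [abs_of_pos hpos] at hval
      obtain ⟨⟨q, hq⟩, b⟩ := c
      cases b
      · simp [evenEnd] at hval; omega
      · simp [evenEnd] at hval; simp; omega
  · exact hone

lemma sum_face_skip_top {L : ℕ} (hL : 0 < L) (hs : SignAdapted (2 * L) A s) (hA : Fin.last D ∉ A) :
    ∑ σ : Simp D (2 * L), face s D (vert σ ∘ skip (D + 1)) = 1 := by
  have hface : ∀ σ : Simp D (2 * L), face s D (vert σ ∘ skip (D + 1)) = face s D (vert σ) :=
    fun σ => by
      rw [face, face, edgeProd_skip_last]
      simp [skip]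
  simp only [hface]
  classical
  rw [← Finset.add_sum_erase _ _ (Finset.mem_univ (base D L hL)), face_base hL hs hA]
  have hbb : neighbor ((base D L hL).1 ((base D L hL).2 (Fin.last D))) =
      (base D L hL).1 ((base D L hL).2 (Fin.last D)) := by
    simp [base, neighbor]; omega
  have hbA : (base D L hL).2 (Fin.last D) ∉ A := by simpa [base] using hA
  let T : Simp D (2 * L) → Simp D (2 * L) := fun σ =>
    if neighbor (σ.1 (σ.2 (Fin.last D))) = σ.1 (σ.2 (Fin.last D)) then
      (if σ.2 (Fin.last D) ∈ A then flipSimp A σ else σ)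
    else (Function.update σ.1 (σ.2 (Fin.last D)) (neighbor (σ.1 (σ.2 (Fin.last D)))), σ.2)
  have hTT : ∀ σ, T (T σ) = σ := fun σ => by
    by_cases hb : neighbor (σ.1 (σ.2 (Fin.last D))) = σ.1 (σ.2 (Fin.last D))
    · by_cases hi : σ.2 (Fin.last D) ∈ A
      · have h1 : T σ = flipSimp A σ := by simp [T, hb, hi]
        rw [h1]
        have hb' := neighbor_mirror _ hb
        have h2 : T (flipSimp A σ) = flipSimp A (flipSimp A σ) := by
          simp only [T]
          rw [if_pos (by simpa [flipSimp, hi] using hb'), if_pos (by simpa [flipSimp] using hi)]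
        rw [h2]
        ext1
        · funext i
          by_cases hiA : i ∈ A <;> simp [flipSimp, hiA, mirror_mirror]
        · rfl
      · have h1 : T σ = σ := by simp [T, hb, hi]
        rw [h1, h1]
    · have h1 : T σ = (Function.update σ.1 (σ.2 (Fin.last D))
        (neighbor (σ.1 (σ.2 (Fin.last D)))), σ.2) := by simp [T, hb]
      rw [h1]
      simp only [T, Function.update_self, neighbor_neighbor]
      rw [if_neg (fun h => hb h.symm)]
      ext1
      · simp
      · rfl
  have hTb : T (base D L hL) = base D L hL := by
    simp only [T]
    rw [if_pos hbb, if_neg hbA]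
  rw [Finset.sum_involution (fun σ _ => T σ), add_zero]
  · intro σ hσ
    have hσ := (Finset.mem_erase.1 hσ).1
    by_cases hb : neighbor (σ.1 (σ.2 (Fin.last D))) = σ.1 (σ.2 (Fin.last D))
    · by_cases hi : σ.2 (Fin.last D) ∈ A
      · simp only [T, hb, hi, if_true]
        rw [face_flipSimp hs hA σ hb hi]
        exact CharTwo.add_self_eq_zero _
      · simp only [T, hb, hi, if_true, if_false]
        exact CharTwo.add_self_eq_zero _
    · simp only [T, hb, if_false]
      have : face s D (vert (Function.update σ.1 (σ.2 (Fin.last D))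
        (neighbor (σ.1 (σ.2 (Fin.last D)))), σ.2)) = face s D (vert σ) := by
        have hv : ∀ k ≤ D, vert (Function.update σ.1 (σ.2 (Fin.last D))
            (neighbor (σ.1 (σ.2 (Fin.last D)))), σ.2) k = vert σ k := fun k hk => by
          funext i
          simp only [vert]
          by_cases hi : i = σ.2 (Fin.last D)
          · subst hi
            simp [evenEnd_neighbor, not_lt_of_ge hk]
          · simp [Function.update_of_ne hi]
        rw [face, face, edgeProd_congr s D hv, hv D le_rfl]
      rw [this]
      exact CharTwo.add_self_eq_zero _
  · intro σ hσ hne h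
    have hσ := (Finset.mem_erase.1 hσ).1
    by_cases hb : neighbor (σ.1 (σ.2 (Fin.last D))) = σ.1 (σ.2 (Fin.last D))
    · by_cases hi : σ.2 (Fin.last D) ∈ A
      · simp only [T, hb, hi, if_true] at h
        have := congrFun (congrArg Prod.fst h) (σ.2 (Fin.last D))
        simp only [flipSimp, hi, if_true] at this
        exact mirror_ne _ this
      · exact hne (face_eq_zero hL hs σ hσ hb hi)
    · simp only [T, hb, if_false] at h
      have := congrFun (congrArg Prod.fst h) (σ.2 (Fin.last D))
      simp only [Function.update_self] at this
      exact hb this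
  · intro σ hσ
    refine Finset.mem_erase.2 ⟨fun h => (Finset.mem_erase.1 hσ).1 ?_, Finset.mem_univ _⟩
    rw [← hTT σ, h, hTb]
  · intro σ _
    exact hTT σ

theorem exists_full_simplex {L : ℕ} (hL : 0 < L) (hs : SignAdapted (2 * L) A s)
    (hA : Fin.last D ∉ A) :
    ∃ x : ℕ → Fin (D + 1) → ℤ, (∀ k i, |x k i| ≤ (2 * L : ℕ)) ∧ (∀ k l i, |x k i - x l i| ≤ 1) ∧
      ∀ i : Fin (D + 1), s i (x i) ≠ s i (x (i + 1)) := by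
  have h1 : ∑ σ : Simp D (2 * L), edgeProd s (D + 1) (vert σ) = 1 := by
    simp only [← sum_face_skip]
    rw [Finset.sum_comm, Finset.sum_range_succ, sum_face_skip_top hL hs hA,
      Finset.sum_range_succ', sum_face_skip_zero, Finset.sum_eq_zero, zero_add, zero_add]
    exact fun j hj => sum_face_skip_mid s j (Finset.mem_range.1 hj)
  obtain ⟨σ, -, hσ⟩ := Finset.exists_ne_zero_of_sum_ne_zero (h1.trans_ne one_ne_zero)
  refine ⟨vert σ, abs_vert_le σ, abs_vert_sub_le σ, fun i h => hσ ?_⟩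
  exact edgeProd_eq_zero i i.2 h

/-- The cube `[-1,1]^d`. -/
def cube (ι : Type*) : Set (ι → ℝ) := {x | ∀ i, |x i| ≤ 1}

lemma isCompact_cube (ι : Type*) : IsCompact (cube ι) := by
  have : cube ι = Set.pi univ fun _ => Icc (-1 : ℝ) 1 := by
    ext x; simp only [cube, abs_le, Set.mem_ofPred_eq, mem_univ_pi, mem_Icc]
  rw [this]
  exact isCompact_univ_pi fun _ => isCompact_Icc

/-- Negate the coordinates in `A` (real version of `flip`). -/
def flipR {ι : Type*} [DecidableEq ι] (A : Finset ι) (x : ι → ℝ) : ι → ℝ :=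
  fun i => if i ∈ A then -x i else x i

/-- The point of the cube with grid coordinates `x`. -/
def pt (L : ℕ) (x : Fin (D + 1) → ℤ) : Fin (D + 1) → ℝ := fun i => x i / (2 * L : ℕ)

/-- The first nonzero `A`-coordinate is positive. -/
def FirstPos (A : Finset (Fin (D + 1))) (x : Fin (D + 1) → ℤ) : Prop :=
  ∃ k ∈ A, 0 < x k ∧ ∀ l ∈ A, l < k → x l = 0

lemma firstPos_flip (x : Fin (D + 1) → ℤ) (hx : ∃ k ∈ A, x k ≠ 0) :
    FirstPos A (flip A x) ↔ ¬ FirstPos A x := by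
  classical
  have hne : (A.filter fun k => x k ≠ 0).Nonempty := by
    obtain ⟨k, hk, hk'⟩ := hx
    exact ⟨k, Finset.mem_filter.2 ⟨hk, hk'⟩⟩
  set m := (A.filter fun k => x k ≠ 0).min' hne with hm
  have hmm := Finset.mem_filter.1 (Finset.min'_mem _ hne)
  rw [← hm] at hmm
  have hlow : ∀ l ∈ A, l < m → x l = 0 := fun l hl hlm => by
    by_contra h
    have := Finset.min'_le (A.filter fun k => x k ≠ 0) l (Finset.mem_filter.2 ⟨hl, h⟩)
    rw [← hm] at this
    exact absurd hlm (not_lt.2 this)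
  have key : ∀ y : Fin (D + 1) → ℤ, (∀ l ∈ A, y l = 0 ↔ x l = 0) → (FirstPos A y ↔ 0 < y m) := by
    intro y hy
    constructor
    · rintro ⟨k, hk, hpos, hl⟩
      rcases lt_trichotomy k m with h | h | h
      · have := (hy k hk).2 (hlow k hk h); omega
      · rwa [← h]
      · exact absurd ((hy m hmm.1).1 (hl m hmm.1 h)) hmm.2
    · exact fun h => ⟨m, hmm.1, h, fun l hl hlm => (hy l hl).2 (hlow l hl hlm)⟩
  rw [key (flip A x) fun l hl => by simp [flip, hl], key x fun l _ => Iff.rfl]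
  simp only [flip, hmm.1, if_true]
  have := hmm.2
  omega

/-- Positivity of a vector field at a grid point, with the tie-break on the `A`-coordinates. -/
def PosAt (A : Finset (Fin (D + 1))) (G : (Fin (D + 1) → ℝ) → Fin (D + 1) → ℝ) (L : ℕ)
    (x : Fin (D + 1) → ℤ) (i : Fin (D + 1)) : Prop :=
  0 < G (pt L x) i ∨ (G (pt L x) i = 0 ∧ i ∈ A ∧ FirstPos A x ∧
      ∀ k ∉ A, |x k| < ((2 * L : ℕ) : ℤ))

open Classical in
/-- Sign bits of a vector field at grid points. -/
def bit (A : Finset (Fin (D + 1))) (G : (Fin (D + 1) → ℝ) → Fin (D + 1) → ℝ) (L : ℕ) (i : ℕ)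
    (x : Fin (D + 1) → ℤ) : ZMod 2 :=
  if h : i < D + 1 then if PosAt A G L x ⟨i, h⟩ then 1 else 0 else 0

open Classical in
lemma bit_fin (G : (Fin (D + 1) → ℝ) → Fin (D + 1) → ℝ) (L : ℕ) (i : Fin (D + 1))
    (x : Fin (D + 1) → ℤ) : bit A G L i x = if PosAt A G L x i then 1 else 0 := by
  simp [bit, i.2, -Order.lt_add_one_iff]

open Classical in
lemma bit_adapted {L : ℕ} (hL : 0 < L) (G : (Fin (D + 1) → ℝ) → Fin (D + 1) → ℝ)
    (hodd : ∀ x ∈ cube (Fin (D + 1)), (∃ k ∈ A, |x k| = 1) → G (flipR A x) = flipR A (G x))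
    (hcol : ∀ x ∈ cube (Fin (D + 1)), (∃ k ∉ A, 1 / 2 ≤ |x k|) →
      ∀ i, ∃ r > 0, G x i = r * x i) :
    SignAdapted (2 * L) A (bit A G L) := by
  have hLpos : (0 : ℝ) < (2 * L : ℕ) := by positivity
  have hcube : ∀ x : Fin (D + 1) → ℤ, (∀ k, |x k| ≤ ((2 * L : ℕ) : ℤ)) →
      pt L x ∈ cube (Fin (D + 1)) := fun x hx i => by
    have : |(x i : ℝ)| ≤ (2 * L : ℕ) := by exact_mod_cast hx i
    simp only [pt, abs_div, abs_of_pos hLpos]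
    exact (div_le_one hLpos).2 this
  have habs : ∀ (x : Fin (D + 1) → ℤ) k, |x k| = ((2 * L : ℕ) : ℤ) → |pt L x k| = 1 :=
    fun x k hx => by
      have : |(x k : ℝ)| = (2 * L : ℕ) := by exact_mod_cast hx
      simp only [pt, abs_div, abs_of_pos hLpos, this]
      exact div_self hLpos.ne'
  have hpos : ∀ (x : Fin (D + 1) → ℤ) i, 0 < pt L x i ↔ 0 < x i := fun x i => by
    simp only [pt]
    rw [div_pos_iff_of_pos_right hLpos]
    exact Int.cast_pos
  refine ⟨?_, ?_, ?_⟩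
  · intro x hx hA hw i
    have hf : pt L (flip A x) = flipR A (pt L x) := by
      funext k
      simp only [pt, flip, flipR]
      split_ifs <;> simp [neg_div]
    have hG := hodd _ (hcube x hx) (hA.imp fun k hk => ⟨hk.1, habs x k hk.2⟩)
    have hfp : FirstPos A (flip A x) ↔ ¬ FirstPos A x := by
      refine firstPos_flip x (hA.imp fun k hk => ⟨hk.1, fun h => ?_⟩)
      have := hk.2
      rw [h] at this
      simp at this
      omega
    have hw' : ∀ k ∉ A, |flip A x k| < ((2 * L : ℕ) : ℤ) := fun k hk => by
      simpa [flip, hk] using hw k hk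
    by_cases hi : i ∈ A
    · have key : PosAt A G L (flip A x) i ↔ ¬ PosAt A G L x i := by
        simp only [PosAt, hf, hG, hfp, flipR, hi, if_true, true_and, neg_pos, neg_eq_zero]
        rw [and_iff_left hw', and_iff_left hw]
        rcases lt_trichotomy (G (pt L x) i) 0 with h | h | h
        · simp [h, h.not_gt, h.ne]
        · simp [h]
        · simp [h, h.not_gt, h.ne']
      have h2 : (1 : ZMod 2) + 1 = 0 := by decide
      rw [bit_fin, bit_fin, if_pos hi]
      by_cases hp : PosAt A G L x i
      · rw [if_neg (fun h => key.1 h hp), if_pos hp, h2]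
      · rw [if_pos (key.2 hp), if_neg hp, zero_add]
    · have key : PosAt A G L (flip A x) i ↔ PosAt A G L x i := by
        simp only [PosAt, hf, hG, flipR, hi, if_false, false_and, and_false]
      rw [bit_fin, bit_fin, if_neg hi, add_zero]
      simp only [key]
  · intro x hx ⟨k, hk, hkM⟩ i hi hiM
    obtain ⟨r, hr, hG⟩ := hcol _ (hcube x hx) ⟨k, hk, by
      have h1 : ((2 * L : ℕ) : ℝ) - 1 ≤ |(x k : ℝ)| := by exact_mod_cast hkM
      have h2 : (1 : ℝ) ≤ L := by exact_mod_cast hL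
      simp only [pt, abs_div, abs_of_pos hLpos]
      rw [le_div_iff₀ hLpos]
      push_cast at h1 ⊢
      linarith⟩ i
    have hne : G (pt L x) i ≠ 0 := by
      rw [hG]
      refine mul_ne_zero hr.ne' fun h => ?_
      have := habs x i hiM
      rw [h] at this
      simp at this
    have key : PosAt A G L x i ↔ 0 < x i := by
      simp only [PosAt, hne, false_and, or_false]
      rw [hG, mul_pos_iff_of_pos_left hr, hpos]
    rw [bit_fin]
    simp only [key]
  · intro x hx ⟨k, hk, hkM⟩ i
    obtain ⟨r, hr, hG⟩ := hcol _ (hcube x hx) ⟨k, hk, by rw [habs x k hkM]; norm_num⟩ i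
    have hn : ¬ ∀ k ∉ A, |x k| < ((2 * L : ℕ) : ℤ) := fun h => (h k hk).ne hkM
    have key : PosAt A G L x i ↔ 0 < x i := by
      simp only [PosAt, hn, and_false, or_false]
      rw [hG, mul_pos_iff_of_pos_left hr, hpos]
    rw [bit_fin]
    simp only [key]

theorem exists_zero_fin (hA : Fin.last D ∉ A) (G : (Fin (D + 1) → ℝ) → Fin (D + 1) → ℝ)
    (hG : ContinuousOn G (cube (Fin (D + 1))))
    (hodd : ∀ x ∈ cube (Fin (D + 1)), (∃ k ∈ A, |x k| = 1) → G (flipR A x) = flipR A (G x))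
    (hcol : ∀ x ∈ cube (Fin (D + 1)), (∃ k ∉ A, 1 / 2 ≤ |x k|) →
      ∀ i, ∃ r > 0, G x i = r * x i) :
    ∃ x ∈ cube (Fin (D + 1)), G x = 0 := by
  by_contra! hno
  have hne : (cube (Fin (D + 1))).Nonempty := ⟨0, fun i => by simp⟩
  obtain ⟨x₀, hx₀, hmin⟩ := (isCompact_cube _).exists_isMinOn hne hG.norm
  have hm : 0 < ‖G x₀‖ := norm_pos_iff.2 (hno x₀ hx₀)
  have huc := (isCompact_cube _).uniformContinuousOn_of_continuous hG
  obtain ⟨δ, hδ, hd⟩ := Metric.uniformContinuousOn_iff.1 huc _ hm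
  obtain ⟨L₀, hL₀⟩ := exists_nat_gt (1 / δ)
  set L := L₀ + 1 with hLdef
  have hL : 0 < L := by omega
  have hLpos : (0 : ℝ) < (2 * L : ℕ) := by positivity
  have hsmall : 1 / ((2 * L : ℕ) : ℝ) < δ := by
    rw [div_lt_comm₀ hLpos hδ]
    refine hL₀.trans ?_
    rw [hLdef]; push_cast
    have : (0 : ℝ) ≤ L₀ := by positivity
    linarith
  obtain ⟨x, hx, hxd, hbit⟩ := exists_full_simplex hL (bit_adapted hL G hodd hcol) hA
  have hcube : ∀ k, pt L (x k) ∈ cube (Fin (D + 1)) := fun k i => by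
    have : |(x k i : ℝ)| ≤ (2 * L : ℕ) := by exact_mod_cast hx k i
    simp only [pt, abs_div, abs_of_pos hLpos]
    exact (div_le_one hLpos).2 this
  have hdist : ∀ k l, dist (pt L (x k)) (pt L (x l)) < δ := fun k l => by
    refine lt_of_le_of_lt ((dist_pi_le_iff (by positivity)).2 fun i => ?_) hsmall
    have : |(x k i : ℝ) - x l i| ≤ 1 := by exact_mod_cast hxd k l i
    simp only [pt, Real.dist_eq, ← sub_div, abs_div, abs_of_pos hLpos]
    gcongr
  have hclose : ∀ k i, |G (pt L (x k)) i - G (pt L (x 0)) i| < ‖G x₀‖ := fun k i => by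
    have := hd _ (hcube k) _ (hcube 0) (hdist k 0)
    rw [dist_eq_norm] at this
    exact lt_of_le_of_lt (norm_le_pi_norm (G (pt L (x k)) - G (pt L (x 0))) i) this
  have hb1 : ∀ k (i : Fin (D + 1)), bit A G L i (x k) ≠ 0 → 0 ≤ G (pt L (x k)) i := by
    intro k i h
    classical
    rw [bit_fin] at h
    have := (ite_ne_right_iff.1 h).1
    rcases this with h | h
    · exact h.le
    · exact h.1.ge
  have hb0 : ∀ k (i : Fin (D + 1)), bit A G L i (x k) = 0 → G (pt L (x k)) i ≤ 0 := by
    intro k i h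
    by_contra hcon
    push Not at hcon
    simp [bit_fin, PosAt, hcon] at h
  have hfin : ‖G (pt L (x 0))‖ < ‖G x₀‖ := by
    refine (pi_norm_lt_iff hm).2 fun i => ?_
    rw [Real.norm_eq_abs, abs_lt]
    have h1 := abs_lt.1 (hclose i i)
    have h2 := abs_lt.1 (hclose (i + 1) i)
    by_cases h : bit A G L i (x i) = 0
    · have g1 := hb0 _ _ h
      have g2 := hb1 _ _ (h ▸ hbit i).symm
      constructor <;> linarith
    · have g1 := hb1 _ _ h
      have g2 : G (pt L (x (i + 1))) i ≤ 0 := by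
        refine hb0 _ _ ?_
        have := hbit i
        revert this h
        generalize bit A G L i (x i) = u
        generalize bit A G L i (x (i + 1)) = v
        revert u v; decide
      constructor <;> linarith
  exact absurd (hmin (hcube 0)) (not_le.2 hfin)

/-- A parametrised Borsuk-Ulam theorem on the cube. -/
theorem exists_zero {α β : Type*} [Fintype α] [Fintype β] [Nonempty β]
    (G : (α ⊕ β → ℝ) → α ⊕ β → ℝ) (hG : ContinuousOn G (cube (α ⊕ β)))
    (hodd : ∀ x ∈ cube (α ⊕ β), (∃ a, |x (.inl a)| = 1) →
      G (Sum.elim (fun a => -x (.inl a)) (fun b => x (.inr b))) =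
        Sum.elim (fun a => -G x (.inl a)) (fun b => G x (.inr b)))
    (hcol : ∀ x ∈ cube (α ⊕ β), (∃ b, 1 / 2 ≤ |x (.inr b)|) → ∀ i, ∃ r > 0, G x i = r * x i) :
    ∃ x ∈ cube (α ⊕ β), G x = 0 := by
  classical
  obtain ⟨b₀⟩ := ‹Nonempty β›
  obtain ⟨D, hD⟩ : ∃ D, Fintype.card (α ⊕ β) = D + 1 :=
    Nat.exists_eq_succ_of_ne_zero (Fintype.card_pos_iff.2 ⟨.inr b₀⟩).ne'
  let e₀ : α ⊕ β ≃ Fin (D + 1) := Fintype.equivFinOfCardEq hD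
  let e : α ⊕ β ≃ Fin (D + 1) := e₀.trans (Equiv.swap (e₀ (.inr b₀)) (Fin.last D))
  have he : e (.inr b₀) = Fin.last D := by simp [e]
  let A : Finset (Fin (D + 1)) := Finset.univ.filter fun i => (e.symm i).isLeft
  have hmem : ∀ i, i ∈ A ↔ (e.symm i).isLeft := fun i => by simp [A]
  have hlast : Fin.last D ∉ A := by rw [hmem, ← he]; simp
  have hc : ∀ x ∈ cube (Fin (D + 1)), (fun i => x (e i)) ∈ cube (α ⊕ β) := fun x hx i => hx _
  have hflip : ∀ x : Fin (D + 1) → ℝ, (fun i => flipR A x (e i)) =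
      Sum.elim (fun a => -x (e (.inl a))) (fun b => x (e (.inr b))) := fun x => by
    funext i
    rcases i with a | b <;> simp [flipR, hmem]
  obtain ⟨x, hx, h0⟩ := exists_zero_fin hlast (fun x i => G (fun j => x (e j)) (e.symm i)) (by
      refine continuousOn_pi.2 fun i => ?_
      refine (continuousOn_pi.1 hG (e.symm i)).comp (Continuous.continuousOn (by fun_prop)) hc)
    (by
      rintro x hx ⟨k, hk, hk1⟩
      funext i
      obtain ⟨a, ha⟩ := Sum.isLeft_iff.1 ((hmem k).1 hk)
      rw [hflip, hodd _ (hc x hx) ⟨a, by simpa [← ha] using hk1⟩]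
      simp only [flipR, hmem]
      rcases h : e.symm i with a | b <;> simp)
    (by
      rintro x hx ⟨k, hk, hk1⟩ i
      rw [hmem, Bool.not_eq_true, Sum.isLeft_eq_false, Sum.isRight_iff] at hk
      obtain ⟨b, hb⟩ := hk
      simpa using hcol _ (hc x hx) ⟨b, by simpa [← hb] using hk1⟩ (e.symm i))
  refine ⟨_, hc x hx, funext fun i => ?_⟩
  simpa using congrFun h0 (e i)

end SignCochain

namespace Minimax

section Step
variable {Z W : Type*} [NormedAddCommGroup Z] [InnerProductSpace ℝ Z]
  [NormedAddCommGroup W] [InnerProductSpace ℝ W]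

/-- The component of `g` tangent to the sphere of radius `ρ` at `z`. -/
def tang (ρ : ℝ) (z g : Z) : Z := g - (inner ℝ g z / ρ ^ 2) • z

/-- Radial projection to the ball of radius `ρ`. -/
def proj (ρ : ℝ) (z : Z) : Z := (ρ / max ‖z‖ ρ) • z

lemma tang_neg (ρ : ℝ) (z g : Z) : tang ρ (-z) (-g) = -tang ρ z g := by
  simp only [tang, inner_neg_neg, smul_neg]; abel

lemma proj_neg (ρ : ℝ) (z : Z) : proj ρ (-z) = -proj ρ z := by
  simp [proj]

lemma inner_tang_self {ρ : ℝ} (hρ : 0 < ρ) {z : Z} (hz : ‖z‖ = ρ) (g : Z) :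
    inner ℝ (tang ρ z g) z = 0 := by
  simp only [tang, inner_sub_left, real_inner_smul_left, real_inner_self_eq_norm_sq, hz]
  field_simp; ring

lemma inner_tang {ρ : ℝ} (hρ : 0 < ρ) {z : Z} (hz : ‖z‖ = ρ) (g : Z) :
    inner ℝ g (tang ρ z g) = ‖tang ρ z g‖ ^ 2 := by
  have h : g = tang ρ z g + (inner ℝ g z / ρ ^ 2) • z := by simp [tang]
  have h' : inner ℝ g (tang ρ z g) =
      inner ℝ (tang ρ z g + (inner ℝ g z / ρ ^ 2) • z) (tang ρ z g) :=
    congrArg (fun y => inner ℝ y (tang ρ z g)) h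
  rw [h', inner_add_left, real_inner_smul_left, real_inner_comm (tang ρ z g) z,
    inner_tang_self hρ hz, real_inner_self_eq_norm_sq, mul_zero, add_zero]

lemma norm_tang_le {ρ : ℝ} (hρ : 0 < ρ) {z : Z} (hz : ‖z‖ = ρ) (g : Z) :
    ‖tang ρ z g‖ ≤ ‖g‖ := by
  have h1 := inner_tang hρ hz g
  have h2 := real_inner_le_norm g (tang ρ z g)
  rcases (norm_nonneg (tang ρ z g)).eq_or_lt with h | h
  · rw [← h]; exact norm_nonneg _
  · nlinarith

lemma norm_step_sq {ρ : ℝ} (hρ : 0 < ρ) {z : Z} (hz : ‖z‖ = ρ) (g : Z) (h : ℝ) :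
    ‖z - h • tang ρ z g‖ ^ 2 = ρ ^ 2 + h ^ 2 * ‖tang ρ z g‖ ^ 2 := by
  rw [norm_sub_sq_real, hz, real_inner_smul_right, real_inner_comm, inner_tang_self hρ hz,
    norm_smul, mul_pow, Real.norm_eq_abs, sq_abs]
  ring

lemma le_norm_step {ρ : ℝ} (hρ : 0 < ρ) {z : Z} (hz : ‖z‖ = ρ) (g : Z) (h : ℝ) :
    ρ ≤ ‖z - h • tang ρ z g‖ := by
  refine le_of_sq_le_sq ?_ (norm_nonneg _)
  rw [norm_step_sq hρ hz]
  nlinarith [mul_nonneg (sq_nonneg h) (sq_nonneg ‖tang ρ z g‖)]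

lemma norm_proj {ρ : ℝ} (hρ : 0 < ρ) {z : Z} (hz : ρ ≤ ‖z‖) : ‖proj ρ z‖ = ρ := by
  have hz0 : 0 < ‖z‖ := hρ.trans_le hz
  rw [proj, max_eq_left hz, norm_smul, Real.norm_eq_abs, abs_of_pos (by positivity)]
  field_simp

/-- One projected gradient step decreases a function with a quadratic upper bound. -/
lemma step_decrease {ρ C h : ℝ} (hρ : 0 < ρ) (hC : 0 ≤ C) (hh : 0 ≤ h)
    (hsmall : h * (C / (2 * ρ) + 4 * C) ≤ 1 / 2) {f : Z → W → ℝ} {z : Z} {w : W} {g : Z} {k : W}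
    (hz : ‖z‖ = ρ) (hg : ‖g‖ ≤ C)
    (hquad : ∀ z' w', ‖z'‖ = ρ → f z' w' ≤ f z w + inner ℝ g (z' - z) + inner ℝ k (w' - w) +
      C * (‖z' - z‖ ^ 2 + ‖w' - w‖ ^ 2)) :
    f (proj ρ (z - h • tang ρ z g)) (w - h • k) ≤
      f z w - h / 2 * (‖tang ρ z g‖ ^ 2 + ‖k‖ ^ 2) := by
  set t := tang ρ z g with ht
  set y := z - h • t with hy
  have hle : ρ ≤ ‖y‖ := le_norm_step hρ hz g h
  have hy0 : 0 < ‖y‖ := hρ.trans_le hle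
  have hsq : ‖y‖ ^ 2 = ρ ^ 2 + h ^ 2 * ‖t‖ ^ 2 := norm_step_sq hρ hz g h
  have htC : ‖t‖ ≤ C := (norm_tang_le hρ hz g).trans hg
  set e := proj ρ y - y with he
  have hnorm_e : ‖e‖ ≤ h ^ 2 * ‖t‖ ^ 2 / (2 * ρ) := by
    have : e = (ρ / ‖y‖ - 1) • y := by rw [he, proj, max_eq_left hle, sub_smul, one_smul]
    rw [this, norm_smul, Real.norm_eq_abs, abs_of_nonpos (by
      rw [sub_nonpos]; exact (div_le_one hy0).2 hle)]
    have : -(ρ / ‖y‖ - 1) * ‖y‖ = ‖y‖ - ρ := by field_simp; ring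
    rw [this, le_div_iff₀ (by positivity)]
    nlinarith [sq_nonneg (‖y‖ - ρ)]
  have hdz : proj ρ y - z = e - h • t := by rw [he, hy]; abel
  have hq := hquad (proj ρ y) (w - h • k) (norm_proj hρ hle)
  have hw : w - h • k - w = -(h • k) := by abel
  have i1 : inner ℝ g (proj ρ y - z) ≤ C * (h ^ 2 * ‖t‖ ^ 2 / (2 * ρ)) - h * ‖t‖ ^ 2 := by
    rw [hdz, inner_sub_right, real_inner_smul_right, inner_tang hρ hz]
    have : inner ℝ g e ≤ C * (h ^ 2 * ‖t‖ ^ 2 / (2 * ρ)) :=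
      (real_inner_le_norm _ _).trans (mul_le_mul hg hnorm_e (norm_nonneg _) hC)
    linarith
  have i2 : inner ℝ k (w - h • k - w) = -(h * ‖k‖ ^ 2) := by
    rw [hw, inner_neg_right, real_inner_smul_right, real_inner_self_eq_norm_sq]
  have i3 : ‖w - h • k - w‖ ^ 2 = h ^ 2 * ‖k‖ ^ 2 := by
    rw [hw, norm_neg, norm_smul, mul_pow, Real.norm_eq_abs, sq_abs]
  have hhC : h * C ≤ 2 * ρ := by
    have h1 : h * (C / (2 * ρ)) ≤ 1 / 2 := by nlinarith [mul_nonneg hh hC]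
    have h2 : h * C = h * (C / (2 * ρ)) * (2 * ρ) := by field_simp
    rw [h2]; nlinarith
  have i4 : ‖proj ρ y - z‖ ≤ 2 * (h * ‖t‖) := by
    rw [hdz]
    refine (norm_sub_le _ _).trans ?_
    rw [norm_smul, Real.norm_eq_abs, abs_of_nonneg hh]
    have : h ^ 2 * ‖t‖ ^ 2 / (2 * ρ) ≤ h * ‖t‖ := by
      rw [div_le_iff₀ (by positivity)]
      have := mul_le_mul_of_nonneg_left htC hh
      nlinarith [mul_nonneg hh (norm_nonneg t)]
    linarith
  have i5 : ‖proj ρ y - z‖ ^ 2 ≤ 4 * (h ^ 2 * ‖t‖ ^ 2) := by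
    have := pow_le_pow_left₀ (norm_nonneg _) i4 2
    linarith [this, (by ring : (2 * (h * ‖t‖)) ^ 2 = 4 * (h ^ 2 * ‖t‖ ^ 2))]
  rw [i2, i3] at hq
  have i6 := mul_le_mul_of_nonneg_left i5 hC
  have i7 : C * (h ^ 2 * ‖t‖ ^ 2 / (2 * ρ)) + C * (4 * (h ^ 2 * ‖t‖ ^ 2)) ≤
      h / 2 * ‖t‖ ^ 2 := by
    have : C * (h ^ 2 * ‖t‖ ^ 2 / (2 * ρ)) + C * (4 * (h ^ 2 * ‖t‖ ^ 2)) =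
        h * (C / (2 * ρ) + 4 * C) * (h * ‖t‖ ^ 2) := by ring
    rw [this]
    nlinarith [mul_nonneg hh (sq_nonneg ‖t‖)]
  have i8 : C * (h ^ 2 * ‖k‖ ^ 2) ≤ h / 2 * ‖k‖ ^ 2 := by
    have h1 : h * C ≤ 1 / 2 := by
      have : 0 ≤ h * (C / (2 * ρ)) := by positivity
      nlinarith [mul_nonneg hh hC]
    nlinarith [mul_nonneg hh (sq_nonneg ‖k‖)]
  linarith

end Step

variable {ιz ιw : Type*} [Fintype ιz] [Fintype ιw]

/-- `j` projected gradient steps of size `h`, at parameters `0, ε, 2ε, …`. -/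
def iter (ρ ε : ℝ) (gz : ℝ → EuclideanSpace ℝ ιz → EuclideanSpace ℝ ιw → EuclideanSpace ℝ ιz) (gw : ℝ → EuclideanSpace ℝ ιz → EuclideanSpace ℝ ιw → EuclideanSpace ℝ ιw) (h : ℝ) (x : EuclideanSpace ℝ ιz × EuclideanSpace ℝ ιw) :
    ℕ → EuclideanSpace ℝ ιz × EuclideanSpace ℝ ιw
  | 0 => x
  | j + 1 =>
    let y := iter ρ ε gz gw h x j
    (proj ρ (y.1 - h • tang ρ y.1 (gz (j * ε) y.1 y.2)), y.2 - h • gw (j * ε) y.1 y.2)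

variable {ρ : ℝ} {gz : ℝ → EuclideanSpace ℝ ιz → EuclideanSpace ℝ ιw → EuclideanSpace ℝ ιz} {gw : ℝ → EuclideanSpace ℝ ιz → EuclideanSpace ℝ ιw → EuclideanSpace ℝ ιw}

lemma norm_iter (hρ : 0 < ρ) (ε h : ℝ) {x : EuclideanSpace ℝ ιz × EuclideanSpace ℝ ιw} (hx : ‖x.1‖ = ρ) (j : ℕ) :
    ‖(iter ρ ε gz gw h x j).1‖ = ρ := by
  induction j with
  | zero => exact hx
  | succ j ih => exact norm_proj hρ (le_norm_step hρ ih _ _)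

lemma continuous_iter (hρ : 0 < ρ) (ε : ℝ)
    (hcz : ∀ τ, Continuous fun p : EuclideanSpace ℝ ιz × EuclideanSpace ℝ ιw => gz τ p.1 p.2)
    (hcw : ∀ τ, Continuous fun p : EuclideanSpace ℝ ιz × EuclideanSpace ℝ ιw => gw τ p.1 p.2) (j : ℕ) :
    Continuous fun p : ℝ × (EuclideanSpace ℝ ιz × EuclideanSpace ℝ ιw) => iter ρ ε gz gw p.1 p.2 j := by
  induction j with
  | zero => exact continuous_snd
  | succ j ih =>
    have c1 := (hcz (j * ε)).comp ih
    have c2 := (hcw (j * ε)).comp ih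
    have f1 : Continuous fun p : ℝ × (EuclideanSpace ℝ ιz × EuclideanSpace ℝ ιw) => (iter ρ ε gz gw p.1 p.2 j).1 := ih.fst
    have f2 : Continuous fun p : ℝ × (EuclideanSpace ℝ ιz × EuclideanSpace ℝ ιw) => (iter ρ ε gz gw p.1 p.2 j).2 := ih.snd
    simp only [Function.comp_def] at c1 c2
    have hy : Continuous fun p : ℝ × (EuclideanSpace ℝ ιz × EuclideanSpace ℝ ιw) => (iter ρ ε gz gw p.1 p.2 j).1 -
        p.1 • tang ρ (iter ρ ε gz gw p.1 p.2 j).1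
          (gz (j * ε) (iter ρ ε gz gw p.1 p.2 j).1 (iter ρ ε gz gw p.1 p.2 j).2) := by
      unfold tang
      have c3 : Continuous fun p : ℝ × (EuclideanSpace ℝ ιz × EuclideanSpace ℝ ιw) =>
          inner ℝ (gz (j * ε) (iter ρ ε gz gw p.1 p.2 j).1 (iter ρ ε gz gw p.1 p.2 j).2)
            (iter ρ ε gz gw p.1 p.2 j).1 / ρ ^ 2 := (c1.inner f1).div_const _
      exact f1.sub (continuous_fst.smul (c1.sub (c3.smul f1)))
    refine Continuous.prodMk ?_ (f2.sub (continuous_fst.smul c2))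
    unfold proj
    refine (Continuous.div continuous_const (hy.norm.max continuous_const) fun p => ?_).smul hy
    exact (hρ.trans_le (le_max_right _ _)).ne'

lemma iter_zero_step (hρ : 0 < ρ) (ε : ℝ) {x : EuclideanSpace ℝ ιz × EuclideanSpace ℝ ιw} (hx : ‖x.1‖ = ρ) (j : ℕ) :
    iter ρ ε gz gw 0 x j = x := by
  induction j with
  | zero => rfl
  | succ j ih => simp [iter, ih, proj, hx, hρ.ne']

lemma iter_neg (ε h : ℝ) (hodd : ∀ τ z w, gz τ (-z) w = -gz τ z w)
    (heven : ∀ τ z w, gw τ (-z) w = gw τ z w) (z : EuclideanSpace ℝ ιz) (w : EuclideanSpace ℝ ιw) (j : ℕ) :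
    iter ρ ε gz gw h (-z, w) j =
      (-(iter ρ ε gz gw h (z, w) j).1, (iter ρ ε gz gw h (z, w) j).2) := by
  induction j with
  | zero => rfl
  | succ j ih =>
    simp only [iter, ih, hodd, heven, tang_neg, smul_neg]
    rw [← proj_neg]
    congr 2
    abel

set_option maxHeartbeats 800000 in
theorem exists_low_point [DecidableEq ιz]
    (P : ιz → Prop) (Q : ιw → Prop) (i₀ : ιz) (hi₀ : ¬ P i₀) (hQ : ∃ i, Q i)
    (mu : ιw → ℝ) (hmu : ∀ i, Q i → mu i ≤ 0) (hρ : 0 < ρ) {C b : ℝ}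
    (f : ℝ → EuclideanSpace ℝ ιz → EuclideanSpace ℝ ιw → ℝ) (κ : EuclideanSpace ℝ ιw → ℝ)
    (hf : ∀ τ z w, f τ z w = f 0 z w + τ * κ w) (hκ : ∀ w, κ w ≤ C) (hC : 0 < C)
    (hcz : ∀ τ, Continuous fun p : EuclideanSpace ℝ ιz × EuclideanSpace ℝ ιw => gz τ p.1 p.2)
    (hcw : ∀ τ, Continuous fun p : EuclideanSpace ℝ ιz × EuclideanSpace ℝ ιw => gw τ p.1 p.2)
    (hodd : ∀ τ z w, gz τ (-z) w = -gz τ z w)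
    (heven : ∀ τ z w, gw τ (-z) w = gw τ z w)
    (hquad : ∀ τ ∈ Icc (0 : ℝ) 1, ∀ z w z' w', ‖z‖ = ρ → ‖z'‖ = ρ → f τ z' w' ≤ f τ z w +
      inner ℝ (gz τ z w) (z' - z) + inner ℝ (gw τ z w) (w' - w) +
      C * (‖z' - z‖ ^ 2 + ‖w' - w‖ ^ 2))
    (hgz : ∀ τ ∈ Icc (0 : ℝ) 1, ∀ z w, ‖z‖ = ρ → ‖gz τ z w‖ ≤ C)
    (hgw : ∀ τ ∈ Icc (0 : ℝ) 1, ∀ z w, ‖z‖ = ρ → ∀ i, Q i → |gw τ z w i - mu i * w i| ≤ C)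
    {δ r : ℝ} (hδ : 0 < δ) (hr : 0 < r)
    (hgap : ∀ τ ∈ Icc (0 : ℝ) 1, ∀ z w, ‖z‖ = ρ → b - 1 ≤ f τ z w → f τ z w ≤ b →
      ‖tang ρ z (gz τ z w)‖ ^ 2 + ‖gw τ z w‖ ^ 2 < δ ^ 2 → ∀ w', ‖w' - w‖ ≤ r → κ w' = 0)
    (hΓ : ∀ z w, ‖z‖ = ρ → (∀ i, ¬ P i → i ≠ i₀ → z i = 0) → (∀ i, ¬ Q i → w i = 0) →
      f 0 z w ≤ b) :
    ∃ z w, ‖z‖ = ρ ∧ (∀ i, P i → z i = 0) ∧ (∀ i, Q i → w i = 0) ∧ f 1 z w ≤ b := by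
  classical
  have hCρ : 0 < C / (2 * ρ) + 4 * C := by positivity
  obtain ⟨h, hh, hh1, hh2⟩ : ∃ h > 0, h * (C / (2 * ρ) + 4 * C) ≤ 1 / 2 ∧ h * δ ≤ r := by
    refine ⟨min (1 / 2 / (C / (2 * ρ) + 4 * C)) (r / δ), by positivity, ?_, ?_⟩
    · exact (le_div_iff₀ hCρ).1 (min_le_left _ _)
    · exact (le_div_iff₀ hδ).1 (min_le_right _ _)
  obtain ⟨J, hJ⟩ := exists_nat_gt (max C (2 * C / (h * δ ^ 2)))
  have hJ1 := (le_max_left _ _).trans_lt hJ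
  have hJ2 := (le_max_right _ _).trans_lt hJ
  have hJ0 : (0 : ℝ) < J := hC.trans hJ1
  have hτ : ∀ j < J, (j : ℝ) * (1 / J) ∈ Icc (0 : ℝ) 1 := fun j hj => by
    have : (j : ℝ) ≤ J := by exact_mod_cast hj.le
    refine ⟨by positivity, ?_⟩
    rw [mul_one_div, div_le_one hJ0]; exact this
  have hκJ : ∀ w, 1 / J * κ w ≤ C / J := fun w => by
    rw [one_div_mul_eq_div]; gcongr; exact hκ w
  -- energy estimate
  have energy : ∀ x : EuclideanSpace ℝ ιz × EuclideanSpace ℝ ιw, ‖x.1‖ = ρ → f 0 x.1 x.2 ≤ b → ∀ j ≤ J,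
      f (j * (1 / J)) (iter ρ (1 / J) gz gw h x j).1 (iter ρ (1 / J) gz gw h x j).2 ≤ b := by
    intro x hx hxb j
    induction j with
    | zero => intro _; simpa [iter] using hxb
    | succ j ih =>
      intro hj
      have hjb := ih (by omega)
      have ht := hτ j (by omega)
      have hn : ‖(iter ρ (1 / J) gz gw h x j).1‖ = ρ := norm_iter hρ _ _ hx j
      simp only [iter]
      generalize iter ρ (1 / J) gz gw h x j = y at hjb hn
      set τ : ℝ := j * (1 / J) with hτdef
      have hdec := step_decrease hρ hC.le hh.le hh1 hn (hgz τ ht y.1 y.2 hn)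
        (fun z' w' hz' => hquad τ ht y.1 y.2 z' w' hn hz')
      set z' := proj ρ (y.1 - h • tang ρ y.1 (gz τ y.1 y.2))
      set w' := y.2 - h • gw τ y.1 y.2 with hw'
      have hnext : f ((j + 1 : ℕ) * (1 / J)) z' w' = f τ z' w' + 1 / J * κ w' := by
        rw [hf, hf τ, hτdef]; push_cast; ring
      rw [hnext]
      set q := ‖tang ρ y.1 (gz τ y.1 y.2)‖ ^ 2 + ‖gw τ y.1 y.2‖ ^ 2 with hq
      have hq0 : 0 ≤ q := by positivity
      have hk := hκJ w'
      by_cases hwin : b - 1 ≤ f τ y.1 y.2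
      · by_cases hsm : q < δ ^ 2
        · have : κ w' = 0 := by
            refine hgap τ ht y.1 y.2 hn hwin hjb hsm w' ?_
            have hgw' : ‖gw τ y.1 y.2‖ ≤ δ := by
              refine le_of_sq_le_sq ?_ hδ.le
              have : 0 ≤ ‖tang ρ y.1 (gz τ y.1 y.2)‖ ^ 2 := by positivity
              linarith
            rw [hw', sub_sub_cancel_left, norm_neg, norm_smul, Real.norm_eq_abs, abs_of_pos hh]
            exact (mul_le_mul_of_nonneg_left hgw' hh.le).trans hh2
          rw [this, mul_zero, add_zero]
          nlinarith
        · push Not at hsm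
          have : C / J ≤ h / 2 * δ ^ 2 := by
            rw [div_le_iff₀ hJ0]
            have := (div_lt_iff₀ (by positivity)).1 hJ2
            linarith
          have : h / 2 * δ ^ 2 ≤ h / 2 * q := by gcongr
          linarith
      · push Not at hwin
        have : C / J ≤ 1 := (div_le_one hJ0).2 hJ1.le
        have : 0 ≤ h / 2 * q := by positivity
        linarith
  -- the family of initial points
  let zb : ({i // P i} ⊕ {i // Q i} → ℝ) → {i // P i} → ℝ := fun x a => x (.inl a)
  let wb : ({i // P i} ⊕ {i // Q i} → ℝ) → {i // Q i} → ℝ := fun x a => x (.inr a)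
  have hzb : Continuous zb := by fun_prop
  have hwb : Continuous wb := by fun_prop
  let v : ({i // P i} ⊕ {i // Q i} → ℝ) → EuclideanSpace ℝ ιz := fun x => WithLp.toLp 2 fun i =>
    if hi : P i then zb x ⟨i, hi⟩ else if i = i₀ then 1 - ‖zb x‖ else 0
  have hv : Continuous v := by
    refine (PiLp.continuous_toLp 2 _).comp (continuous_pi fun i => ?_)
    by_cases hi : P i
    · simp only [hi, dif_pos]; fun_prop
    · by_cases hi' : i = i₀
      · simp only [hi, dif_neg, not_false_iff, hi', if_true]; subst hi'; simp only [hi, dif_neg, not_false_iff]; fun_prop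
      · simp only [hi, dif_neg, not_false_iff, hi', if_false]; fun_prop
  have hvP : ∀ x i (hi : P i), v x i = zb x ⟨i, hi⟩ := fun x i hi => by simp [v, hi]
  have hvP' : ∀ x (i : {i // P i}), v x i = x (.inl i) := fun x i => hvP x i i.2
  have hv0 : ∀ x, 0 < ‖v x‖ := fun x => by
    rw [norm_pos_iff]
    intro h0
    have hz0 : zb x = 0 := by
      funext ⟨i, hi⟩
      rw [← hvP x i hi, h0]; rfl
    have : v x i₀ = 1 := by simp [v, hi₀, hz0]
    rw [h0] at this
    simp at this
  obtain ⟨B, hB, hBpos⟩ : ∃ B : ℝ, J * (h * C) < B * (1 / 4) ∧ 0 < B :=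
    ⟨4 * (J * (h * C)) + 1, by linarith, by positivity⟩
  let z₀ : ({i // P i} ⊕ {i // Q i} → ℝ) → EuclideanSpace ℝ ιz := fun x => (ρ / ‖v x‖) • v x
  let w₀ : ({i // P i} ⊕ {i // Q i} → ℝ) → EuclideanSpace ℝ ιw := fun x => WithLp.toLp 2 fun i =>
    if hi : Q i then B * wb x ⟨i, hi⟩ else 0
  have hz₀ : Continuous z₀ := (continuous_const.div hv.norm fun x => (hv0 x).ne').smul hv
  have hw₀ : Continuous w₀ := by
    refine (PiLp.continuous_toLp 2 _).comp (continuous_pi fun i => ?_)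
    by_cases hi : Q i
    · simp only [hi, dif_pos]; fun_prop
    · simp only [hi, dif_neg, not_false_iff]; fun_prop
  have hz₀n : ∀ x, ‖z₀ x‖ = ρ := fun x => by
    simp only [z₀, norm_smul, Real.norm_eq_abs, abs_div, abs_norm, abs_of_pos hρ]
    field_simp [(hv0 x).ne']
  have hw₀Q : ∀ x i (hi : Q i), w₀ x i = B * wb x ⟨i, hi⟩ := fun x i hi => by simp [w₀, hi]
  have hΓx : ∀ x, f 0 (z₀ x) (w₀ x) ≤ b := fun x => by
    refine hΓ _ _ (hz₀n x) (fun i hi hi' => ?_) fun i hi => ?_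
    · simp [z₀, v, hi, hi']
    · simp [w₀, hi]
  let η : ({i // P i} ⊕ {i // Q i} → ℝ) → ℝ := fun x => h * max 0 (min 1 (2 - 4 * ‖wb x‖))
  have hη : Continuous η := by fun_prop
  have hη0 : ∀ x, 0 ≤ η x := fun x => mul_nonneg hh.le (le_max_left _ _)
  have hη1 : ∀ x, η x ≤ h := fun x => by
    refine mul_le_of_le_one_right hh.le (max_le zero_le_one (min_le_left _ _))
  let F : ({i // P i} ⊕ {i // Q i} → ℝ) → EuclideanSpace ℝ ιz × EuclideanSpace ℝ ιw := fun x =>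
    iter ρ (1 / J) gz gw (η x) (z₀ x, w₀ x) J
  have hF : Continuous F :=
    (continuous_iter hρ (1 / J) hcz hcw J).comp (hη.prodMk (hz₀.prodMk hw₀))
  haveI : Nonempty {i // Q i} := let ⟨i, hi⟩ := hQ; ⟨⟨i, hi⟩⟩
  obtain ⟨x, hx, hx0⟩ := SignCochain.exists_zero
    (fun x => Sum.elim (fun a : {i // P i} => (F x).1 a) (fun a : {i // Q i} => (F x).2 a))
    (by
      refine Continuous.continuousOn (continuous_pi fun i => ?_)
      rcases i with a | a
      · exact (EuclideanSpace.proj (𝕜 := ℝ) (a : ιz)).continuous.comp hF.fst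
      · exact (EuclideanSpace.proj (𝕜 := ℝ) (a : ιw)).continuous.comp hF.snd)
    (by
      rintro x hx ⟨a, ha⟩
      set x' := Sum.elim (fun a => -x (.inl a)) (fun b => x (.inr b)) with hx'
      have e1 : zb x' = -zb x := rfl
      have e2 : wb x' = wb x := rfl
      have en : ‖zb x‖ = 1 := by
        refine le_antisymm ((pi_norm_le_iff_of_nonneg zero_le_one).2 fun a => hx _) ?_
        rw [← ha]
        exact norm_le_pi_norm (zb x) a
      have ev : v x' = -v x := by
        ext i
        by_cases hi : P i
        · simp [v, hi, e1]
        · by_cases hi' : i = i₀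
          · subst hi'; simp [v, hi, e1, en]
          · simp [v, hi, hi']
      have ez : z₀ x' = -z₀ x := by simp [z₀, ev]
      have ew : w₀ x' = w₀ x := by simp only [w₀, e2]
      have eη : η x' = η x := by simp only [η, e2]
      have eF : F x' = (-(F x).1, (F x).2) := by
        simp only [F, ez, ew, eη]
        exact iter_neg _ _ hodd heven _ _ _
      funext i
      rcases i with a | a <;> simp [eF])
    (by
      rintro x hx ⟨a, ha⟩ i
      have en : 1 / 2 ≤ ‖wb x‖ := ha.trans (norm_le_pi_norm (wb x) a)
      have eη : η x = 0 := by
        have : max 0 (min 1 (2 - 4 * ‖wb x‖)) = 0 :=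
          max_eq_left ((min_le_right _ _).trans (by linarith))
        simp only [η, this, mul_zero]
      have eF : F x = (z₀ x, w₀ x) := by
        have h1 : F x = iter ρ (1 / J) gz gw (η x) (z₀ x, w₀ x) J := rfl
        rw [h1, eη]
        exact iter_zero_step (x := (z₀ x, w₀ x)) hρ (1 / J) (hz₀n x) J
      rcases i with i | i
      · refine ⟨ρ / ‖v x‖, div_pos hρ (hv0 x), ?_⟩
        have h1 : z₀ x i = ρ / ‖v x‖ * x (.inl i) := by
          rw [← hvP' x i]; rfl
        rw [← h1]
        simp only [Sum.elim_inl, eF]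
      · refine ⟨B, hBpos, ?_⟩
        have h1 : w₀ x i = B * x (.inr i) := hw₀Q x i i.2
        rw [← h1]
        simp only [Sum.elim_inr, eF])
  have hzP : ∀ i, P i → (F x).1 i = 0 := fun i hi => congrFun hx0 (.inl ⟨i, hi⟩)
  have hwQ : ∀ i, Q i → (F x).2 i = 0 := fun i hi => congrFun hx0 (.inr ⟨i, hi⟩)
  -- the zero has small `w`-part
  have hgrow : ∀ i, Q i → ∀ j ≤ J, |w₀ x i| - j * (h * C) ≤
      |(iter ρ (1 / J) gz gw (η x) (z₀ x, w₀ x) j).2 i| := by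
    intro i hi j
    induction j with
    | zero => intro _; simp [iter]
    | succ j ih =>
      intro hj
      refine le_trans ?_ (le_trans (sub_le_sub_right (ih (by omega)) (h * C)) ?_)
      · push_cast; linarith
      have hn : ‖(iter ρ (1 / J) gz gw (η x) (z₀ x, w₀ x) j).1‖ = ρ := norm_iter (x := (z₀ x, w₀ x)) hρ _ _ (hz₀n x) j
      have hg := hgw _ (hτ j (by omega)) _ (iter ρ (1 / J) gz gw (η x) (z₀ x, w₀ x) j).2 hn i hi
      simp only [iter, PiLp.sub_apply, PiLp.smul_apply, smul_eq_mul]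
      generalize iter ρ (1 / J) gz gw (η x) (z₀ x, w₀ x) j = y at hg
      set k := gw (j * (1 / J)) y.1 y.2 i
      have h1 : y.2 i - η x * k = (1 - η x * mu i) * y.2 i - η x * (k - mu i * y.2 i) := by ring
      have h2 : |y.2 i| ≤ |(1 - η x * mu i) * y.2 i| := by
        rw [abs_mul]
        refine le_mul_of_one_le_left (abs_nonneg _) (le_trans ?_ (le_abs_self _))
        nlinarith [hmu i hi, hη0 x]
      have h3 : |η x * (k - mu i * y.2 i)| ≤ h * C := by
        rw [abs_mul, abs_of_nonneg (hη0 x)]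
        exact mul_le_mul (hη1 x) hg (abs_nonneg _) hh.le
      have h4 := abs_sub_abs_le_abs_sub ((1 - η x * mu i) * y.2 i) (η x * (k - mu i * y.2 i))
      rw [h1]
      linarith
  have hsmall : ‖wb x‖ ≤ 1 / 4 := by
    refine (pi_norm_le_iff_of_nonneg (by norm_num)).2 fun ⟨i, hi⟩ => ?_
    have h1 := hgrow i hi J le_rfl
    have h2 : (iter ρ (1 / J) gz gw (η x) (z₀ x, w₀ x) J).2 i = 0 := hwQ i hi
    rw [h2, abs_zero, hw₀Q x i hi, abs_mul, abs_of_pos hBpos] at h1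
    by_contra hcon
    push Not at hcon
    rw [Real.norm_eq_abs] at hcon
    nlinarith
  have hηx : η x = h := by
    have : max 0 (min 1 (2 - 4 * ‖wb x‖)) = 1 := by
      rw [min_eq_left (by linarith), max_eq_right zero_le_one]
    simp only [η, this, mul_one]
  have hFx : F x = iter ρ (1 / J) gz gw h (z₀ x, w₀ x) J := by simp only [F, hηx]
  have hE := energy (z₀ x, w₀ x) (hz₀n x) (hΓx x) J le_rfl
  rw [← hFx, mul_one_div_cancel hJ0.ne'] at hE
  refine ⟨(F x).1, (F x).2, ?_, hzP, hwQ, hE⟩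
  rw [hFx]
  exact norm_iter (x := (z₀ x, w₀ x)) hρ _ _ (hz₀n x) _

end Minimax

namespace Trig
open Complex

/-- The exponential `t ↦ exp (-2πikt)`. -/
def mode (k : ℤ) (t : ℝ) : ℂ := Complex.exp ((-(2 * Real.pi * k) : ℝ) * I * t)

lemma mode_zero (k : ℤ) : mode k 0 = 1 := by simp [mode]

lemma mode_one (k : ℤ) : mode k 1 = 1 := by
  rw [mode, Complex.exp_eq_one_iff]
  exact ⟨-k, by push_cast; ring⟩

lemma norm_mode (k : ℤ) (t : ℝ) : ‖mode k t‖ = 1 := by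
  rw [mode, show ((-(2 * Real.pi * k) : ℝ) * I * t : ℂ) = ((-(2 * Real.pi * k) * t : ℝ) : ℂ) * I by
    push_cast; ring, Complex.norm_exp_ofReal_mul_I]

@[fun_prop]
lemma continuous_mode (k : ℤ) : Continuous (mode k) := by unfold mode; fun_prop

lemma hasDerivAt_mode (k : ℤ) (t : ℝ) :
    HasDerivAt (mode k) ((-(2 * Real.pi * k) : ℝ) * I * mode k t) t := by
  have h1 : HasDerivAt (fun s : ℝ => ((-(2 * Real.pi * k) : ℝ) * I * s : ℂ))
      ((-(2 * Real.pi * k) : ℝ) * I) t := by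
    simpa using (Complex.ofRealCLM.hasDerivAt (x := t)).const_mul ((-(2 * Real.pi * k) : ℝ) * I : ℂ)
  exact h1.cexp.congr_deriv (mul_comm _ _)

lemma conj_mode (k : ℤ) (t : ℝ) : (starRingEnd ℂ) (mode k t) = mode (-k) t := by
  rw [mode, mode, ← Complex.exp_conj]
  simp [Complex.conj_ofNat]

lemma mode_mul (k l : ℤ) (t : ℝ) : mode k t * mode l t = mode (k + l) t := by
  rw [mode, mode, mode, ← Complex.exp_add]
  congr 1; push_cast; ring

lemma integral_mode (k : ℤ) : ∫ t in (0 : ℝ)..1, mode k t = if k = 0 then 1 else 0 := by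
  split_ifs with h
  · simp [h, mode]
  · have hc : ((-(2 * Real.pi * k) : ℝ) * I : ℂ) ≠ 0 := by
      simp [Real.pi_ne_zero, h]
    have := integral_exp_mul_complex (a := 0) (b := 1) hc
    have h1 := mode_one k
    have h0 := mode_zero k
    unfold mode at *
    rw [this, h1, h0, sub_self, zero_div]

/-- The unit of `ℂ` attached to a sign bit. -/
def unit (b : Bool) : ℂ := if b then I else 1

lemma norm_unit (b : Bool) : ‖unit b‖ = 1 := by cases b <;> simp [unit]

lemma integral_inner_mode (k l : ℤ) (b c : Bool) :
    ∫ t in (0 : ℝ)..1, inner ℝ (unit b * mode k t) (unit c * mode l t) =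
      if k = l ∧ b = c then 1 else 0 := by
  have h : ∀ t, inner ℝ (unit b * mode k t) (unit c * mode l t) =
      Complex.reCLM (unit c * (starRingEnd ℂ) (unit b) * mode (l - k) t) := fun t => by
    rw [Complex.inner, map_mul, conj_mode, Complex.reCLM_apply, sub_eq_add_neg, ← mode_mul]
    congr 1; ring
  simp_rw [h]
  rw [ContinuousLinearMap.intervalIntegral_comp_comm _
    (Continuous.intervalIntegrable (by fun_prop) _ _),
    intervalIntegral.integral_const_mul, integral_mode]
  by_cases hkl : k = l
  · subst hkl
    cases b <;> cases c <;> simp [unit]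
  · have : l - k ≠ 0 := fun h => hkl (by omega)
    simp [this, hkl]

variable {m : ℕ}

/-- The real Fourier basis of loops in `ℂᵐ`. -/
def bas (p : ℤ × Fin m × Bool) (t : ℝ) : CE m :=
  EuclideanSpace.single p.2.1 (unit p.2.2 * mode p.1 t)

lemma norm_bas (p : ℤ × Fin m × Bool) (t : ℝ) : ‖bas p t‖ = 1 := by
  simp [bas, norm_unit, norm_mode]

@[fun_prop]
lemma continuous_bas (p : ℤ × Fin m × Bool) : Continuous (bas p) := by
  unfold bas
  refine (PiLp.continuous_toLp 2 _).comp (continuous_pi fun j => ?_)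
  by_cases h : j = p.2.1
  · subst h; simp only [Pi.single_eq_same]; fun_prop
  · simpa [h] using continuous_const

lemma bas_one (p : ℤ × Fin m × Bool) : bas p 1 = bas p 0 := by
  simp [bas, mode_one, mode_zero]

lemma inner_bas (x : CE m) (p : ℤ × Fin m × Bool) (t : ℝ) :
    inner ℝ x (bas p t) = inner ℝ (x p.2.1) (unit p.2.2 * mode p.1 t) := by
  rw [PiLp.inner_apply, Finset.sum_eq_single p.2.1]
  · simp [bas]
  · intro j _ hj; simp [bas, hj]
  · simp

lemma integral_inner_bas (p q : ℤ × Fin m × Bool) :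
    ∫ t in (0 : ℝ)..1, inner ℝ (bas p t) (bas q t) = if p = q then 1 else 0 := by
  simp_rw [inner_bas]
  by_cases h : p.2.1 = q.2.1
  · have h1 : ∀ t, (bas p t) q.2.1 = unit p.2.2 * mode p.1 t := fun t => by simp [bas, ← h]
    simp_rw [h1, integral_inner_mode]
    congr 1
    rw [Prod.ext_iff, Prod.ext_iff]
    simp [h]
  · have h1 : ∀ t, (bas p t) q.2.1 = 0 := fun t => by simp [bas, Ne.symm h]
    simp_rw [h1]
    have : p ≠ q := fun e => h (by rw [e])
    simp [this]

lemma hasDerivAt_bas (p : ℤ × Fin m × Bool) (t : ℝ) :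
    HasDerivAt (bas p) (-I • ((2 * Real.pi * p.1) • bas p t)) t := by
  have h1 : HasDerivAt (fun s => (bas p s).ofLp)
      ((-I • ((2 * Real.pi * p.1) • bas p t)).ofLp) t := by
    rw [hasDerivAt_pi]
    intro j
    by_cases h : j = p.2.1
    · subst h
      have := (hasDerivAt_mode p.1 t).const_mul (unit p.2.2)
      have e : ∀ s, (bas p s).ofLp p.2.1 = unit p.2.2 * mode p.1 s := fun s => by simp [bas]
      simp only [PiLp.smul_apply, e]
      refine this.congr_deriv ?_
      simp only [smul_eq_mul, Complex.real_smul]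
      push_cast; ring
    · simpa [h, bas] using hasDerivAt_const t (0 : ℂ)
  exact (PiLp.continuousLinearEquiv 2 ℝ (fun _ : Fin m => ℂ)).symm.hasFDerivAt.comp_hasDerivAt t h1

/-- Frequencies between `-N` and `N`, with a coordinate and a phase. -/
abbrev Idx (N m : ℕ) : Type := ↥(Finset.Icc (-(N : ℤ)) N) × Fin m × Bool

variable {N : ℕ}

def Idx.toFull (i : Idx N m) : ℤ × Fin m × Bool := (i.1.1, i.2)

lemma Idx.toFull_injective : Function.Injective (Idx.toFull (N := N) (m := m)) := by
  rintro ⟨⟨a, ha⟩, b⟩ ⟨⟨c, hc⟩, d⟩ h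
  simpa [Idx.toFull] using h

/-- The frequency of an index, as an eigenvalue of `i d/dt`. -/
def freq (i : Idx N m) : ℝ := 2 * Real.pi * i.1.1

/-- The trigonometric polynomial with coefficients `x`. -/
def loop (x : EuclideanSpace ℝ (Idx N m)) (t : ℝ) : CE m := ∑ i, x i • bas i.toFull t

/-- Multiplication of the coefficients by the frequencies. -/
def wt (x : EuclideanSpace ℝ (Idx N m)) : EuclideanSpace ℝ (Idx N m) :=
  WithLp.toLp 2 fun i => freq i * x i

lemma loop_add (x y : EuclideanSpace ℝ (Idx N m)) (t : ℝ) :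
    loop (x + y) t = loop x t + loop y t := by
  simp [loop, add_smul, Finset.sum_add_distrib]

lemma loop_neg (x : EuclideanSpace ℝ (Idx N m)) (t : ℝ) : loop (-x) t = -loop x t := by
  simp [loop]

lemma loop_sub (x y : EuclideanSpace ℝ (Idx N m)) (t : ℝ) :
    loop (x - y) t = loop x t - loop y t := by
  rw [sub_eq_add_neg, loop_add, loop_neg, ← sub_eq_add_neg]

lemma loop_one (x : EuclideanSpace ℝ (Idx N m)) : loop x 1 = loop x 0 := by
  simp [loop, bas_one]

lemma continuous_loop_uncurry :
    Continuous fun p : EuclideanSpace ℝ (Idx N m) × ℝ => loop p.1 p.2 := by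
  unfold loop
  fun_prop

@[fun_prop]
lemma continuous_loop (x : EuclideanSpace ℝ (Idx N m)) : Continuous (loop x) :=
  continuous_loop_uncurry.comp (continuous_const.prodMk continuous_id)

lemma integral_inner_loop_bas (x : EuclideanSpace ℝ (Idx N m)) (i : Idx N m) :
    ∫ t in (0 : ℝ)..1, inner ℝ (loop x t) (bas i.toFull t) = x i := by
  simp only [loop, sum_inner, real_inner_smul_left]
  rw [intervalIntegral.integral_finsetSum]
  · simp only [intervalIntegral.integral_const_mul, integral_inner_bas,
      Idx.toFull_injective.eq_iff]
    simp
  · intro j _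
    exact (continuous_const.mul ((continuous_bas _).inner (continuous_bas _))).intervalIntegrable _ _

lemma integral_norm_loop_sq (x : EuclideanSpace ℝ (Idx N m)) :
    ∫ t in (0 : ℝ)..1, ‖loop x t‖ ^ 2 = ‖x‖ ^ 2 := by
  have h : ∀ t, ‖loop x t‖ ^ 2 = ∑ i, x i * inner ℝ (loop x t) (bas i.toFull t) := fun t => by
    rw [← real_inner_self_eq_norm_sq]
    conv_lhs => rw [show loop x t = ∑ i, x i • bas i.toFull t from rfl, inner_sum]
    simp only [real_inner_smul_right]; rfl
  simp_rw [h]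
  rw [intervalIntegral.integral_finsetSum]
  · simp only [intervalIntegral.integral_const_mul, integral_inner_loop_bas]
    rw [EuclideanSpace.norm_sq_eq]
    exact Finset.sum_congr rfl fun i _ => by rw [Real.norm_eq_abs, sq_abs, sq]
  · intro j _
    exact (continuous_const.mul ((continuous_loop x).inner (continuous_bas _))).intervalIntegrable _ _

lemma hasDerivAt_loop (x : EuclideanSpace ℝ (Idx N m)) (t : ℝ) :
    HasDerivAt (loop x) (-I • loop (wt x) t) t := by
  have := HasDerivAt.fun_sum (u := Finset.univ) fun (i : Idx N m) _ =>
    (hasDerivAt_bas i.toFull t).const_smul (x i)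
  refine this.congr_deriv ?_
  rw [loop, Finset.smul_sum]
  refine Finset.sum_congr rfl fun i _ => ?_
  rw [smul_comm, smul_smul, mul_comm]
  rfl

lemma norm_loop_le (x : EuclideanSpace ℝ (Idx N m)) (t : ℝ) :
    ‖loop x t‖ ≤ Fintype.card (Idx N m) * ‖x‖ := by
  refine (norm_sum_le _ _).trans ?_
  rw [← nsmul_eq_mul, ← Finset.card_univ]
  refine Finset.sum_le_card_nsmul _ _ _ fun i _ => ?_
  rw [norm_smul, norm_bas, mul_one]
  exact PiLp.norm_apply_le x i

lemma norm_loop_sub_le (x : EuclideanSpace ℝ (Idx N m)) {s t : ℝ} (hs : s ∈ Icc (0 : ℝ) 1)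
    (ht : t ∈ Icc (0 : ℝ) 1) :
    ‖loop x t - loop x s‖ ≤ (‖wt x‖ ^ 2 + 1) * √|t - s| := by
  wlog hst : s ≤ t generalizing s t
  · rw [norm_sub_rev, abs_sub_comm]; exact this ht hs (le_of_not_ge hst)
  rcases hst.eq_or_lt with rfl | hlt
  · simp
  have hcont : Continuous fun r => -I • loop (wt x) r := by fun_prop
  rw [← intervalIntegral.integral_eq_sub_of_hasDerivAt (fun r _ => hasDerivAt_loop x r)
    (hcont.intervalIntegrable _ _), abs_of_pos (sub_pos.2 hlt)]
  set e := √(t - s) with he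
  have he0 : 0 < e := Real.sqrt_pos.2 (sub_pos.2 hlt)
  have hee : e * e = t - s := Real.mul_self_sqrt (sub_pos.2 hlt).le
  calc ‖∫ r in s..t, -I • loop (wt x) r‖ ≤ ∫ r in s..t, ‖-I • loop (wt x) r‖ :=
        intervalIntegral.norm_integral_le_integral_norm hst
    _ ≤ ∫ r in s..t, (e * ‖loop (wt x) r‖ ^ 2 + e⁻¹) := by
        refine intervalIntegral.integral_mono_on hst (hcont.norm.intervalIntegrable _ _)
          (Continuous.intervalIntegrable (by have := continuous_loop (wt x); fun_prop) _ _)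
          fun r _ => ?_
        rw [norm_smul, norm_neg, norm_I, one_mul]
        set q := ‖loop (wt x) r‖
        have h1 : e⁻¹ * e = 1 := inv_mul_cancel₀ he0.ne'
        have h2 : e * q ^ 2 + e⁻¹ - q = e⁻¹ * ((e * q - 1 / 2) ^ 2 + 3 / 4) := by
          field_simp; ring
        have : 0 ≤ e⁻¹ * ((e * q - 1 / 2) ^ 2 + 3 / 4) := by positivity
        linarith
    _ = e * (∫ r in s..t, ‖loop (wt x) r‖ ^ 2) + e := by
        rw [intervalIntegral.integral_add, intervalIntegral.integral_const_mul,
          intervalIntegral.integral_const, smul_eq_mul, ← hee]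
        · congr 1; field_simp
        · exact Continuous.intervalIntegrable (by have := continuous_loop (wt x); fun_prop) _ _
        · exact Continuous.intervalIntegrable (by fun_prop) _ _
    _ ≤ e * ‖wt x‖ ^ 2 + e := by
        rw [← integral_norm_loop_sq (wt x)]
        gcongr
        refine intervalIntegral.integral_mono_interval hs.1 hst ht.2
          (Eventually.of_forall fun r => by positivity)
          (Continuous.intervalIntegrable (by have := continuous_loop (wt x); fun_prop) _ _)
    _ = (‖wt x‖ ^ 2 + 1) * e := by ring

end Trig

namespace Trig
open Complex

lemma eq_zero_of_mode_coeff {f : ℝ → ℂ} (hf : Continuous f) (h01 : f 0 = f 1)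
    (h : ∀ k, ∫ t in (0 : ℝ)..1, mode k t * f t = 0) {t : ℝ} (ht : t ∈ Ico (0 : ℝ) 1) : f t = 0 := by
  have hcont : Continuous (AddCircle.liftIco (1 : ℝ) 0 f) :=
    AddCircle.liftIco_continuous (by simpa using h01) hf.continuousOn
  let F : C(AddCircle (1 : ℝ), ℂ) := ⟨_, hcont⟩
  have hc : ∀ n, fourierCoeff F n = 0 := fun n => by
    rw [show (F : AddCircle (1 : ℝ) → ℂ) = AddCircle.liftIco (1 : ℝ) 0 f from rfl,
      fourierCoeff_liftIco_eq, fourierCoeffOn_eq_integral]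
    have e : ∫ x in (0 : ℝ)..0 + 1, fourier (-n) (x : AddCircle ((0 : ℝ) + 1 - 0)) • f x = 0 := by
      have h2 : ∀ x : ℝ, fourier (-n) (x : AddCircle ((0 : ℝ) + 1 - 0)) = mode n x := fun x => by
        rw [fourier_coe_apply, mode]
        congr 1; push_cast; ring
      simp_rw [h2, zero_add]
      exact h n
    rw [e, smul_zero]
  have hs := has_pointwise_sum_fourier_series_of_summable (f := F)
    (by simp only [funext hc]; exact summable_zero) (t : AddCircle (1 : ℝ))
  simp only [hc, zero_smul] at hs
  have h0 := hs.unique hasSum_zero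
  have : F (t : AddCircle (1 : ℝ)) = f t := AddCircle.liftIco_coe_apply (by simpa using ht)
  rw [← this, h0]

lemma eq_integral_of_mode_coeff {x g : ℝ → ℂ} (hx : Continuous x) (hg : Continuous g)
    (h01 : x 0 = x 1)
    (h : ∀ k : ℤ, (2 * Real.pi * k : ℝ) * ∫ t in (0 : ℝ)..1, mode (-k) t * x t =
      ∫ t in (0 : ℝ)..1, mode (-k) t * g t) {t : ℝ} (ht : t ∈ Icc (0 : ℝ) 1) :
    x t = x 0 + ∫ s in (0 : ℝ)..t, -I * g s := by
  set G : ℝ → ℂ := fun t => ∫ s in (0 : ℝ)..t, -I * g s with hGdef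
  have hIg : Continuous fun s => -I * g s := by fun_prop
  have hG : ∀ t, HasDerivAt G (-I * g t) t := fun t =>
    intervalIntegral.integral_hasDerivAt_right (hIg.intervalIntegrable _ _)
      hIg.stronglyMeasurable.stronglyMeasurableAtFilter hIg.continuousAt
  have hGc : Continuous G := continuous_iff_continuousAt.2 fun t => (hG t).continuousAt
  have hG0 : G 0 = 0 := intervalIntegral.integral_same
  have hG1 : G 1 = 0 := by
    have h0 := h 0
    simp only [Int.cast_zero, mul_zero, Complex.ofReal_zero, zero_mul, neg_zero] at h0
    have e : ∀ t, mode 0 t = 1 := fun t => by simp [mode]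
    simp only [e, one_mul] at h0
    rw [hGdef]
    simp only [intervalIntegral.integral_const_mul, ← h0, mul_zero]
  set c : ℂ := ∫ t in (0 : ℝ)..1, (x t - G t) with hc
  have key : ∀ l, ∫ t in (0 : ℝ)..1, mode l t * (x t - G t - c) = 0 := by
    intro l
    have e1 : ∫ t in (0 : ℝ)..1, mode l t * (x t - G t - c) =
        (∫ t in (0 : ℝ)..1, mode l t * (x t - G t)) - (if l = 0 then 1 else 0) * c := by
      rw [← integral_mode, ← intervalIntegral.integral_mul_const, ← intervalIntegral.integral_sub]
      · congr 1; funext t; ring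
      all_goals exact Continuous.intervalIntegrable (by fun_prop) _ _
    rw [e1]
    split_ifs with hl
    · subst hl
      have e : ∀ t, mode 0 t = 1 := fun t => by simp [mode]
      simp only [e, one_mul, ← hc, sub_self]
    · have hk := h (-l)
      rw [neg_neg] at hk
      have ibp := intervalIntegral.integral_deriv_mul_eq_sub (a := 0) (b := 1)
        (fun t _ => hasDerivAt_mode l t) (fun t _ => hG t)
        (Continuous.intervalIntegrable (by fun_prop) _ _)
        (Continuous.intervalIntegrable (by fun_prop) _ _)
      rw [hG0, hG1, mul_zero, mul_zero, sub_zero, intervalIntegral.integral_add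
        (Continuous.intervalIntegrable (by fun_prop) _ _)
        (Continuous.intervalIntegrable (by fun_prop) _ _)] at ibp
      have e2 : ∀ t, mode l t * (-I * g t) = -I * (mode l t * g t) := fun t => by ring
      have e3 : ∀ t, (-(2 * Real.pi * l) : ℝ) * I * mode l t * G t =
        (-(2 * Real.pi * l) : ℝ) * I * (mode l t * G t) := fun t => by ring
      simp only [e2, e3, intervalIntegral.integral_const_mul, ← hk] at ibp
      have e4 : ∫ t in (0 : ℝ)..1, mode l t * (x t - G t) =
          (∫ t in (0 : ℝ)..1, mode l t * x t) - ∫ t in (0 : ℝ)..1, mode l t * G t := by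
        rw [← intervalIntegral.integral_sub]
        · congr 1; funext t; ring
        all_goals exact Continuous.intervalIntegrable (by fun_prop) _ _
      rw [e4, zero_mul, sub_zero]
      have hne : ((-(2 * Real.pi * l) : ℝ) * I : ℂ) ≠ 0 := by simp [Real.pi_ne_zero, hl]
      refine (mul_right_inj' hne).1 ?_
      rw [mul_zero, ← neg_eq_zero, ← ibp]
      push_cast; ring
  have hf01 : x 0 - G 0 - c = x 1 - G 1 - c := by rw [hG0, hG1, h01]
  have hz : ∀ t ∈ Icc (0 : ℝ) 1, x t - G t - c = 0 := by
    intro t ht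
    rcases ht.2.eq_or_lt with rfl | hlt
    · rw [← hf01]
      exact eq_zero_of_mode_coeff (f := fun t => x t - G t - c) (by fun_prop) hf01 key ⟨le_rfl, one_pos⟩
    · exact eq_zero_of_mode_coeff (f := fun t => x t - G t - c) (by fun_prop) hf01 key ⟨ht.1, hlt⟩
  have ha := hz t ht
  have hb := hz 0 ⟨le_rfl, zero_le_one⟩
  rw [hG0] at hb
  linear_combination ha - hb

lemma re_integral {q : ℝ → ℂ} (hq : Continuous q) :
    (∫ t in (0 : ℝ)..1, q t).re = ∫ t in (0 : ℝ)..1, (q t).re :=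
  (Complex.reCLM.intervalIntegral_comp_comm (hq.intervalIntegrable 0 1)).symm

lemma im_integral {q : ℝ → ℂ} (hq : Continuous q) :
    (∫ t in (0 : ℝ)..1, q t).im = ∫ t in (0 : ℝ)..1, (q t).im :=
  (Complex.imCLM.intervalIntegral_comp_comm (hq.intervalIntegrable 0 1)).symm

lemma inner_bas_re {m : ℕ} (x : CE m) (k : ℤ) (j : Fin m) (t : ℝ) :
    inner ℝ x (bas (k, j, false) t) = (mode (-k) t * x j).re := by
  rw [inner_bas, real_inner_comm, Complex.inner, ← conj_mode]
  simp [unit, mul_comm]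

lemma inner_bas_im {m : ℕ} (x : CE m) (k : ℤ) (j : Fin m) (t : ℝ) :
    inner ℝ x (bas (k, j, true) t) = (mode (-k) t * x j).im := by
  rw [inner_bas, real_inner_comm, Complex.inner, ← conj_mode]
  simp [unit]
  ring

/-- A loop whose Fourier coefficients satisfy `i x' = g` solves this equation. -/
lemma eq_integral_of_coeff {m : ℕ} {x g : ℝ → CE m} (hx : Continuous x) (hg : Continuous g)
    (h01 : x 0 = x 1)
    (h : ∀ p : ℤ × Fin m × Bool, (2 * Real.pi * p.1) * ∫ t in (0 : ℝ)..1, inner ℝ (x t) (bas p t) =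
      ∫ t in (0 : ℝ)..1, inner ℝ (g t) (bas p t)) {t : ℝ} (ht : t ∈ Icc (0 : ℝ) 1) (j : Fin m) :
    x t j = x 0 j + ∫ s in (0 : ℝ)..t, -I * g s j := by
  have hxj : Continuous fun t => x t j := (EuclideanSpace.proj (𝕜 := ℂ) j).continuous.comp hx
  have hgj : Continuous fun t => g t j := (EuclideanSpace.proj (𝕜 := ℂ) j).continuous.comp hg
  refine eq_integral_of_mode_coeff hxj hgj (by rw [h01]) (fun k => ?_) ht
  have hm := continuous_mode (-k)
  apply Complex.ext
  · rw [Complex.re_ofReal_mul, re_integral (hm.fun_mul hxj), re_integral (hm.fun_mul hgj)]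
    have := h (k, j, false)
    simp only [inner_bas_re] at this
    exact this
  · rw [Complex.im_ofReal_mul, im_integral (hm.fun_mul hxj), im_integral (hm.fun_mul hgj)]
    have := h (k, j, true)
    simp only [inner_bas_im] at this
    exact this

end Trig

namespace Trig

lemma integral_norm_loop_le {m N : ℕ} (x : EuclideanSpace ℝ (Idx N m)) :
    ∫ t in (0 : ℝ)..1, ‖loop x t‖ ≤ ‖x‖ := by
  rcases (norm_nonneg x).eq_or_lt with h | h
  · have : x = 0 := norm_eq_zero.1 h.symm
    subst this
    simp [loop]
  · have h1 : ∫ t in (0 : ℝ)..1, ‖loop x t‖ ≤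
        ∫ t in (0 : ℝ)..1, ((2 * ‖x‖)⁻¹ * ‖loop x t‖ ^ 2 + ‖x‖ / 2) := by
      refine intervalIntegral.integral_mono_on zero_le_one
        (Continuous.intervalIntegrable (by fun_prop) _ _)
        (Continuous.intervalIntegrable (by fun_prop) _ _) fun t _ => ?_
      have : (2 * ‖x‖)⁻¹ * ‖loop x t‖ ^ 2 + ‖x‖ / 2 - ‖loop x t‖ =
          (2 * ‖x‖)⁻¹ * (‖loop x t‖ - ‖x‖) ^ 2 := by field_simp; ring
      have : 0 ≤ (2 * ‖x‖)⁻¹ * (‖loop x t‖ - ‖x‖) ^ 2 := by positivity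
      linarith
    refine h1.trans (le_of_eq ?_)
    rw [intervalIntegral.integral_add, intervalIntegral.integral_const_mul, integral_norm_loop_sq,
      intervalIntegral.integral_const, smul_eq_mul]
    · field_simp; ring
    all_goals exact Continuous.intervalIntegrable (by fun_prop) _ _

lemma integral_flip (f : ℝ → ℝ) : ∫ t in (0 : ℝ)..1, f (1 - t) = ∫ t in (0 : ℝ)..1, f t := by
  simp

lemma wt_add {m N : ℕ} (x y : EuclideanSpace ℝ (Idx N m)) : wt (x + y) = wt x + wt y := by
  ext i; simp [wt, mul_add]

lemma wt_neg {m N : ℕ} (x : EuclideanSpace ℝ (Idx N m)) : wt (-x) = -wt x := by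
  ext i; simp [wt]

lemma inner_wt_comm {m N : ℕ} (x y : EuclideanSpace ℝ (Idx N m)) :
    inner ℝ (wt x) y = inner ℝ (wt y) x := by
  simp only [PiLp.inner_apply, wt]
  refine Finset.sum_congr rfl fun i _ => ?_
  simp only [RCLike.inner_apply, conj_trivial]; ring

lemma abs_freq_le {m N : ℕ} (i : Idx N m) : |freq i| ≤ 2 * Real.pi * N := by
  have h := Finset.mem_Icc.1 i.1.2
  have h1 : |(i.1.1 : ℝ)| ≤ N := by
    rw [abs_le]; constructor
    · exact_mod_cast h.1
    · exact_mod_cast h.2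
  rw [freq, abs_mul, abs_of_pos Real.two_pi_pos]
  exact mul_le_mul_of_nonneg_left h1 Real.two_pi_pos.le

lemma norm_wt_le {m N : ℕ} (x : EuclideanSpace ℝ (Idx N m)) : ‖wt x‖ ≤ 2 * Real.pi * N * ‖x‖ := by
  refine le_of_sq_le_sq ?_ (by positivity)
  rw [mul_pow, EuclideanSpace.norm_sq_eq, EuclideanSpace.norm_sq_eq, Finset.mul_sum]
  refine Finset.sum_le_sum fun i _ => ?_
  simp only [wt, norm_mul, Real.norm_eq_abs]
  rw [mul_pow]
  exact mul_le_mul_of_nonneg_right (pow_le_pow_left₀ (abs_nonneg _) (abs_freq_le i) 2) (sq_nonneg _)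

@[fun_prop]
lemma continuous_wt {m N : ℕ} : Continuous (wt : EuclideanSpace ℝ (Idx N m) → _) := by
  unfold wt
  fun_prop

end Trig

namespace Functional
open Trig

/-- The space of values `(a(t), a(1-t), w(t))`. -/
abbrev U (m : ℕ) : Type := CE 1 × CE 1 × CE m

/-- A family of Lagrangians with uniform bounds, even in the first two variables. -/
structure Tame {m : ℕ} (G : ℝ → ℝ → U m → ℝ) (DG : ℝ → ℝ → U m → U m →L[ℝ] ℝ) (C : ℝ) : Prop where
  nonneg : 0 ≤ C
  cont : Continuous fun p : ℝ × ℝ × U m => G p.1 p.2.1 p.2.2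
  contD : Continuous fun p : ℝ × ℝ × U m => DG p.1 p.2.1 p.2.2
  deriv : ∀ τ t u, HasFDerivAt (G τ t) (DG τ t u) u
  bound : ∀ τ ∈ Icc (0 : ℝ) 1, ∀ t u, |G τ t u| ≤ C
  boundD : ∀ τ ∈ Icc (0 : ℝ) 1, ∀ t u, ‖DG τ t u‖ ≤ C
  quad : ∀ τ ∈ Icc (0 : ℝ) 1, ∀ t u v, |G τ t (u + v) - G τ t u - DG τ t u v| ≤ C * ‖v‖ ^ 2
  even : ∀ τ t a b w, G τ t (-a, -b, w) = G τ t (a, b, w)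

variable {m N : ℕ}

/-- Evaluation of a pair of loops. -/
def ev (z : EuclideanSpace ℝ (Idx N 1)) (w : EuclideanSpace ℝ (Idx N m)) (t : ℝ) : U m :=
  (loop z t, loop z (1 - t), loop w t)

@[fun_prop]
lemma continuous_ev : Continuous fun p : (EuclideanSpace ℝ (Idx N 1) × EuclideanSpace ℝ (Idx N m)) × ℝ =>
    ev p.1.1 p.1.2 p.2 := by
  unfold ev
  have h1 := continuous_loop_uncurry (N := N) (m := 1)
  have h2 := continuous_loop_uncurry (N := N) (m := m)
  refine (h1.comp (g := fun q => loop q.1 q.2) (f := fun p : (EuclideanSpace ℝ (Idx N 1) × EuclideanSpace ℝ (Idx N m)) × ℝ => (p.1.1, p.2)) (by fun_prop)).prodMk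
    ((h1.comp (f := fun p : (EuclideanSpace ℝ (Idx N 1) × EuclideanSpace ℝ (Idx N m)) × ℝ => (p.1.1, 1 - p.2)) (by fun_prop)).prodMk
     (h2.comp (f := fun p : (EuclideanSpace ℝ (Idx N 1) × EuclideanSpace ℝ (Idx N m)) × ℝ => (p.1.2, p.2)) (by fun_prop)))

lemma continuous_ev_right (z : EuclideanSpace ℝ (Idx N 1)) (w : EuclideanSpace ℝ (Idx N m)) :
    Continuous (ev z w) :=
  continuous_ev.comp (f := fun t : ℝ => ((z, w), t)) (by fun_prop)

lemma ev_neg (z : EuclideanSpace ℝ (Idx N 1)) (w : EuclideanSpace ℝ (Idx N m)) (t : ℝ) :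
    ev (-z) w t = (-loop z t, -loop z (1 - t), loop w t) := by
  simp [ev, loop_neg]

variable (G : ℝ → ℝ → U m → ℝ) (DG : ℝ → ℝ → U m → U m →L[ℝ] ℝ)

/-- The action functional. -/
def act (τ : ℝ) (z : EuclideanSpace ℝ (Idx N 1)) (w : EuclideanSpace ℝ (Idx N m)) : ℝ :=
  1 / 2 * inner ℝ (wt z) z + 1 / 2 * inner ℝ (wt w) w - ∫ t in (0 : ℝ)..1, G τ t (ev z w t)

/-- The `z`-gradient of the nonlinear part of the action. -/
def pz (τ : ℝ) (z : EuclideanSpace ℝ (Idx N 1)) (w : EuclideanSpace ℝ (Idx N m)) :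
    EuclideanSpace ℝ (Idx N 1) :=
  WithLp.toLp 2 fun i => ∫ t in (0 : ℝ)..1,
    DG τ t (ev z w t) (bas i.toFull t, bas i.toFull (1 - t), 0)

/-- The `w`-gradient of the nonlinear part of the action. -/
def pw (τ : ℝ) (z : EuclideanSpace ℝ (Idx N 1)) (w : EuclideanSpace ℝ (Idx N m)) :
    EuclideanSpace ℝ (Idx N m) :=
  WithLp.toLp 2 fun i => ∫ t in (0 : ℝ)..1, DG τ t (ev z w t) (0, 0, bas i.toFull t)

variable {G DG} {C : ℝ} (hG : Tame G DG C)
include hG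

lemma Tame.contD_ev (τ : ℝ) : Continuous fun p : (EuclideanSpace ℝ (Idx N 1) ×
    EuclideanSpace ℝ (Idx N m)) × ℝ => DG τ p.2 (ev p.1.1 p.1.2 p.2) :=
  hG.contD.comp (continuous_const.prodMk (continuous_snd.prodMk continuous_ev))

lemma Tame.contD_ev_right (τ : ℝ) (z : EuclideanSpace ℝ (Idx N 1)) (w : EuclideanSpace ℝ (Idx N m)) :
    Continuous fun t => DG τ t (ev z w t) :=
  (hG.contD_ev τ).comp (f := fun t : ℝ => ((z, w), t)) (by fun_prop)

lemma Tame.cont_ev_right (τ : ℝ) (z : EuclideanSpace ℝ (Idx N 1)) (w : EuclideanSpace ℝ (Idx N m)) :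
    Continuous fun t => G τ t (ev z w t) :=
  hG.cont.comp (f := fun t : ℝ => (τ, t, ev z w t))
    (continuous_const.prodMk (continuous_id.prodMk (continuous_ev_right z w)))

lemma Tame.continuous_pz (τ : ℝ) : Continuous fun p : EuclideanSpace ℝ (Idx N 1) ×
    EuclideanSpace ℝ (Idx N m) => pz DG τ p.1 p.2 := by
  unfold pz
  refine (PiLp.continuous_toLp 2 _).comp (continuous_pi fun i => ?_)
  refine intervalIntegral.continuous_parametric_intervalIntegral_of_continuous' ?_ _ _
  exact (hG.contD_ev τ).clm_apply (by fun_prop)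

lemma Tame.continuous_pw (τ : ℝ) : Continuous fun p : EuclideanSpace ℝ (Idx N 1) ×
    EuclideanSpace ℝ (Idx N m) => pw DG τ p.1 p.2 := by
  unfold pw
  refine (PiLp.continuous_toLp 2 _).comp (continuous_pi fun i => ?_)
  refine intervalIntegral.continuous_parametric_intervalIntegral_of_continuous' ?_ _ _
  exact (hG.contD_ev τ).clm_apply (by fun_prop)

lemma Tame.inner_pz (τ : ℝ) (z : EuclideanSpace ℝ (Idx N 1)) (w : EuclideanSpace ℝ (Idx N m))
    (y : EuclideanSpace ℝ (Idx N 1)) : inner ℝ (pz DG τ z w) y =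
      ∫ t in (0 : ℝ)..1, DG τ t (ev z w t) (loop y t, loop y (1 - t), 0) := by
  have h : ∀ t, DG τ t (ev z w t) (loop y t, loop y (1 - t), 0) =
      ∑ i, y i * DG τ t (ev z w t) (bas i.toFull t, bas i.toFull (1 - t), 0) := fun t => by
    have : ((loop y t, loop y (1 - t), 0) : U m) =
        ∑ i, y i • ((bas i.toFull t, bas i.toFull (1 - t), 0) : U m) := by
      simp only [loop, Prod.smul_mk, smul_zero]
      refine Prod.ext ?_ (Prod.ext ?_ ?_)
      · simp [Prod.fst_sum]
      · simp [Prod.fst_sum, Prod.snd_sum]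
      · simp [Prod.snd_sum]
    rw [this, map_sum]
    simp only [map_smul, smul_eq_mul]
  simp_rw [h]
  rw [intervalIntegral.integral_finsetSum, PiLp.inner_apply]
  · refine Finset.sum_congr rfl fun i _ => ?_
    rw [intervalIntegral.integral_const_mul]
    simp [pz]
  · intro i _
    refine Continuous.intervalIntegrable ?_ _ _
    exact continuous_const.mul ((hG.contD_ev_right τ z w).clm_apply (by fun_prop))

lemma Tame.inner_pw (τ : ℝ) (z : EuclideanSpace ℝ (Idx N 1)) (w : EuclideanSpace ℝ (Idx N m))
    (y : EuclideanSpace ℝ (Idx N m)) : inner ℝ (pw DG τ z w) y =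
      ∫ t in (0 : ℝ)..1, DG τ t (ev z w t) (0, 0, loop y t) := by
  have h : ∀ t, DG τ t (ev z w t) (0, 0, loop y t) =
      ∑ i, y i * DG τ t (ev z w t) (0, 0, bas i.toFull t) := fun t => by
    have : ((0, 0, loop y t) : U m) = ∑ i, y i • ((0, 0, bas i.toFull t) : U m) := by
      simp only [loop, Prod.smul_mk, smul_zero]
      refine Prod.ext ?_ (Prod.ext ?_ ?_)
      · simp [Prod.fst_sum]
      · simp [Prod.fst_sum, Prod.snd_sum]
      · simp [Prod.snd_sum]
    rw [this, map_sum]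
    simp only [map_smul, smul_eq_mul]
  simp_rw [h]
  rw [intervalIntegral.integral_finsetSum, PiLp.inner_apply]
  · refine Finset.sum_congr rfl fun i _ => ?_
    rw [intervalIntegral.integral_const_mul]
    simp [pw]
  · intro i _
    refine Continuous.intervalIntegrable ?_ _ _
    exact continuous_const.mul ((hG.contD_ev_right τ z w).clm_apply (by fun_prop))

lemma Tame.norm_pz_le {τ : ℝ} (hτ : τ ∈ Icc (0 : ℝ) 1) (z : EuclideanSpace ℝ (Idx N 1))
    (w : EuclideanSpace ℝ (Idx N m)) : ‖pz DG τ z w‖ ≤ 2 * C := by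
  set p := pz DG τ z w with hp
  have h : ‖p‖ ^ 2 ≤ 2 * C * ‖p‖ := by
    rw [← real_inner_self_eq_norm_sq]
    nth_rewrite 1 [hp]
    rw [hG.inner_pz]
    calc _ ≤ ∫ t in (0 : ℝ)..1, (C * ‖loop p t‖ + C * ‖loop p (1 - t)‖) := by
          refine intervalIntegral.integral_mono_on zero_le_one
            (Continuous.intervalIntegrable ((hG.contD_ev_right τ z w).clm_apply (by fun_prop)) _ _)
            (Continuous.intervalIntegrable (by fun_prop) _ _) fun t _ => ?_
          have h1 := ((DG τ t (ev z w t)).le_opNorm (loop p t, loop p (1 - t), 0))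
          have h2 := (le_abs_self _).trans h1
          have h3 : ‖((loop p t, loop p (1 - t), 0) : U m)‖ ≤ ‖loop p t‖ + ‖loop p (1 - t)‖ := by
            simp only [Prod.norm_mk, norm_zero]
            refine max_le (by linarith [norm_nonneg (loop p (1 - t))]) (max_le ?_ (by positivity))
            linarith [norm_nonneg (loop p t)]
          calc _ ≤ _ := h2
            _ ≤ C * (‖loop p t‖ + ‖loop p (1 - t)‖) :=
              mul_le_mul (hG.boundD τ hτ t _) h3 (norm_nonneg _) hG.nonneg
            _ = _ := by ring
      _ = 2 * C * ∫ t in (0 : ℝ)..1, ‖loop p t‖ := by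
          rw [intervalIntegral.integral_add, intervalIntegral.integral_const_mul,
            intervalIntegral.integral_const_mul, integral_flip fun t => ‖loop p t‖]
          · ring
          all_goals exact Continuous.intervalIntegrable (by fun_prop) _ _
      _ ≤ 2 * C * ‖p‖ :=
          mul_le_mul_of_nonneg_left (integral_norm_loop_le p) (by linarith [hG.nonneg])
  rcases (norm_nonneg p).eq_or_lt with h0 | h0
  · rw [← h0]; linarith [hG.nonneg]
  · nlinarith

lemma Tame.norm_pw_le {τ : ℝ} (hτ : τ ∈ Icc (0 : ℝ) 1) (z : EuclideanSpace ℝ (Idx N 1))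
    (w : EuclideanSpace ℝ (Idx N m)) : ‖pw DG τ z w‖ ≤ C := by
  set p := pw DG τ z w with hp
  have h : ‖p‖ ^ 2 ≤ C * ‖p‖ := by
    rw [← real_inner_self_eq_norm_sq]
    nth_rewrite 1 [hp]
    rw [hG.inner_pw]
    calc _ ≤ ∫ t in (0 : ℝ)..1, C * ‖loop p t‖ := by
          refine intervalIntegral.integral_mono_on zero_le_one
            (Continuous.intervalIntegrable ((hG.contD_ev_right τ z w).clm_apply (by fun_prop)) _ _)
            (Continuous.intervalIntegrable (by fun_prop) _ _) fun t _ => ?_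
          have h1 := ((DG τ t (ev z w t)).le_opNorm (0, 0, loop p t))
          have h2 := (le_abs_self _).trans h1
          have h3 : ‖((0, 0, loop p t) : U m)‖ ≤ ‖loop p t‖ := by simp [Prod.norm_mk]
          exact h2.trans (mul_le_mul (hG.boundD τ hτ t _) h3 (norm_nonneg _) hG.nonneg)
      _ = C * ∫ t in (0 : ℝ)..1, ‖loop p t‖ := intervalIntegral.integral_const_mul _ _
      _ ≤ C * ‖p‖ := mul_le_mul_of_nonneg_left (integral_norm_loop_le p) hG.nonneg
  rcases (norm_nonneg p).eq_or_lt with h0 | h0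
  · rw [← h0]; exact hG.nonneg
  · nlinarith

lemma Tame.D_neg (τ t : ℝ) (a b : CE 1) (w : CE m) (v : U m) :
    DG τ t (-a, -b, w) v = DG τ t (a, b, w) (-v.1, -v.2.1, v.2.2) := by
  let L : U m →L[ℝ] U m :=
    ContinuousLinearMap.prodMap (-ContinuousLinearMap.id ℝ (CE 1))
      (ContinuousLinearMap.prodMap (-ContinuousLinearMap.id ℝ (CE 1)) (ContinuousLinearMap.id ℝ (CE m)))
  have hL : G τ t ∘ L = G τ t := funext fun u => hG.even τ t u.1 u.2.1 u.2.2
  have h1 : HasFDerivAt (G τ t ∘ L) ((DG τ t (L (-a, -b, w))).comp L) (-a, -b, w) :=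
    (hG.deriv τ t _).comp _ L.hasFDerivAt
  rw [hL] at h1
  have := (hG.deriv τ t (-a, -b, w)).unique h1
  rw [this]
  simp [L]
  rfl

lemma Tame.pz_neg (τ : ℝ) (z : EuclideanSpace ℝ (Idx N 1)) (w : EuclideanSpace ℝ (Idx N m)) :
    pz DG τ (-z) w = -pz DG τ z w := by
  ext i
  simp only [pz, PiLp.neg_apply, ← intervalIntegral.integral_neg]
  congr 1; funext t
  rw [ev_neg, hG.D_neg, ← map_neg]
  simp [ev]

lemma Tame.pw_neg (τ : ℝ) (z : EuclideanSpace ℝ (Idx N 1)) (w : EuclideanSpace ℝ (Idx N m)) :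
    pw DG τ (-z) w = pw DG τ z w := by
  ext i
  simp only [pw]
  congr 1; funext t
  rw [ev_neg, hG.D_neg]
  simp [ev]

lemma Tame.act_le {τ : ℝ} (hτ : τ ∈ Icc (0 : ℝ) 1) (z z' : EuclideanSpace ℝ (Idx N 1))
    (w w' : EuclideanSpace ℝ (Idx N m)) : act G τ z' w' ≤ act G τ z w +
      inner ℝ (wt z - pz DG τ z w) (z' - z) + inner ℝ (wt w - pw DG τ z w) (w' - w) +
      (2 * Real.pi * N + 2 * C) * (‖z' - z‖ ^ 2 + ‖w' - w‖ ^ 2) := by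
  have hq : ∀ {k : ℕ} (x d : EuclideanSpace ℝ (Idx N k)), 1 / 2 * inner ℝ (wt (x + d)) (x + d) ≤
      1 / 2 * inner ℝ (wt x) x + inner ℝ (wt x) d + 2 * Real.pi * N * ‖d‖ ^ 2 := fun x d => by
    rw [wt_add, inner_add_left, inner_add_right, inner_add_right, inner_wt_comm d x]
    have h1 := (real_inner_le_norm (wt d) d).trans
      (mul_le_mul_of_nonneg_right (norm_wt_le d) (norm_nonneg d))
    have : 0 ≤ 2 * Real.pi * N * ‖d‖ ^ 2 := by positivity
    nlinarith
  obtain ⟨dz, rfl⟩ : ∃ d, z' = z + d := ⟨z' - z, by abel⟩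
  obtain ⟨dw, rfl⟩ : ∃ d, w' = w + d := ⟨w' - w, by abel⟩
  rw [add_sub_cancel_left, add_sub_cancel_left, inner_sub_left, inner_sub_left, hG.inner_pz,
    hG.inner_pw]
  have h1 := hq z dz
  have h2 := hq w dw
  have h3 : (∫ t in (0 : ℝ)..1, G τ t (ev z w t)) +
      (∫ t in (0 : ℝ)..1, DG τ t (ev z w t) (loop dz t, loop dz (1 - t), 0)) +
      (∫ t in (0 : ℝ)..1, DG τ t (ev z w t) (0, 0, loop dw t)) -
      (∫ t in (0 : ℝ)..1, G τ t (ev (z + dz) (w + dw) t)) ≤ C * (2 * ‖dz‖ ^ 2 + ‖dw‖ ^ 2) := by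
    have c1 := hG.cont_ev_right τ z w
    have c2 := hG.cont_ev_right τ (z + dz) (w + dw)
    have c3 : Continuous fun t => DG τ t (ev z w t) (loop dz t, loop dz (1 - t), 0) :=
      (hG.contD_ev_right τ z w).clm_apply (by fun_prop)
    have c4 : Continuous fun t => DG τ t (ev z w t) (0, 0, loop dw t) :=
      (hG.contD_ev_right τ z w).clm_apply (by fun_prop)
    have c5 := c1.fun_add c3
    have c6 := c5.fun_add c4
    rw [← intervalIntegral.integral_add (c1.intervalIntegrable _ _) (c3.intervalIntegrable _ _),
      ← intervalIntegral.integral_add (c5.intervalIntegrable _ _) (c4.intervalIntegrable _ _),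
      ← intervalIntegral.integral_sub (c6.intervalIntegrable _ _)
        (c2.intervalIntegrable _ _)]
    calc _ ≤ ∫ t in (0 : ℝ)..1, C * (‖loop dz t‖ ^ 2 + ‖loop dz (1 - t)‖ ^ 2 + ‖loop dw t‖ ^ 2) := by
          refine intervalIntegral.integral_mono_on zero_le_one
            ((c6.sub c2).intervalIntegrable _ _)
            (Continuous.intervalIntegrable (by fun_prop) _ _) fun t _ => ?_
          have e1 : ev (z + dz) (w + dw) t = ev z w t + (loop dz t, loop dz (1 - t), loop dw t) := by
            simp [ev, loop_add]
          have e2 : ((loop dz t, loop dz (1 - t), loop dw t) : U m) =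
            (loop dz t, loop dz (1 - t), 0) + (0, 0, loop dw t) := by simp
          have h4 := hG.quad τ hτ t (ev z w t) (loop dz t, loop dz (1 - t), loop dw t)
          rw [← e1] at h4
          have h5 := (abs_le.1 h4).1
          have h6 : DG τ t (ev z w t) (loop dz t, loop dz (1 - t), loop dw t) =
            DG τ t (ev z w t) (loop dz t, loop dz (1 - t), 0) +
              DG τ t (ev z w t) (0, 0, loop dw t) := by rw [e2, map_add]
          have h7 : ‖((loop dz t, loop dz (1 - t), loop dw t) : U m)‖ ^ 2 ≤
              ‖loop dz t‖ ^ 2 + ‖loop dz (1 - t)‖ ^ 2 + ‖loop dw t‖ ^ 2 := by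
            simp only [Prod.norm_mk]
            rcases max_choice ‖loop dz t‖ (max ‖loop dz (1 - t)‖ ‖loop dw t‖) with h | h <;> rw [h]
            · nlinarith [sq_nonneg ‖loop dz (1 - t)‖, sq_nonneg ‖loop dw t‖]
            · rcases max_choice ‖loop dz (1 - t)‖ ‖loop dw t‖ with h | h <;> rw [h] <;>
              nlinarith [sq_nonneg ‖loop dz t‖, sq_nonneg ‖loop dz (1 - t)‖, sq_nonneg ‖loop dw t‖]
          have h8 := mul_le_mul_of_nonneg_left h7 hG.nonneg
          linarith
      _ = C * (2 * ‖dz‖ ^ 2 + ‖dw‖ ^ 2) := by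
          rw [intervalIntegral.integral_const_mul, intervalIntegral.integral_add,
            intervalIntegral.integral_add, integral_flip fun t => ‖loop dz t‖ ^ 2,
            integral_norm_loop_sq, integral_norm_loop_sq]
          · ring
          all_goals exact Continuous.intervalIntegrable (by fun_prop) _ _
  have h9 : C * (2 * ‖dz‖ ^ 2 + ‖dw‖ ^ 2) ≤ 2 * C * (‖dz‖ ^ 2 + ‖dw‖ ^ 2) := by
    nlinarith [mul_nonneg hG.nonneg (sq_nonneg ‖dw‖)]
  unfold act
  linarith

end Functional

namespace Trig

open Topology in
/-- Bounded uniformly Hölder sequences of paths subconverge uniformly. -/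
lemma exists_uniform_limit {E : Type*} [NormedAddCommGroup E] [ProperSpace E] {B A : ℝ}
    (F : ℕ → ℝ → E)
    (hB : ∀ k, ∀ t ∈ Icc (0 : ℝ) 1, ‖F k t‖ ≤ B)
    (hA : ∀ k, ∀ s ∈ Icc (0 : ℝ) 1, ∀ t ∈ Icc (0 : ℝ) 1, ‖F k t - F k s‖ ≤ A * √|t - s|) :
    ∃ f : ℝ → E, Continuous f ∧ ∃ φ : ℕ → ℕ, StrictMono φ ∧
      TendstoUniformlyOn (fun k => F (φ k)) f atTop (Icc 0 1) := by
  have hlim : ∀ s : Icc (0 : ℝ) 1, Tendsto (fun t : Icc (0 : ℝ) 1 => A * √|(t : ℝ) - s|) (𝓝 s) (𝓝 0) :=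
    fun s => by
      have : Continuous fun t : Icc (0 : ℝ) 1 => A * √|(t : ℝ) - s| := by fun_prop
      simpa using this.tendsto s
  let S : Set (BoundedContinuousFunction (Icc (0 : ℝ) 1) E) :=
    {g | (∀ t, ‖g t‖ ≤ B) ∧ ∀ s t : Icc (0 : ℝ) 1, ‖g t - g s‖ ≤ A * √|(t : ℝ) - s|}
  have hS : IsCompact (closure S) := by
    refine BoundedContinuousFunction.arzela_ascoli (Metric.closedBall 0 B)
      (isCompact_closedBall 0 B) S (fun f x hf => by simpa using hf.1 x) ?_
    intro s
    refine Metric.equicontinuousAt_of_continuity_modulus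
      (fun t : Icc (0 : ℝ) 1 => A * √|(t : ℝ) - s|) (hlim s) _ ?_
    refine Eventually.of_forall fun t g => ?_
    rw [dist_comm, dist_eq_norm]
    exact g.2.2 s t
  have hc : ∀ k, Continuous fun t : Icc (0 : ℝ) 1 => F k t := fun k => by
    rw [continuous_iff_continuousAt]
    intro s
    rw [ContinuousAt, tendsto_iff_norm_sub_tendsto_zero]
    exact squeeze_zero (fun _ => norm_nonneg _) (fun t => hA k s s.2 t t.2) (hlim s)
  let g : ℕ → BoundedContinuousFunction (Icc (0 : ℝ) 1) E := fun k =>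
    BoundedContinuousFunction.mkOfCompact ⟨fun t => F k t, hc k⟩
  have hg : ∀ k, g k ∈ closure S := fun k => subset_closure
    ⟨fun t => hB k t t.2, fun s t => hA k s s.2 t t.2⟩
  obtain ⟨f, -, φ, hφ, hf⟩ := hS.tendsto_subseq hg
  refine ⟨fun t => f (projIcc 0 1 zero_le_one t), f.continuous.comp continuous_projIcc, φ, hφ, ?_⟩
  rw [BoundedContinuousFunction.tendsto_iff_tendstoUniformly] at hf
  rw [Metric.tendstoUniformly_iff] at hf
  rw [Metric.tendstoUniformlyOn_iff]
  intro ε hε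
  filter_upwards [hf ε hε] with k hk t ht
  have := hk ⟨t, ht⟩
  rw [projIcc_of_mem zero_le_one ht]
  exact this

end Trig

namespace Functional
open Trig

variable {m : ℕ}

/-- The partial gradient with respect to the first variable. -/
def grad₀ (L : U m →L[ℝ] ℝ) : CE 1 :=
  (InnerProductSpace.toDual ℝ (CE 1)).symm (L.comp (ContinuousLinearMap.inl ℝ (CE 1) (CE 1 × CE m)))

/-- The partial gradient with respect to the second variable. -/
def grad₁ (L : U m →L[ℝ] ℝ) : CE 1 :=
  (InnerProductSpace.toDual ℝ (CE 1)).symm (L.comp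
    ((ContinuousLinearMap.inr ℝ (CE 1) (CE 1 × CE m)).comp (ContinuousLinearMap.inl ℝ (CE 1) (CE m))))

/-- The partial gradient with respect to the third variable. -/
def grad₂ (L : U m →L[ℝ] ℝ) : CE m :=
  (InnerProductSpace.toDual ℝ (CE m)).symm (L.comp
    ((ContinuousLinearMap.inr ℝ (CE 1) (CE 1 × CE m)).comp (ContinuousLinearMap.inr ℝ (CE 1) (CE m))))

lemma inner_grad₀ (L : U m →L[ℝ] ℝ) (v : CE 1) : inner ℝ (grad₀ L) v = L (v, 0, 0) := by
  rw [grad₀, InnerProductSpace.toDual_symm_apply]; rfl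

lemma inner_grad₁ (L : U m →L[ℝ] ℝ) (v : CE 1) : inner ℝ (grad₁ L) v = L (0, v, 0) := by
  rw [grad₁, InnerProductSpace.toDual_symm_apply]; rfl

lemma inner_grad₂ (L : U m →L[ℝ] ℝ) (v : CE m) : inner ℝ (grad₂ L) v = L (0, 0, v) := by
  rw [grad₂, InnerProductSpace.toDual_symm_apply]; rfl

@[fun_prop]
lemma continuous_grad₀ : Continuous (grad₀ : (U m →L[ℝ] ℝ) → CE 1) := by
  unfold grad₀; fun_prop

@[fun_prop]
lemma continuous_grad₁ : Continuous (grad₁ : (U m →L[ℝ] ℝ) → CE 1) := by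
  unfold grad₁; fun_prop

@[fun_prop]
lemma continuous_grad₂ : Continuous (grad₂ : (U m →L[ℝ] ℝ) → CE m) := by
  unfold grad₂; fun_prop

/-- The triple attached to a pair of paths. -/
def cv (a : ℝ → CE 1) (w : ℝ → CE m) (t : ℝ) : U m := (a t, a (1 - t), w t)

/-- A critical point of a Lagrange-multiplier problem for the deformed action, in integral form,
passing through the ball of radius `r` at some time in `[σ, 1]`. -/
structure IsChord (DG : ℝ → ℝ → U m → U m →L[ℝ] ℝ) (ρ σ r τ θ : ℝ) (a : ℝ → CE 1)
    (w : ℝ → CE m) : Prop where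
  cont_fst : Continuous a
  cont_snd : Continuous w
  mem : τ ∈ Icc (0 : ℝ) 1
  closed_fst : a 0 = a 1
  closed_snd : w 0 = w 1
  mass : ∫ t in (0 : ℝ)..1, ‖a t‖ ^ 2 = ρ ^ 2
  hit : ∃ t ∈ Icc σ 1, ‖w t‖ ≤ r
  eq_fst : ∀ t ∈ Icc (0 : ℝ) 1, ∀ j, a t j = a 0 j + ∫ s in (0 : ℝ)..t,
    -Complex.I * (grad₀ (DG τ s (cv a w s)) + grad₁ (DG τ (1 - s) (cv a w (1 - s))) + θ • a s) j
  eq_snd : ∀ t ∈ Icc (0 : ℝ) 1, ∀ j, w t j = w 0 j + ∫ s in (0 : ℝ)..t,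
    -Complex.I * (grad₂ (DG τ s (cv a w s))) j

variable {G : ℝ → ℝ → U m → ℝ} {DG : ℝ → ℝ → U m → U m →L[ℝ] ℝ} {C : ℝ}

open Topology in
lemma Tame.isChord_of_tendsto (hG : Tame G DG C) {ρ σ r τ θ : ℝ} {a : ℝ → CE 1} {w : ℝ → CE m}
    {B : ℝ} {N : ℕ → ℕ} (hN : Tendsto N atTop atTop) {T Θ tk e : ℕ → ℝ} {t₀ : ℝ}
    (hT : ∀ k, T k ∈ Icc (0 : ℝ) 1)
    (hTτ : Tendsto T atTop (𝓝 τ)) (hΘ : Tendsto Θ atTop (𝓝 θ)) (ht : Tendsto tk atTop (𝓝 t₀))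
    (htk : ∀ k, tk k ∈ Icc σ 1) (hσ : 0 ≤ σ) (he : Tendsto e atTop (𝓝 0))
    (x : ∀ k, EuclideanSpace ℝ (Idx (N k) 1)) (y : ∀ k, EuclideanSpace ℝ (Idx (N k) m))
    (hx : ∀ k, ‖x k‖ = ρ)
    (hB : ∀ k, ∀ t ∈ Icc (0 : ℝ) 1, ‖(loop (x k) t, loop (y k) t)‖ ≤ B)
    (ha : Continuous a) (hw : Continuous w)
    (hlim : TendstoUniformlyOn (fun k t => (loop (x k) t, loop (y k) t)) (fun t => (a t, w t)) atTop
      (Icc 0 1))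
    (hex : ∀ k, ‖wt (x k) - pz DG (T k) (x k) (y k) - Θ k • x k‖ ≤ e k)
    (hey : ∀ k, ‖wt (y k) - pw DG (T k) (x k) (y k)‖ ≤ e k)
    (hhit : ∀ k, ‖loop (y k) (tk k)‖ ≤ r + e k) : IsChord DG ρ σ r τ θ a w := by
  have hlx : ∀ t ∈ Icc (0 : ℝ) 1, Tendsto (fun k => loop (x k) t) atTop (𝓝 (a t)) := fun t h =>
    (continuous_fst.tendsto _).comp (hlim.tendsto_at h)
  have hly : ∀ t ∈ Icc (0 : ℝ) 1, Tendsto (fun k => loop (y k) t) atTop (𝓝 (w t)) := fun t h =>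
    (continuous_snd.tendsto _).comp (hlim.tendsto_at h)
  have h0 : (0 : ℝ) ∈ Icc (0 : ℝ) 1 := by simp
  have h1 : (1 : ℝ) ∈ Icc (0 : ℝ) 1 := by simp
  have hsub : ∀ t ∈ uIoc (0 : ℝ) 1, t ∈ Icc (0 : ℝ) 1 := fun t h => by
    rw [uIoc_of_le zero_le_one] at h; exact ⟨h.1.le, h.2⟩
  have hxB : ∀ k, ∀ t ∈ Icc (0 : ℝ) 1, ‖loop (x k) t‖ ≤ B := fun k t h =>
    (norm_fst_le _).trans (hB k t h)
  have hyB : ∀ k, ∀ t ∈ Icc (0 : ℝ) 1, ‖loop (y k) t‖ ≤ B := fun k t h =>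
    (norm_snd_le _).trans (hB k t h)
  have hτ : τ ∈ Icc (0 : ℝ) 1 := isClosed_Icc.mem_of_tendsto hTτ (Eventually.of_forall hT)
  have hcl1 : a 0 = a 1 := tendsto_nhds_unique (hlx 0 h0) (by simpa only [loop_one] using hlx 1 h1)
  have hcl2 : w 0 = w 1 := tendsto_nhds_unique (hly 0 h0) (by simpa only [loop_one] using hly 1 h1)
  have hu : Continuous (cv a w) := by unfold cv; fun_prop
  have hev : ∀ t ∈ Icc (0 : ℝ) 1, Tendsto (fun k => ev (x k) (y k) t) atTop (𝓝 (cv a w t)) :=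
    fun t h => (hlx t h).prodMk_nhds ((hlx (1 - t) ⟨by linarith [h.2], by linarith [h.1]⟩).prodMk_nhds
      (hly t h))
  have hD : ∀ t ∈ Icc (0 : ℝ) 1, Tendsto (fun k => DG (T k) t (ev (x k) (y k) t)) atTop
      (𝓝 (DG τ t (cv a w t))) := fun t h =>
    (hG.contD.tendsto (τ, t, cv a w t)).comp
      (hTτ.prodMk_nhds (tendsto_const_nhds.prodMk_nhds (hev t h)))
  have hDc : Continuous fun t => DG τ t (cv a w t) :=
    hG.contD.comp (f := fun t => (τ, t, cv a w t)) (by fun_prop)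
  have hg0 : Continuous fun t => grad₀ (DG τ t (cv a w t)) := continuous_grad₀.comp hDc
  have hg2 : Continuous fun t => grad₂ (DG τ t (cv a w t)) := continuous_grad₂.comp hDc
  have hg1 : Continuous fun t => grad₁ (DG τ (1 - t) (cv a w (1 - t))) :=
    (continuous_grad₁.comp hDc).comp (f := fun t : ℝ => 1 - t) (by fun_prop)
  have hDc' : Continuous fun t => DG τ (1 - t) (cv a w (1 - t)) :=
    hDc.comp (f := fun t : ℝ => 1 - t) (by fun_prop)
  -- dominated convergence for the pairings
  have hpair : ∀ {l : ℕ} (X : ℕ → ℝ → CE l) (X₀ : ℝ → CE l) (p : ℤ × Fin l × Bool),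
      (∀ k, Continuous (X k)) → (∀ k, ∀ t ∈ Icc (0 : ℝ) 1, ‖X k t‖ ≤ B) →
      (∀ t ∈ Icc (0 : ℝ) 1, Tendsto (fun k => X k t) atTop (𝓝 (X₀ t))) →
      Tendsto (fun k => ∫ t in (0 : ℝ)..1, inner ℝ (X k t) (bas p t)) atTop
        (𝓝 (∫ t in (0 : ℝ)..1, inner ℝ (X₀ t) (bas p t))) := fun X X₀ p hXc hXB hX => by
    refine intervalIntegral.tendsto_integral_filter_of_dominated_convergence (fun _ => B)
      (Eventually.of_forall fun k => ?_) (Eventually.of_forall fun k => ?_)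
      (by simp) ?_
    · have := hXc k
      exact Continuous.aestronglyMeasurable (by fun_prop)
    · refine Eventually.of_forall fun t h => ?_
      refine (norm_inner_le_norm _ _).trans ?_
      rw [norm_bas, mul_one]; exact hXB k t (hsub t h)
    · exact Eventually.of_forall fun t h => (hX t (hsub t h)).inner tendsto_const_nhds
  have hDpair : ∀ V : ℝ → U m, Continuous V → (∀ t, ‖V t‖ ≤ 1) →
      Tendsto (fun k => ∫ t in (0 : ℝ)..1, DG (T k) t (ev (x k) (y k) t) (V t)) atTop
        (𝓝 (∫ t in (0 : ℝ)..1, DG τ t (cv a w t) (V t))) := fun V hV hV1 => by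
    refine intervalIntegral.tendsto_integral_filter_of_dominated_convergence (fun _ => C)
      (Eventually.of_forall fun k => ?_) (Eventually.of_forall fun k => ?_)
      (by simp) ?_
    · exact ((hG.contD_ev_right (T k) (x k) (y k)).clm_apply hV).aestronglyMeasurable
    · refine Eventually.of_forall fun t h => ?_
      refine (ContinuousLinearMap.le_opNorm _ _).trans ?_
      exact (mul_le_mul (hG.boundD _ (hT k) _ _) (hV1 t) (norm_nonneg _) hG.nonneg).trans (by simp)
    · exact Eventually.of_forall fun t h => ((ContinuousLinearMap.apply ℝ ℝ (V t)).continuous.tendsto _).comp (hD t (hsub t h))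
  have hz : ∀ (f : ℕ → ℝ) (c : ℝ), Tendsto f atTop (𝓝 c) → (∀ᶠ k in atTop, |f k| ≤ e k) → c = 0 :=
    fun f c hf hfe => tendsto_nhds_unique hf (squeeze_zero_norm' hfe he)
  have hmem : ∀ p : ℤ, ∀ᶠ k in atTop, p ∈ Finset.Icc (-(N k : ℤ)) (N k) := fun p => by
    filter_upwards [hN.eventually_ge_atTop p.natAbs] with k hk
    rw [Finset.mem_Icc]; omega
  refine ⟨ha, hw, hτ, hcl1, hcl2, ?_, ⟨t₀, isClosed_Icc.mem_of_tendsto ht (Eventually.of_forall htk),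
    ?_⟩, ?_, ?_⟩
  · have h : Tendsto (fun k => ∫ t in (0 : ℝ)..1, ‖loop (x k) t‖ ^ 2) atTop
        (𝓝 (∫ t in (0 : ℝ)..1, ‖a t‖ ^ 2)) := by
      refine intervalIntegral.tendsto_integral_filter_of_dominated_convergence (fun _ => B ^ 2)
        (Eventually.of_forall fun k => ?_) (Eventually.of_forall fun k => ?_)
        (by simp) ?_
      · exact Continuous.aestronglyMeasurable (by fun_prop)
      · refine Eventually.of_forall fun t h => ?_
        rw [norm_pow, norm_norm]
        exact pow_le_pow_left₀ (norm_nonneg _) (hxB k t (hsub t h)) 2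
      · exact Eventually.of_forall fun t h => (hlx t (hsub t h)).norm.pow 2
    simp_rw [integral_norm_loop_sq, hx] at h
    exact tendsto_nhds_unique h tendsto_const_nhds
  · have ht₀ : t₀ ∈ Icc σ 1 := isClosed_Icc.mem_of_tendsto ht (Eventually.of_forall htk)
    have hsσ : Icc σ 1 ⊆ Icc (0 : ℝ) 1 := Icc_subset_Icc_left hσ
    have h := hlim.tendsto_comp (g := tk) (x := t₀) (Continuous.continuousWithinAt (by fun_prop))
      (tendsto_nhdsWithin_iff.2 ⟨ht, Eventually.of_forall fun k => hsσ (htk k)⟩)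
    have h' : Tendsto (fun k => ‖loop (y k) (tk k)‖) atTop (𝓝 ‖w t₀‖) :=
      ((continuous_snd.tendsto _).comp h).norm
    have h'' : Tendsto (fun k => r + e k) atTop (𝓝 r) := by simpa using he.const_add r
    exact le_of_tendsto_of_tendsto' h' h'' hhit
  · intro t h j
    refine eq_integral_of_coeff ha (g := fun s => grad₀ (DG τ s (cv a w s)) +
      grad₁ (DG τ (1 - s) (cv a w (1 - s))) + θ • a s) ((hg0.fun_add hg1).fun_add (ha.const_smul θ)) hcl1 (fun p => ?_) h j
    have hV : Continuous fun t => ((bas p t, bas p (1 - t), 0) : U m) := by fun_prop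
    have e1 : ∫ t in (0 : ℝ)..1, inner ℝ (grad₀ (DG τ t (cv a w t)) +
        grad₁ (DG τ (1 - t) (cv a w (1 - t))) + θ • a t) (bas p t) =
        (∫ t in (0 : ℝ)..1, DG τ t (cv a w t) (bas p t, bas p (1 - t), 0)) +
        θ * ∫ t in (0 : ℝ)..1, inner ℝ (a t) (bas p t) := by
      have i0 : Continuous fun t => DG τ t (cv a w t) (bas p t, 0, 0) :=
        hDc.clm_apply (by fun_prop)
      have i1 : Continuous fun t => DG τ t (cv a w t) (0, bas p (1 - t), 0) :=
        hDc.clm_apply (by fun_prop)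
      have i2 : Continuous fun t => DG τ (1 - t) (cv a w (1 - t)) (0, bas p t, 0) :=
        hDc'.clm_apply (by fun_prop)
      have i3 : Continuous fun t => inner ℝ (a t) (bas p t) := by fun_prop
      have i4 := i0.fun_add i2
      simp only [inner_add_left, inner_grad₀, inner_grad₁, real_inner_smul_left]
      rw [intervalIntegral.integral_add (i4.intervalIntegrable _ _)
        ((i3.const_mul θ).intervalIntegrable _ _), intervalIntegral.integral_const_mul,
        intervalIntegral.integral_add (i0.intervalIntegrable _ _) (i2.intervalIntegrable _ _)]
      congr 1
      have e2 : ∫ t in (0 : ℝ)..1, DG τ (1 - t) (cv a w (1 - t)) (0, bas p t, 0) =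
          ∫ t in (0 : ℝ)..1, DG τ t (cv a w t) (0, bas p (1 - t), 0) := by
        rw [← integral_flip]; simp
      rw [e2, ← intervalIntegral.integral_add (i0.intervalIntegrable _ _)
        (i1.intervalIntegrable _ _)]
      congr 1; funext t
      rw [← map_add]; simp
    rw [e1]
    have hl1 := hpair _ a p (fun k => continuous_loop (x k)) hxB hlx
    have hl2 := hDpair _ hV fun t => by simp [Prod.norm_mk, norm_bas]
    have hl := ((hl1.const_mul (2 * Real.pi * p.1)).sub hl2).sub (hΘ.mul hl1)
    have := hz _ _ hl (by
      filter_upwards [hmem p.1] with k hk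
      have h2 := (PiLp.norm_apply_le _ (⟨⟨p.1, hk⟩, p.2⟩ : Idx (N k) 1)).trans (hex k)
      have h3 := integral_inner_loop_bas (x k) ⟨⟨p.1, hk⟩, p.2⟩
      simp only [Idx.toFull] at h3
      rw [Real.norm_eq_abs] at h2
      refine (le_of_eq (congrArg abs ?_)).trans h2
      simp only [PiLp.sub_apply, PiLp.smul_apply, wt, pz, freq, Idx.toFull, smul_eq_mul, ← h3])
    linarith
  · intro t h j
    refine eq_integral_of_coeff hw (g := fun s => grad₂ (DG τ s (cv a w s)))
      hg2 hcl2 (fun p => ?_) h j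
    have hV : Continuous fun t => ((0, 0, bas p t) : U m) := by fun_prop
    simp only [inner_grad₂]
    have hl1 := hpair _ w p (fun k => continuous_loop (y k)) hyB hly
    have hl2 := hDpair _ hV fun t => by simp [Prod.norm_mk, norm_bas]
    have hl := (hl1.const_mul (2 * Real.pi * p.1)).sub hl2
    have := hz _ _ hl (by
      filter_upwards [hmem p.1] with k hk
      have h2 := (PiLp.norm_apply_le _ (⟨⟨p.1, hk⟩, p.2⟩ : Idx (N k) m)).trans (hey k)
      have h3 := integral_inner_loop_bas (y k) ⟨⟨p.1, hk⟩, p.2⟩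
      simp only [Idx.toFull] at h3
      rw [Real.norm_eq_abs] at h2
      refine (le_of_eq (congrArg abs ?_)).trans h2
      simp only [PiLp.sub_apply, wt, pw, freq, Idx.toFull, ← h3])
    linarith

end Functional

namespace Trig

lemma abs_inner_wt_le {m N : ℕ} (x : EuclideanSpace ℝ (Idx N m)) :
    |inner ℝ (wt x) x| ≤ ‖wt x‖ ^ 2 := by
  rw [EuclideanSpace.norm_sq_eq, PiLp.inner_apply]
  refine (Finset.abs_sum_le_sum_abs _ _).trans (Finset.sum_le_sum fun i _ => ?_)
  have h : |freq i| ≤ freq i ^ 2 := by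
    rcases eq_or_ne i.1.1 0 with h0 | h0
    · simp [freq, h0]
    · have h1 : (1 : ℝ) ≤ |(i.1.1 : ℝ)| := by exact_mod_cast Int.one_le_abs h0
      have h2 : 1 ≤ |freq i| := by
        rw [freq, abs_mul, abs_of_pos Real.two_pi_pos]
        nlinarith [Real.pi_gt_three]
      rw [← sq_abs]; nlinarith
  simp only [wt, RCLike.inner_apply, conj_trivial, Real.norm_eq_abs, sq_abs]
  rw [show x i * (freq i * x i) = freq i * x i ^ 2 by ring, abs_mul, abs_of_nonneg (sq_nonneg (x i)),
    mul_pow]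
  exact mul_le_mul_of_nonneg_right h (sq_nonneg _)

lemma norm_loop_le_of_anchor {m N : ℕ} (x : EuclideanSpace ℝ (Idx N m)) {s t : ℝ}
    (hs : s ∈ Icc (0 : ℝ) 1) (ht : t ∈ Icc (0 : ℝ) 1) :
    ‖loop x t‖ ≤ ‖loop x s‖ + (‖wt x‖ ^ 2 + 1) := by
  have h1 := norm_loop_sub_le x hs ht
  have h2 : √|t - s| ≤ 1 := by
    rw [Real.sqrt_le_one, abs_le]
    constructor <;> linarith [hs.1, hs.2, ht.1, ht.2]
  have h3 : (‖wt x‖ ^ 2 + 1) * √|t - s| ≤ (‖wt x‖ ^ 2 + 1) * 1 :=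
    mul_le_mul_of_nonneg_left h2 (by positivity)
  have h4 := norm_sub_norm_le (loop x t) (loop x s)
  linarith

lemma norm_loop_le_add {m N : ℕ} (x : EuclideanSpace ℝ (Idx N m)) {t : ℝ}
    (ht : t ∈ Icc (0 : ℝ) 1) : ‖loop x t‖ ≤ ‖x‖ + (‖wt x‖ ^ 2 + 1) := by
  by_contra! h
  have h1 : ∀ s ∈ Icc (0 : ℝ) 1, ‖loop x t‖ - (‖wt x‖ ^ 2 + 1) ≤ ‖loop x s‖ := fun s hs => by
    linarith [norm_loop_le_of_anchor x hs ht]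
  have h2 : ∫ s in (0 : ℝ)..1, (‖loop x t‖ - (‖wt x‖ ^ 2 + 1)) ^ 2 ≤
      ∫ s in (0 : ℝ)..1, ‖loop x s‖ ^ 2 :=
    intervalIntegral.integral_mono_on zero_le_one (by simp)
      (Continuous.intervalIntegrable (by fun_prop) _ _) fun s hs =>
        pow_le_pow_left₀ (by linarith [norm_nonneg x]) (h1 s hs) 2
  rw [integral_norm_loop_sq, intervalIntegral.integral_const, smul_eq_mul] at h2
  nlinarith [norm_nonneg x]

end Trig

namespace Functional
open Trig

variable {m : ℕ} {G : ℝ → ℝ → U m → ℝ} {DG : ℝ → ℝ → U m → U m →L[ℝ] ℝ} {C : ℝ}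

open Topology in
lemma Tame.exists_chord_of_seq (hG : Tame G DG C) {ρ σ r A B : ℝ} (hσ : 0 ≤ σ) {T Θ tk : ℕ → ℝ}
    (hT : ∀ k, T k ∈ Icc (0 : ℝ) 1) (hΘ : ∀ k, |Θ k| ≤ A) (htk : ∀ k, tk k ∈ Icc σ 1)
    (x : ∀ k, EuclideanSpace ℝ (Idx k 1)) (y : ∀ k, EuclideanSpace ℝ (Idx k m))
    (hx : ∀ k, ‖x k‖ = ρ) (hwx : ∀ k, ‖wt (x k)‖ ≤ B) (hwy : ∀ k, ‖wt (y k)‖ ≤ B)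
    (hex : ∀ k : ℕ, ‖wt (x k) - pz DG (T k) (x k) (y k) - Θ k • x k‖ ≤ 1 / ((k : ℝ) + 1))
    (hey : ∀ k : ℕ, ‖wt (y k) - pw DG (T k) (x k) (y k)‖ ≤ 1 / ((k : ℝ) + 1))
    (hhit : ∀ k : ℕ, ‖loop (y k) (tk k)‖ ≤ r + 1 / ((k : ℝ) + 1)) :
    ∃ τ θ a w, IsChord DG ρ σ r τ θ a w := by
  let F : ℕ → ℝ → CE 1 × CE m := fun k t => (loop (x k) t, loop (y k) t)
  have hone : ∀ k : ℕ, 1 / ((k : ℝ) + 1) ≤ 1 := fun k => by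
    rw [div_le_one (by positivity)]; linarith [k.cast_nonneg (α := ℝ)]
  have hFB : ∀ k, ∀ t ∈ Icc (0 : ℝ) 1, ‖F k t‖ ≤ |r| + ρ + 1 + (B ^ 2 + 1) := fun k t ht => by
    have hsq : ∀ {l : ℝ}, 0 ≤ l → l ≤ B → l ^ 2 ≤ B ^ 2 := fun h h' => pow_le_pow_left₀ h h' 2
    have h1 := norm_loop_le_add (x k) ht
    have h2 := norm_loop_le_of_anchor (y k) (s := tk k) ⟨hσ.trans (htk k).1, (htk k).2⟩ ht
    have h3 := hsq (norm_nonneg _) (hwx k)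
    have h4 := hsq (norm_nonneg _) (hwy k)
    have h5 : 0 ≤ ρ := hx 0 ▸ norm_nonneg _
    rw [hx] at h1
    exact max_le (by linarith [abs_nonneg r]) (by linarith [hhit k, hone k, le_abs_self r])
  have hFA : ∀ k, ∀ s ∈ Icc (0 : ℝ) 1, ∀ t ∈ Icc (0 : ℝ) 1,
      ‖F k t - F k s‖ ≤ (B ^ 2 + 1) * √|t - s| := fun k s hs t ht => by
    have hsq : ∀ {l : ℝ}, 0 ≤ l → l ≤ B → (l ^ 2 + 1) * √|t - s| ≤ (B ^ 2 + 1) * √|t - s| :=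
      fun h h' => mul_le_mul_of_nonneg_right (by linarith [pow_le_pow_left₀ h h' 2])
        (Real.sqrt_nonneg _)
    exact max_le ((norm_loop_sub_le (x k) hs ht).trans (hsq (norm_nonneg _) (hwx k)))
      ((norm_loop_sub_le (y k) hs ht).trans (hsq (norm_nonneg _) (hwy k)))
  have hcpt : IsCompact (Icc (0 : ℝ) 1 ×ˢ Icc (-A) A ×ˢ Icc σ 1) :=
    isCompact_Icc.prod (isCompact_Icc.prod isCompact_Icc)
  obtain ⟨⟨τ, θ, t₀⟩, -, φ, hφ, hlim⟩ := hcpt.tendsto_subseq (x := fun k => (T k, Θ k, tk k))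
    fun k => ⟨hT k, abs_le.1 (hΘ k), htk k⟩
  obtain ⟨f, hf, ψ, hψ, hFf⟩ := exists_uniform_limit (fun k => F (φ k)) (fun k => hFB _)
    (fun k => hFA _)
  have hχ : StrictMono (φ ∘ ψ) := hφ.comp hψ
  have hlim' := hlim.comp hψ.tendsto_atTop
  refine ⟨τ, θ, fun t => (f t).1, fun t => (f t).2, hG.isChord_of_tendsto (N := φ ∘ ψ)
    (T := T ∘ φ ∘ ψ) (Θ := Θ ∘ φ ∘ ψ) (tk := tk ∘ φ ∘ ψ)
    (e := (fun k : ℕ => 1 / ((k : ℝ) + 1)) ∘ φ ∘ ψ) hχ.tendsto_atTop (fun k => hT _)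
    ((continuous_fst.tendsto _).comp hlim')
    (((continuous_fst.comp continuous_snd).tendsto _).comp hlim')
    (((continuous_snd.comp continuous_snd).tendsto _).comp hlim') (fun k => htk _) hσ
    (tendsto_one_div_add_atTop_nhds_zero_nat.comp hχ.tendsto_atTop) (fun k => x _) (fun k => y _)
    (fun k => hx _) (fun k => hFB _) (by fun_prop) (by fun_prop) hFf (fun k => hex _)
    (fun k => hey _) (fun k => hhit _)⟩

lemma Tame.abs_integral_le (hG : Tame G DG C) {N : ℕ} {τ : ℝ} (hτ : τ ∈ Icc (0 : ℝ) 1)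
    (z : EuclideanSpace ℝ (Idx N 1)) (w : EuclideanSpace ℝ (Idx N m)) :
    |∫ t in (0 : ℝ)..1, G τ t (ev z w t)| ≤ C := by
  have := intervalIntegral.norm_integral_le_of_norm_le_const (a := 0) (b := 1) (C := C)
    (f := fun t => G τ t (ev z w t)) fun t _ => hG.bound τ hτ t _
  simpa using this

lemma Tame.exists_gap (hG : Tame G DG C) {ρ σ r b : ℝ} (hρ : 0 < ρ) (hσ : 0 ≤ σ)
    (hno : ∀ τ θ a w, ¬IsChord DG ρ σ r τ θ a w) :
    ∃ N : ℕ, ∃ δ > 0, ∃ η > 0, ∀ τ ∈ Icc (0 : ℝ) 1, ∀ (z : EuclideanSpace ℝ (Idx N 1))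
      (w : EuclideanSpace ℝ (Idx N m)), ‖z‖ = ρ → b - 1 ≤ act G τ z w → act G τ z w ≤ b →
      ‖Minimax.tang ρ z (wt z - pz DG τ z w)‖ ^ 2 + ‖wt w - pw DG τ z w‖ ^ 2 < δ ^ 2 →
      ∀ w', ‖w' - w‖ ≤ η → ∀ t ∈ Icc σ 1, r < ‖loop w' t‖ := by
  by_contra! hcon
  have hdat : ∀ k : ℕ, ∃ τ ∈ Icc (0 : ℝ) 1, ∃ (z : EuclideanSpace ℝ (Idx k 1))
      (w : EuclideanSpace ℝ (Idx k m)), ‖z‖ = ρ ∧ b - 1 ≤ act G τ z w ∧ act G τ z w ≤ b ∧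
      ‖Minimax.tang ρ z (wt z - pz DG τ z w)‖ ≤ 1 / ((k : ℝ) + 1) ∧
      ‖wt w - pw DG τ z w‖ ≤ 1 / ((k : ℝ) + 1) ∧
      ∃ t ∈ Icc σ 1, ‖loop w t‖ ≤ r + 1 / ((k : ℝ) + 1) := fun k => by
    have hk : (0 : ℝ) < 1 / ((k : ℝ) + 1) := by positivity
    have hc : (0 : ℝ) < Fintype.card (Idx k m) + 1 := by positivity
    obtain ⟨τ, hτ, z, w, hz, h1, h2, h3, w', hw', t, ht, h4⟩ :=
      hcon k (1 / ((k : ℝ) + 1)) hk (1 / ((k : ℝ) + 1) / (Fintype.card (Idx k m) + 1)) (by positivity)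
    refine ⟨τ, hτ, z, w, hz, h1, h2, ?_, ?_, t, ht, ?_⟩
    · exact abs_le_of_sq_le_sq' (by nlinarith [sq_nonneg ‖wt w - pw DG τ z w‖]) hk.le |>.2
    · exact abs_le_of_sq_le_sq' (by
        nlinarith [sq_nonneg ‖Minimax.tang ρ z (wt z - pz DG τ z w)‖]) hk.le |>.2
    · have h5 := norm_loop_le (w' - w) t
      have h6 : (Fintype.card (Idx k m) : ℝ) * ‖w' - w‖ ≤ 1 / ((k : ℝ) + 1) := by
        rw [le_div_iff₀ hc] at hw'
        nlinarith [norm_nonneg (w' - w)]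
      have h7 : loop w t = loop w' t - loop (w' - w) t := by rw [loop_sub]; abel
      have h8 := norm_sub_le (loop w' t) (loop (w' - w) t)
      rw [h7]; linarith
  choose T hT x y hx hlo hhi hex hey tk htk hhit using hdat
  have hone : ∀ k : ℕ, 1 / ((k : ℝ) + 1) ≤ 1 := fun k => by
    rw [div_le_one (by positivity)]; linarith [k.cast_nonneg (α := ℝ)]
  have hwy : ∀ k, ‖wt (y k)‖ ≤ C + 1 := fun k => by
    have h1 := hG.norm_pw_le (hT k) (x k) (y k)
    have h2 := norm_le_norm_add_norm_sub (pw DG (T k) (x k) (y k)) (wt (y k))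
    have h3 := norm_sub_norm_le (wt (y k)) (pw DG (T k) (x k) (y k))
    linarith [hey k, hone k]
  have hin : ∀ k, |inner ℝ (wt (x k)) (x k)| ≤ 2 * (|b| + 1) + (C + 1) ^ 2 + 2 * C := fun k => by
    have h1 := abs_le.1 (hG.abs_integral_le (hT k) (x k) (y k))
    have h2 := abs_le.1 ((abs_inner_wt_le (y k)).trans (pow_le_pow_left₀ (norm_nonneg _) (hwy k) 2))
    have h3 := hlo k
    have h4 := hhi k
    unfold act at h3 h4
    rw [abs_le]
    constructor <;> linarith [neg_abs_le b, le_abs_self b]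
  set D := 2 * (|b| + 1) + (C + 1) ^ 2 + 2 * C with hD
  let Θ : ℕ → ℝ := fun k => inner ℝ (wt (x k) - pz DG (T k) (x k) (y k)) (x k) / ρ ^ 2
  have hΘ : ∀ k, |Θ k| ≤ (D + 2 * C * ρ) / ρ ^ 2 := fun k => by
    have hp := hG.norm_pz_le (hT k) (x k) (y k)
    have h1 := abs_real_inner_le_norm (pz DG (T k) (x k) (y k)) (x k)
    rw [hx] at h1
    have h2 : ‖pz DG (T k) (x k) (y k)‖ * ρ ≤ 2 * C * ρ := mul_le_mul_of_nonneg_right hp hρ.le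
    simp only [Θ, inner_sub_left]
    rw [abs_div, abs_of_pos (pow_pos hρ 2)]
    refine div_le_div_of_nonneg_right ?_ (sq_nonneg ρ)
    exact (abs_sub _ _).trans (by linarith [hin k])
  have hex' : ∀ k : ℕ, ‖wt (x k) - pz DG (T k) (x k) (y k) - Θ k • x k‖ ≤ 1 / ((k : ℝ) + 1) := hex
  set A := (D + 2 * C * ρ) / ρ ^ 2 with hA
  have hwx : ∀ k, ‖wt (x k)‖ ≤ 1 + 2 * C + A * ρ := fun k => by
    have h1 := hG.norm_pz_le (hT k) (x k) (y k)
    have h2 : ‖Θ k • x k‖ ≤ A * ρ := by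
      rw [norm_smul, hx, Real.norm_eq_abs]
      exact mul_le_mul_of_nonneg_right (hΘ k) hρ.le
    have h3 : wt (x k) = (wt (x k) - pz DG (T k) (x k) (y k) - Θ k • x k) +
      pz DG (T k) (x k) (y k) + Θ k • x k := by abel
    have h4 := norm_add₃_le (a := wt (x k) - pz DG (T k) (x k) (y k) - Θ k • x k)
      (b := pz DG (T k) (x k) (y k)) (c := Θ k • x k)
    rw [← h3] at h4
    linarith [hex' k, hone k]
  obtain ⟨τ, θ, a, w, h⟩ := hG.exists_chord_of_seq (r := r) hσ hT hΘ htk x y hx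
    (fun k => (hwx k).trans (le_max_left _ (C + 1))) (fun k => (hwy k).trans (le_max_right _ _))
    hex' hey hhit
  exact hno τ θ a w h

/-- Absence of chords produces a low point of the deformed action. -/
theorem Tame.exists_low_point (hG : Tame G DG C) (hm : 0 < m) {ρ σ r b : ℝ} (hρ : 0 < ρ)
    (hσ : 0 ≤ σ) (B : ℝ → CE m → ℝ) (hB : Continuous fun p : ℝ × CE m => B p.1 p.2)
    (hBC : ∀ t w, B t w ≤ C) (hdef : ∀ τ t u, G τ t u = G 0 t u - τ * B t u.2.2)
    (hB0 : ∀ t ∈ Icc (0 : ℝ) 1, ∀ w, B t w ≠ 0 → t ∈ Icc σ 1 ∧ ‖w‖ ≤ r)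
    (hb : ∀ u : ℝ → U m, Continuous u → -∫ t in (0 : ℝ)..1, G 0 t (u t) ≤ b)
    (hno : ∀ τ θ a w, ¬IsChord DG ρ σ r τ θ a w) :
    ∃ N : ℕ, ∃ (z : EuclideanSpace ℝ (Idx N 1)) (w : EuclideanSpace ℝ (Idx N m)), ‖z‖ = ρ ∧
      (∀ i, i.1.1 < 0 → z i = 0) ∧ (∀ i, i.1.1 ≤ 0 → w i = 0) ∧ act G 1 z w ≤ b := by
  classical
  obtain ⟨N, δ, hδ, η, hη, hgap⟩ := hG.exists_gap (b := b) hρ hσ hno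
  have h0N : (0 : ℤ) ∈ Finset.Icc (-(N : ℤ)) N := by simp
  have hC := hG.nonneg
  have hBi : ∀ w : EuclideanSpace ℝ (Idx N m), Continuous fun t => B t (loop w t) := fun w =>
    hB.comp (f := fun t => (t, loop w t)) (by fun_prop)
  have hN0 : 0 ≤ 2 * Real.pi * N := by positivity
  refine ⟨N, Minimax.exists_low_point (C := 2 * Real.pi * N * (ρ + 1) + 2 * C + 1) (δ := δ) (r := η)
    (fun i : Idx N 1 => i.1.1 < 0) (fun i : Idx N m => i.1.1 ≤ 0)
    (⟨0, h0N⟩, 0, false) (by simp) ⟨(⟨0, h0N⟩, ⟨0, hm⟩, false), by simp⟩ freq ?_ hρ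
    (fun τ z w => act G τ z w) (fun w => ∫ t in (0 : ℝ)..1, B t (loop w t))
    (gz := fun τ z w => wt z - pz DG τ z w) (gw := fun τ z w => wt w - pw DG τ z w)
    ?_ ?_ ?_ ?_ ?_ ?_ ?_ ?_ ?_ ?_ hδ hη ?_ ?_⟩
  · intro i hi
    have : (i.1.1 : ℝ) ≤ 0 := by exact_mod_cast hi
    exact mul_nonpos_of_nonneg_of_nonpos Real.two_pi_pos.le this
  · intro τ z w
    simp only [act]
    have h1 : ∫ t in (0 : ℝ)..1, G τ t (ev z w t) = (∫ t in (0 : ℝ)..1, G 0 t (ev z w t)) -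
        τ * ∫ t in (0 : ℝ)..1, B t (loop w t) := by
      rw [← intervalIntegral.integral_const_mul, ← intervalIntegral.integral_sub
        ((hG.cont_ev_right 0 z w).intervalIntegrable _ _)
        (((hBi w).const_mul τ).intervalIntegrable _ _)]
      congr 1; funext t; rw [hdef]; rfl
    rw [h1]; ring
  · intro w
    have h1 : ∫ t in (0 : ℝ)..1, B t (loop w t) ≤ ∫ t in (0 : ℝ)..1, C :=
      intervalIntegral.integral_mono_on zero_le_one ((hBi w).intervalIntegrable _ _) (by simp)
        fun t _ => hBC t _
    simp only [intervalIntegral.integral_const, sub_zero, one_smul] at h1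
    have : 0 ≤ 2 * Real.pi * N * (ρ + 1) := by positivity
    linarith
  · have : 0 ≤ 2 * Real.pi * N * (ρ + 1) := by positivity
    linarith
  · intro τ
    exact (continuous_wt.comp continuous_fst).sub (hG.continuous_pz τ)
  · intro τ
    exact (continuous_wt.comp continuous_snd).sub (hG.continuous_pw τ)
  · intro τ z w
    simp only [wt_neg, hG.pz_neg]; abel
  · intro τ z w
    simp only [hG.pw_neg]
  · intro τ hτ z w z' w' _ _
    have h1 := hG.act_le hτ z z' w w'
    have h2 : (2 * Real.pi * N + 2 * C) * (‖z' - z‖ ^ 2 + ‖w' - w‖ ^ 2) ≤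
        (2 * Real.pi * N * (ρ + 1) + 2 * C + 1) * (‖z' - z‖ ^ 2 + ‖w' - w‖ ^ 2) :=
      mul_le_mul_of_nonneg_right (by nlinarith) (by positivity)
    linarith
  · intro τ hτ z w hz
    have h1 := norm_sub_le (wt z) (pz DG τ z w)
    have h2 := norm_wt_le z
    have h3 := hG.norm_pz_le hτ z w
    rw [hz] at h2
    nlinarith
  · intro τ hτ z w _ i _
    have h1 := (PiLp.norm_apply_le (pw DG τ z w) i).trans (hG.norm_pw_le hτ z w)
    have : 0 ≤ 2 * Real.pi * N * (ρ + 1) := by positivity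
    rw [Real.norm_eq_abs] at h1
    have h2 : (wt w - pw DG τ z w) i - freq i * w i = -(pw DG τ z w) i := by
      simp [wt]
    rw [h2, abs_neg]
    linarith
  · intro τ hτ z w hz h1 h2 h3 w' hw'
    have := hgap τ hτ z w hz h1 h2 h3 w' hw'
    refine intervalIntegral.integral_zero_ae (Eventually.of_forall fun t ht => ?_)
    rw [uIoc_of_le zero_le_one] at ht
    by_contra hne
    obtain ⟨h4, h5⟩ := hB0 t ⟨ht.1.le, ht.2⟩ _ hne
    exact absurd h5 (this t h4).not_ge
  · intro z w hz hzP hwQ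
    have h1 := hb (ev z w) (continuous_ev_right z w)
    have hs : ∀ {k : ℕ} (x : EuclideanSpace ℝ (Idx N k)), (∀ i, 0 < i.1.1 → x i = 0) →
        inner ℝ (wt x) x ≤ 0 := fun x hx => by
      rw [PiLp.inner_apply]
      refine Finset.sum_nonpos fun i _ => ?_
      simp only [wt, RCLike.inner_apply, conj_trivial]
      rcases lt_or_ge 0 i.1.1 with h | h
      · simp [hx i h]
      · have h' : freq i ≤ 0 := mul_nonpos_of_nonneg_of_nonpos Real.two_pi_pos.le
          (by exact_mod_cast h)
        nlinarith [mul_nonneg (neg_nonneg.2 h') (sq_nonneg (x i))]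
    have h2 := hs w fun i hi => hwQ i (by omega)
    have h3 := hs z fun i hi => hzP i (by omega) fun h => by simp [h] at hi
    simp only [act]
    linarith

end Functional

namespace Functional
open Trig

/-- Uniform `C²` bounds for a smooth compactly supported function. -/
lemma exists_uniform_bounds {E : Type*} [NormedAddCommGroup E] [NormedSpace ℝ E] {f : E → ℝ}
    (hf : ContDiff ℝ (⊤ : ℕ∞) f) (hc : HasCompactSupport f) :
    ∃ C, 0 ≤ C ∧ (∀ x, |f x| ≤ C) ∧ (∀ x, ‖fderiv ℝ f x‖ ≤ C) ∧
      ∀ x v, |f (x + v) - f x - fderiv ℝ f x v| ≤ C * ‖v‖ ^ 2 := by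
  have hd : ContDiff ℝ 1 (fderiv ℝ f) := hf.fderiv_right (by
    rw [one_add_one_eq_two]; exact WithTop.coe_le_coe.2 le_top)
  obtain ⟨C₁, h1⟩ := hf.continuous.bounded_above_of_compact_support hc
  obtain ⟨C₂, h2⟩ := hd.continuous.bounded_above_of_compact_support (hc.fderiv ℝ)
  obtain ⟨C₃, h3⟩ := hd.lipschitzWith_of_hasCompactSupport (hc.fderiv ℝ) one_ne_zero
  have hC1 : 0 ≤ C₁ := (norm_nonneg _).trans (h1 0)
  have hC2 : 0 ≤ C₂ := (norm_nonneg _).trans (h2 0)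
  refine ⟨C₁ + C₂ + C₃, by positivity, fun x => ?_, fun x => ?_, fun x v => ?_⟩
  · have := h1 x; rw [Real.norm_eq_abs] at this; linarith [C₃.coe_nonneg]
  · linarith [h2 x, C₃.coe_nonneg]
  · have hx : x ∈ Metric.closedBall x ‖v‖ := Metric.mem_closedBall_self (norm_nonneg _)
    have hy : x + v ∈ Metric.closedBall x ‖v‖ := by simp
    have := (convex_closedBall x ‖v‖).norm_image_sub_le_of_norm_hasFDerivWithin_le'
      (f' := fderiv ℝ f) (φ := fderiv ℝ f x) (C := C₃ * ‖v‖)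
      (fun y _ => (hf.differentiable (by simp) y).hasFDerivAt.hasFDerivWithinAt)
      (fun y hy => by
        rw [← dist_eq_norm]
        exact (h3.dist_le_mul y x).trans (mul_le_mul_of_nonneg_left (Metric.mem_closedBall.1 hy)
          C₃.coe_nonneg)) hx hy
    rw [add_sub_cancel_left, Real.norm_eq_abs] at this
    refine this.trans ?_
    nlinarith [sq_nonneg ‖v‖]

variable {m : ℕ} (F : ℝ × U m → ℝ) (B : ℝ × CE m → ℝ)

/-- The Lagrangian deformed by a function of the last variable. -/
def lagr (τ t : ℝ) (u : U m) : ℝ := F (t, u) - τ * B (t, u.2.2)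

/-- The projection to time and the last variable. -/
def toLast (m : ℕ) : U m →L[ℝ] CE m :=
  (ContinuousLinearMap.snd ℝ (CE 1) (CE m)).comp (ContinuousLinearMap.snd ℝ (CE 1) (CE 1 × CE m))

/-- The derivative of the deformed Lagrangian. -/
def lagrD (τ t : ℝ) (u : U m) : U m →L[ℝ] ℝ :=
  (fderiv ℝ F (t, u)).comp (ContinuousLinearMap.inr ℝ ℝ (U m)) -
    τ • (fderiv ℝ B (t, u.2.2)).comp ((ContinuousLinearMap.inr ℝ ℝ (CE m)).comp (toLast m))

lemma lagrD_apply (τ t : ℝ) (u v : U m) : lagrD F B τ t u v =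
    fderiv ℝ F (t, u) (0, v) - τ * fderiv ℝ B (t, u.2.2) (0, v.2.2) := rfl

variable {F B}

lemma exists_tame (hF : ContDiff ℝ (⊤ : ℕ∞) F) (hFc : HasCompactSupport F)
    (hB : ContDiff ℝ (⊤ : ℕ∞) B) (hBc : HasCompactSupport B)
    (heven : ∀ t a b w, F (t, -a, -b, w) = F (t, a, b, w)) :
    ∃ C, Tame (lagr F B) (lagrD F B) C ∧ ∀ p, B p ≤ C := by
  obtain ⟨C₁, h0, h1, h2, h3⟩ := exists_uniform_bounds hF hFc
  obtain ⟨C₂, k0, k1, k2, k3⟩ := exists_uniform_bounds hB hBc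
  have hinr : ∀ v : U m, ‖((0 : ℝ), v)‖ = ‖v‖ := fun v => by simp [Prod.norm_mk]
  have hlast : ∀ v : U m, ‖((0 : ℝ), v.2.2)‖ ≤ ‖v‖ := fun v => by
    simp only [Prod.norm_mk, norm_zero]
    exact max_le (norm_nonneg _) ((norm_snd_le _).trans (norm_snd_le _))
  have hmul : ∀ τ ∈ Icc (0 : ℝ) 1, ∀ x y : ℝ, |x| ≤ y → |τ * x| ≤ y := fun τ hτ x y h => by
    rw [abs_mul, abs_of_nonneg hτ.1]
    exact (mul_le_of_le_one_left (abs_nonneg x) hτ.2).trans h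
  refine ⟨C₁ + C₂, ⟨by positivity, ?_, ?_, fun τ t u => ?_, fun τ hτ t u => ?_, fun τ hτ t u => ?_,
    fun τ hτ t u v => ?_, fun τ t a b w => ?_⟩, fun p => ?_⟩
  · have c1 := hF.continuous
    have c2 := hB.continuous
    unfold lagr
    fun_prop
  · have c1 : Continuous (fderiv ℝ F) := hF.continuous_fderiv (by simp)
    have c2 : Continuous (fderiv ℝ B) := hB.continuous_fderiv (by simp)
    unfold lagrD
    fun_prop
  · have d1 := (hF.differentiable (by simp) (t, u)).hasFDerivAt.comp u (hasFDerivAt_prodMk_right t u)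
    have d2 := (hB.differentiable (by simp) (t, u.2.2)).hasFDerivAt.comp u
      ((hasFDerivAt_prodMk_right t u.2.2).comp u (toLast m).hasFDerivAt)
    exact d1.sub (d2.const_smul τ)
  · refine (abs_sub _ _).trans (add_le_add (h1 _) (hmul τ hτ _ _ (k1 _)))
  · refine ContinuousLinearMap.opNorm_le_bound _ (by positivity) fun v => ?_
    rw [lagrD_apply, Real.norm_eq_abs, add_mul]
    refine (abs_sub _ _).trans (add_le_add ?_ (hmul τ hτ _ _ ?_))
    · refine ((fderiv ℝ F (t, u)).le_opNorm _).trans ?_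
      rw [hinr]
      exact mul_le_mul_of_nonneg_right (h2 _) (norm_nonneg _)
    · refine ((fderiv ℝ B (t, u.2.2)).le_opNorm _).trans ?_
      exact mul_le_mul (k2 _) (hlast v) (norm_nonneg _) k0
  · have e1 := h3 (t, u) (0, v)
    have e2 := k3 (t, u.2.2) (0, v.2.2)
    have e3 : ‖((0 : ℝ), v.2.2)‖ ^ 2 ≤ ‖v‖ ^ 2 := pow_le_pow_left₀ (norm_nonneg _) (hlast v) 2
    have e4 := hmul τ hτ _ _ (e2.trans (mul_le_mul_of_nonneg_left e3 k0))
    rw [hinr] at e1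
    simp only [Prod.mk_add_mk, add_zero] at e1 e4
    rw [lagrD_apply, add_mul]
    simp only [lagr]
    have e5 : F (t, u + v) - τ * B (t, (u + v).2.2) - (F (t, u) - τ * B (t, u.2.2)) -
        (fderiv ℝ F (t, u) (0, v) - τ * fderiv ℝ B (t, u.2.2) (0, v.2.2)) =
        (F (t, u + v) - F (t, u) - fderiv ℝ F (t, u) (0, v)) -
        τ * (B (t, u.2.2 + v.2.2) - B (t, u.2.2) - fderiv ℝ B (t, u.2.2) (0, v.2.2)) := by
      simp only [Prod.snd_add]; ring
    rw [e5]
    exact (abs_sub _ _).trans (add_le_add e1 e4)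
  · simp only [lagr, heven]
  · exact (le_abs_self _).trans ((k1 p).trans (by linarith))

/-- Absence of chords forces the lower bound on the oscillation. -/
theorem lower_bound (hF : ContDiff ℝ (⊤ : ℕ∞) F) (hFc : HasCompactSupport F)
    (hB : ContDiff ℝ (⊤ : ℕ∞) B) (hBc : HasCompactSupport B)
    (heven : ∀ t a b w, F (t, -a, -b, w) = F (t, a, b, w)) (hm : 0 < m) {ρ σ r : ℝ} (hρ : 0 < ρ)
    (hσ : 0 ≤ σ) (hB0 : ∀ t ∈ Icc (0 : ℝ) 1, ∀ w, B (t, w) ≠ 0 → t ∈ Icc σ 1 ∧ ‖w‖ ≤ r)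
    {lo hi : ℝ → ℝ} (hlo : Continuous lo) (hhi : Continuous hi)
    (hFlo : ∀ t u, lo t ≤ F (t, u)) (hFhi : ∀ t u, F (t, u) ≤ hi t)
    {β : ℝ → ℝ} (hβ : Continuous β) (hβ1 : ∀ t, β t ≤ 1) {S : ℝ}
    (hBS : ∀ t w, β t * (S - Real.pi * ‖w‖ ^ 2) ≤ B (t, w))
    (hno : ∀ τ θ a w, ¬IsChord (lagrD F B) ρ σ r τ θ a w) :
    S * ∫ t in (0 : ℝ)..1, β t ≤ (∫ t in (0 : ℝ)..1, hi t) - ∫ t in (0 : ℝ)..1, lo t := by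
  obtain ⟨C, hG, hBC⟩ := exists_tame hF hFc hB hBc heven
  obtain ⟨N, z, w, -, hz, hw, hle⟩ := hG.exists_low_point (b := -∫ t in (0 : ℝ)..1, lo t) hm hρ hσ
    (fun t w => B (t, w)) hB.continuous (fun t w => hBC _) (fun τ t u => by simp [lagr]) hB0
    (fun u hu => by
      refine neg_le_neg (intervalIntegral.integral_mono_on zero_le_one
        (hlo.intervalIntegrable _ _) (Continuous.intervalIntegrable ?_ _ _) fun t _ => ?_)
      · exact hG.cont.comp (f := fun t => (0, t, u t)) (by fun_prop)
      · simpa [lagr] using hFlo t (u t)) hno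
  have h1 : 0 ≤ inner ℝ (wt z) z := by
    rw [PiLp.inner_apply]
    refine Finset.sum_nonneg fun i _ => ?_
    simp only [wt, RCLike.inner_apply, conj_trivial]
    rcases lt_or_ge i.1.1 0 with h | h
    · simp [hz i h]
    · have h' : 0 ≤ freq i := mul_nonneg Real.two_pi_pos.le (by exact_mod_cast h)
      nlinarith [mul_nonneg h' (sq_nonneg (z i))]
  have h2 : 2 * Real.pi * ‖w‖ ^ 2 ≤ inner ℝ (wt w) w := by
    rw [PiLp.inner_apply, EuclideanSpace.norm_sq_eq, Finset.mul_sum]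
    refine Finset.sum_le_sum fun i _ => ?_
    simp only [wt, RCLike.inner_apply, conj_trivial, Real.norm_eq_abs, sq_abs]
    rcases le_or_gt i.1.1 0 with h | h
    · simp [hw i h]
    · have h3 : (1 : ℝ) ≤ i.1.1 := by exact_mod_cast h
      have h' : 2 * Real.pi ≤ freq i := le_mul_of_one_le_right Real.two_pi_pos.le h3
      nlinarith [mul_nonneg (sub_nonneg.2 h') (sq_nonneg (w i))]
  have hcl := continuous_loop w
  have h3 : ∫ t in (0 : ℝ)..1, lagr F B 1 t (ev z w t) ≤ ∫ t in (0 : ℝ)..1,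
      (hi t - S * β t + Real.pi * ‖loop w t‖ ^ 2) := by
    refine intervalIntegral.integral_mono_on zero_le_one
      ((hG.cont_ev_right 1 z w).intervalIntegrable _ _)
      (Continuous.intervalIntegrable (by fun_prop) _ _) fun t _ => ?_
    have e1 := hFhi t (ev z w t)
    have e2 := hBS t (loop w t)
    have e3 : β t * (Real.pi * ‖loop w t‖ ^ 2) ≤ Real.pi * ‖loop w t‖ ^ 2 :=
      mul_le_of_le_one_left (by positivity) (hβ1 t)
    have e4 : lagr F B 1 t (ev z w t) = F (t, ev z w t) - B (t, loop w t) := by simp [lagr, ev]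
    rw [e4]; linarith
  rw [intervalIntegral.integral_add (Continuous.intervalIntegrable (by fun_prop) _ _)
    (Continuous.intervalIntegrable (by fun_prop) _ _),
    intervalIntegral.integral_sub (hhi.intervalIntegrable _ _)
    (Continuous.intervalIntegrable (by fun_prop) _ _), intervalIntegral.integral_const_mul,
    intervalIntegral.integral_const_mul, integral_norm_loop_sq] at h3
  unfold act at hle
  linarith

end Functional

namespace Functional
open Trig

variable {m : ℕ}

/-- The isomorphism `ℂ × ℂᵐ ≃ ℂᵐ⁺¹`, as a continuous linear map. -/
def pack (m : ℕ) : ℂ × CE m →L[ℝ] CE (m + 1) :=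
  LinearMap.toContinuousLinearMap
    { toFun := fun p => WithLp.toLp 2 (Fin.cons p.1 p.2)
      map_add' := fun p q => by
        ext j; refine Fin.cases ?_ (fun j => ?_) j <;> simp
      map_smul' := fun s p => by
        ext j; refine Fin.cases ?_ (fun j => ?_) j <;> simp }

@[simp] lemma pack_zero_apply (ζ : ℂ) (w : CE m) : pack m (ζ, w) 0 = ζ := rfl

@[simp] lemma pack_succ (ζ : ℂ) (w : CE m) (j : Fin m) : pack m (ζ, w) j.succ = w j := rfl

lemma norm_sq_pack (ζ : ℂ) (w : CE m) : ‖pack m (ζ, w)‖ ^ 2 = ‖ζ‖ ^ 2 + ‖w‖ ^ 2 := by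
  simp [EuclideanSpace.norm_sq_eq, Fin.sum_univ_succ]

/-- A positive smooth function which is the identity on `[c, ∞)`. -/
def posId (c y : ℝ) : ℝ := c / 2 + (y - c / 2) * Real.smoothTransition (2 * y / c - 1)

lemma posId_pos {c : ℝ} (hc : 0 < c) (y : ℝ) : 0 < posId c y := by
  unfold posId
  rcases le_or_gt y (c / 2) with h | h
  · rw [Real.smoothTransition.zero_of_nonpos]
    · simpa using hc
    · rw [sub_nonpos, div_le_one hc]; linarith
  · have := mul_nonneg (sub_pos.2 h).le (Real.smoothTransition.nonneg (2 * y / c - 1))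
    linarith

lemma posId_eq {c y : ℝ} (hc : 0 < c) (h : c ≤ y) : posId c y = y := by
  unfold posId
  rw [Real.smoothTransition.one_of_one_le]
  · ring
  · rw [le_sub_iff_add_le, le_div_iff₀ hc]; linarith

lemma contDiff_posId (c : ℝ) : ContDiff ℝ (⊤ : ℕ∞) (posId c) := by
  unfold posId
  exact contDiff_const.add ((contDiff_id.sub contDiff_const).mul
    (Real.smoothTransition.contDiff.comp (f := fun y : ℝ => 2 * y / c - 1) (by fun_prop)))

/-- The reduced coordinate. -/
def red (c : ℝ) (a b : ℂ) : ℂ := ((√(posId c (‖a‖ ^ 2)))⁻¹ : ℝ) • starRingEnd ℂ (a * b)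

lemma red_eq {c : ℝ} (hc : 0 < c) {a : ℂ} (h : c ≤ ‖a‖ ^ 2) (b : ℂ) :
    red c a b = (‖a‖⁻¹ : ℝ) • starRingEnd ℂ (a * b) := by
  rw [red, posId_eq hc h, Real.sqrt_sq (norm_nonneg _)]

lemma norm_red {c : ℝ} (hc : 0 < c) {a : ℂ} (h : c ≤ ‖a‖ ^ 2) (b : ℂ) : ‖red c a b‖ = ‖b‖ := by
  have ha : ‖a‖ ≠ 0 := fun h0 => by rw [h0] at h; norm_num at h; linarith
  rw [red_eq hc h, norm_smul, RCLike.norm_conj, norm_mul]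
  simp [ha]

lemma contDiff_red {c : ℝ} (hc : 0 < c) :
    ContDiff ℝ (⊤ : ℕ∞) fun p : ℂ × ℂ => red c p.1 p.2 := by
  unfold red
  have h1 : ContDiff ℝ (⊤ : ℕ∞) fun p : ℂ × ℂ => posId c (‖p.1‖ ^ 2) :=
    (contDiff_posId c).comp (contDiff_fst.norm_sq ℝ)
  have h2 : ContDiff ℝ (⊤ : ℕ∞) fun p : ℂ × ℂ => (√(posId c (‖p.1‖ ^ 2)))⁻¹ :=
    (h1.sqrt fun p => (posId_pos hc _).ne').inv fun p => (Real.sqrt_pos.2 (posId_pos hc _)).ne'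
  have h3 : ContDiff ℝ (⊤ : ℕ∞) fun p : ℂ × ℂ => starRingEnd ℂ (p.1 * p.2) :=
    Complex.conjCLE.contDiff.comp (contDiff_fst.mul contDiff_snd)
  exact h2.smul h3

/-- The lift of a Hamiltonian to the variables `(a, b, w)`. -/
def liftHam (H : ℝ × CE (m + 1) → ℝ) (σ c R : ℝ) (p : ℝ × U m) : ℝ :=
  Real.smoothTransition (‖p.2.1 0‖ ^ 2 / c - 1) *
    Real.smoothTransition (R + 2 - (‖p.2.1 0‖ ^ 2 + ‖p.2.2.1 0‖ ^ 2)) *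
      (σ⁻¹ * H (p.1 / σ, pack m (red c (p.2.1 0) (p.2.2.1 0), p.2.2.2)))

variable {H : ℝ × CE (m + 1) → ℝ} {σ c R : ℝ}

lemma contDiff_liftHam (hH : ContDiff ℝ (⊤ : ℕ∞) H) (hc : 0 < c) :
    ContDiff ℝ (⊤ : ℕ∞) (liftHam H σ c R) := by
  have ha : ContDiff ℝ (⊤ : ℕ∞) fun p : ℝ × U m => p.2.1 0 := by fun_prop
  have hb : ContDiff ℝ (⊤ : ℕ∞) fun p : ℝ × U m => p.2.2.1 0 := by fun_prop
  have ha2 : ContDiff ℝ (⊤ : ℕ∞) fun p : ℝ × U m => ‖p.2.1 0‖ ^ 2 := ha.norm_sq ℝ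
  have hb2 : ContDiff ℝ (⊤ : ℕ∞) fun p : ℝ × U m => ‖p.2.2.1 0‖ ^ 2 := hb.norm_sq ℝ
  have hz : ContDiff ℝ (⊤ : ℕ∞) fun p : ℝ × U m => red c (p.2.1 0) (p.2.2.1 0) :=
    (contDiff_red hc).comp (f := fun p : ℝ × U m => (p.2.1 0, p.2.2.1 0)) (ha.prodMk hb)
  have hs : ContDiff ℝ (⊤ : ℕ∞) Real.smoothTransition := Real.smoothTransition.contDiff
  have h6 : ContDiff ℝ (⊤ : ℕ∞) fun p : ℝ × U m => ‖p.2.1 0‖ ^ 2 / c - 1 := by fun_prop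
  have h7 : ContDiff ℝ (⊤ : ℕ∞) fun p : ℝ × U m =>
      R + 2 - (‖p.2.1 0‖ ^ 2 + ‖p.2.2.1 0‖ ^ 2) := by fun_prop
  have h1 : ContDiff ℝ (⊤ : ℕ∞) fun p : ℝ × U m =>
      Real.smoothTransition (‖p.2.1 0‖ ^ 2 / c - 1) :=
    hs.comp h6
  have h2 : ContDiff ℝ (⊤ : ℕ∞) fun p : ℝ × U m =>
      Real.smoothTransition (R + 2 - (‖p.2.1 0‖ ^ 2 + ‖p.2.2.1 0‖ ^ 2)) :=
    hs.comp h7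
  have h4 : ContDiff ℝ (⊤ : ℕ∞) fun p : ℝ × U m => p.1 / σ := by fun_prop
  have h5 : ContDiff ℝ (⊤ : ℕ∞) fun p : ℝ × U m => p.2.2.2 := by fun_prop
  have h3 : ContDiff ℝ (⊤ : ℕ∞) fun p : ℝ × U m =>
      H (p.1 / σ, pack m (red c (p.2.1 0) (p.2.2.1 0), p.2.2.2)) :=
    hH.comp (h4.prodMk ((pack m).contDiff.comp (hz.prodMk h5)))
  unfold liftHam
  fun_prop

lemma norm_CE_one (x : CE 1) : ‖x‖ = ‖x 0‖ := by
  rw [EuclideanSpace.norm_eq]; simp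

lemma hasCompactSupport_liftHam (hH : HasCompactSupport H) (hσ : 0 < σ) :
    HasCompactSupport (liftHam H σ c R) := by
  obtain ⟨M, hM⟩ := hH.isCompact.isBounded.exists_norm_le
  refine HasCompactSupport.intro (isCompact_closedBall 0 (σ * M + M + √(R + 2))) fun p hp => ?_
  by_contra hne
  refine hp ?_
  unfold liftHam at hne
  have h1 := right_ne_zero_of_mul (left_ne_zero_of_mul hne)
  have h2 := hM _ (subset_tsupport _ (right_ne_zero_of_mul (right_ne_zero_of_mul hne)))
  have hM0 := (norm_nonneg _).trans h2
  have h3 : ‖p.2.1 0‖ ^ 2 + ‖p.2.2.1 0‖ ^ 2 < R + 2 := by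
    by_contra! h
    exact h1 (Real.smoothTransition.zero_of_nonpos (by linarith))
  have h4 : ‖p.1‖ ≤ σ * M := by
    have := (norm_fst_le _).trans h2
    rwa [norm_div, Real.norm_of_nonneg hσ.le, div_le_iff₀' hσ] at this
  have h5 : ‖p.2.2.2‖ ≤ M := by
    refine le_trans ?_ ((norm_snd_le _).trans h2)
    refine abs_le_of_sq_le_sq' ?_ (norm_nonneg _) |>.2
    rw [norm_sq_pack]
    nlinarith
  have h6 : ‖p.2.1‖ ≤ √(R + 2) := by
    rw [norm_CE_one]; exact Real.le_sqrt_of_sq_le (by nlinarith [sq_nonneg ‖p.2.2.1 0‖])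
  have h7 : ‖p.2.2.1‖ ≤ √(R + 2) := by
    rw [norm_CE_one]; exact Real.le_sqrt_of_sq_le (by nlinarith [sq_nonneg ‖p.2.1 0‖])
  have h8 := mul_nonneg hσ.le hM0
  have h9 := Real.sqrt_nonneg (R + 2)
  rw [mem_closedBall_zero_iff]
  simp only [Prod.norm_def, sup_le_iff] at *
  refine ⟨by linarith, by linarith, by linarith, by linarith⟩

lemma liftHam_neg (t : ℝ) (a b : CE 1) (w : CE m) :
    liftHam H σ c R (t, -a, -b, w) = liftHam H σ c R (t, a, b, w) := by
  simp [liftHam, red]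

lemma liftHam_rotate (t s : ℝ) (a b : CE 1) (w : CE m) :
    liftHam H σ c R (t, Complex.exp (s * Complex.I) • a, Complex.exp (-(s * Complex.I)) • b, w) =
      liftHam H σ c R (t, a, b, w) := by
  have h1 : ‖Complex.exp (s * Complex.I)‖ = 1 := Complex.norm_exp_ofReal_mul_I s
  have h2 : ‖Complex.exp (-(s * Complex.I))‖ = 1 := by
    simpa using Complex.norm_exp_ofReal_mul_I (-s)
  have h3 : Complex.exp (s * Complex.I) * a 0 * (Complex.exp (-(s * Complex.I)) * b 0) =
      a 0 * b 0 := by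
    rw [mul_mul_mul_comm, ← Complex.exp_add]; simp
  simp only [liftHam, red, PiLp.smul_apply, smul_eq_mul, norm_mul, h1, h2, h3, one_mul]

lemma liftHam_eq_zero_of_time {t : ℝ} (h : ∀ x, H (t / σ, x) = 0) (u : U m) :
    liftHam H σ c R (t, u) = 0 := by
  simp [liftHam, h]

lemma liftHam_mem {lo hi : ℝ} (hσ : 0 < σ) {t : ℝ} (h : ∀ x, H (t / σ, x) ∈ Icc lo hi) (hlo : lo ≤ 0)
    (hhi : 0 ≤ hi) (u : U m) : liftHam H σ c R (t, u) ∈ Icc (σ⁻¹ * lo) (σ⁻¹ * hi) := by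
  unfold liftHam
  set e := Real.smoothTransition (‖u.1 0‖ ^ 2 / c - 1) *
    Real.smoothTransition (R + 2 - (‖u.1 0‖ ^ 2 + ‖u.2.1 0‖ ^ 2))
  have e0 : 0 ≤ e := mul_nonneg (Real.smoothTransition.nonneg _) (Real.smoothTransition.nonneg _)
  have e1 : e ≤ 1 := mul_le_one₀ (Real.smoothTransition.le_one _) (Real.smoothTransition.nonneg _)
    (Real.smoothTransition.le_one _)
  have hx := h (pack m (red c (u.1 0) (u.2.1 0), u.2.2))
  have hs : 0 < σ⁻¹ := inv_pos.2 hσ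
  have k1 := mul_le_mul_of_nonneg_left hx.1 hs.le
  have k2 := mul_le_mul_of_nonneg_left hx.2 hs.le
  have k3 := mul_nonneg hs.le hhi
  have k4 := mul_nonneg hs.le (neg_nonneg.2 hlo)
  constructor <;> dsimp only <;> nlinarith

/-- Near the sphere of area `R` the lift vanishes close to `a = 0`. -/
lemma liftHam_eventually_zero (hc : 0 < c)
    (hHR : ∀ t x, R - 4 * c ≤ ‖x 0‖ ^ 2 → H (t, x) = 0) (t : ℝ) {u : U m}
    (h1 : ‖u.1 0‖ ^ 2 < 4 * c) (h2 : ‖u.1 0‖ ^ 2 + ‖u.2.1 0‖ ^ 2 = R) :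
    ∀ᶠ v in nhds u, liftHam H σ c R (t, v) = 0 := by
  have hb : Continuous fun v : U m => ‖v.2.1 0‖ ^ 2 := by fun_prop
  have := hb.continuousAt.eventually_const_lt (show R - 4 * c < ‖u.2.1 0‖ ^ 2 by linarith)
  filter_upwards [this] with v hv
  unfold liftHam
  rcases le_or_gt (‖v.1 0‖ ^ 2) c with h | h
  · rw [Real.smoothTransition.zero_of_nonpos]
    · simp
    · rw [sub_nonpos, div_le_one hc]; exact h
  · rw [hHR, mul_zero, mul_zero]
    rw [pack_zero_apply, norm_red hc h.le]
    exact hv.le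

/-- Away from `a = 0` and near the sphere of area `R` the lift is a pull-back. -/
lemma liftHam_eventually_eq (hc : 0 < c) (t : ℝ) {u : U m}
    (h1 : 2 * c < ‖u.1 0‖ ^ 2) (h2 : ‖u.1 0‖ ^ 2 + ‖u.2.1 0‖ ^ 2 = R) :
    ∀ᶠ v in nhds u, liftHam H σ c R (t, v) = σ⁻¹ * H (t / σ, pack m
      ((‖v.1 0‖⁻¹ : ℝ) • starRingEnd ℂ (v.1 0 * v.2.1 0), v.2.2)) := by
  have ha : Continuous fun v : U m => ‖v.1 0‖ ^ 2 := by fun_prop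
  have hb : Continuous fun v : U m => ‖v.1 0‖ ^ 2 + ‖v.2.1 0‖ ^ 2 := by fun_prop
  filter_upwards [ha.continuousAt.eventually_const_lt h1,
    hb.continuousAt.eventually_lt_const (show _ < R + 1 by linarith)] with v hv hv'
  unfold liftHam
  rw [Real.smoothTransition.one_of_one_le, Real.smoothTransition.one_of_one_le,
    red_eq hc (by linarith)]
  · simp
  · linarith
  · rw [le_sub_iff_add_le, le_div_iff₀ hc]; linarith

end Functional

namespace Functional
open Trig

variable {m : ℕ}

/-- A cutoff in time vanishing on `[0, σ]`. -/
def late (σ t : ℝ) : ℝ := Real.smoothTransition (t / σ - 1) * Real.smoothTransition (3 - t)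

lemma late_nonneg (σ t : ℝ) : 0 ≤ late σ t :=
  mul_nonneg (Real.smoothTransition.nonneg _) (Real.smoothTransition.nonneg _)

lemma late_le_one (σ t : ℝ) : late σ t ≤ 1 :=
  mul_le_one₀ (Real.smoothTransition.le_one _) (Real.smoothTransition.nonneg _)
    (Real.smoothTransition.le_one _)

lemma late_eq_zero {σ t : ℝ} (hσ : 0 < σ) (h : t ≤ σ) : late σ t = 0 := by
  rw [late, Real.smoothTransition.zero_of_nonpos, zero_mul]
  rw [sub_nonpos, div_le_one hσ]; exact h

lemma contDiff_late (σ : ℝ) : ContDiff ℝ (⊤ : ℕ∞) (late σ) := by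
  have hs : ContDiff ℝ (⊤ : ℕ∞) Real.smoothTransition := Real.smoothTransition.contDiff
  unfold late
  exact (hs.comp (f := fun t : ℝ => t / σ - 1) (by fun_prop)).mul
    (hs.comp (f := fun t : ℝ => 3 - t) (by fun_prop))

lemma integral_late_ge {σ : ℝ} (hσ : 0 < σ) (hσ' : σ < 1 / 2) :
    1 - 2 * σ ≤ ∫ t in (0 : ℝ)..1, late σ t := by
  have hc := (contDiff_late σ).continuous
  rw [← intervalIntegral.integral_add_adjacent_intervals (b := 2 * σ)
    (hc.intervalIntegrable _ _) (hc.intervalIntegrable _ _)]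
  have h1 : 0 ≤ ∫ t in (0 : ℝ)..2 * σ, late σ t :=
    intervalIntegral.integral_nonneg (by linarith) fun t _ => late_nonneg σ t
  have h2 : ∫ t in 2 * σ..1, late σ t = ∫ t in 2 * σ..1, (1 : ℝ) := by
    refine intervalIntegral.integral_congr fun t ht => ?_
    rw [uIcc_of_le (by linarith)] at ht
    rw [late, Real.smoothTransition.one_of_one_le, Real.smoothTransition.one_of_one_le, one_mul]
    · linarith [ht.2]
    · rw [le_sub_iff_add_le, le_div_iff₀ hσ]; linarith [ht.1]
  rw [h2, intervalIntegral.integral_const]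
  simp only [smul_eq_mul, mul_one]; linarith

/-- A radial potential, switched on after time `σ`. -/
def pot (S₁ S₂ σ : ℝ) (p : ℝ × CE m) : ℝ :=
  late σ p.1 * (S₁ * Real.smoothTransition ((S₂ - Real.pi * ‖p.2‖ ^ 2) / (S₂ - S₁)))

variable {S₁ S₂ σ : ℝ}

lemma contDiff_pot : ContDiff ℝ (⊤ : ℕ∞) (pot S₁ S₂ σ : ℝ × CE m → ℝ) := by
  have hs : ContDiff ℝ (⊤ : ℕ∞) Real.smoothTransition := Real.smoothTransition.contDiff
  have h1 : ContDiff ℝ (⊤ : ℕ∞) fun p : ℝ × CE m => ‖p.2‖ ^ 2 := contDiff_snd.norm_sq ℝ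
  have h2 : ContDiff ℝ (⊤ : ℕ∞) fun p : ℝ × CE m => (S₂ - Real.pi * ‖p.2‖ ^ 2) / (S₂ - S₁) := by
    fun_prop
  have h3 : ContDiff ℝ (⊤ : ℕ∞) fun p : ℝ × CE m =>
      Real.smoothTransition ((S₂ - Real.pi * ‖p.2‖ ^ 2) / (S₂ - S₁)) := hs.comp h2
  have h4 : ContDiff ℝ (⊤ : ℕ∞) fun p : ℝ × CE m => late σ p.1 :=
    (contDiff_late σ).comp contDiff_fst
  unfold pot
  fun_prop

lemma norm_sq_lt_of_pot_ne_zero (hS : S₁ < S₂) {p : ℝ × CE m} (h : pot S₁ S₂ σ p ≠ 0) :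
    Real.pi * ‖p.2‖ ^ 2 < S₂ := by
  by_contra! h'
  refine h ?_
  rw [pot, Real.smoothTransition.zero_of_nonpos, mul_zero, mul_zero]
  exact div_nonpos_of_nonpos_of_nonneg (by linarith) (by linarith)

lemma mem_of_pot_ne_zero (hσ : 0 < σ) {p : ℝ × CE m} (h : pot S₁ S₂ σ p ≠ 0) : σ < p.1 := by
  by_contra! h'
  exact h (by rw [pot, late_eq_zero hσ h', zero_mul])

lemma hasCompactSupport_pot (hS : S₁ < S₂) (hσ : 0 < σ) :
    HasCompactSupport (pot S₁ S₂ σ : ℝ × CE m → ℝ) := by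
  refine HasCompactSupport.intro (isCompact_closedBall 0 (3 + √(S₂ / Real.pi))) fun p hp => ?_
  by_contra hne
  refine hp ?_
  have h1 := mem_of_pot_ne_zero hσ hne
  have h2 := norm_sq_lt_of_pot_ne_zero hS hne
  have h3 : p.1 < 3 := by
    by_contra! h'
    refine hne ?_
    rw [pot, late, Real.smoothTransition.zero_of_nonpos (x := 3 - p.1) (by linarith)]
    simp
  have h4 : ‖p.2‖ ≤ √(S₂ / Real.pi) := by
    refine Real.le_sqrt_of_sq_le ?_
    rw [le_div_iff₀' Real.pi_pos]; exact h2.le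
  rw [mem_closedBall_zero_iff]
  have h5 := Real.sqrt_nonneg (S₂ / Real.pi)
  simp only [Prod.norm_def, sup_le_iff, Real.norm_eq_abs, abs_le]
  exact ⟨⟨by linarith, by linarith⟩, by linarith⟩

lemma le_pot (hS₁ : 0 ≤ S₁) (hS : S₁ < S₂) (t : ℝ) (w : CE m) :
    late σ t * (S₁ - Real.pi * ‖w‖ ^ 2) ≤ pot S₁ S₂ σ (t, w) := by
  refine mul_le_mul_of_nonneg_left ?_ (late_nonneg σ t)
  dsimp only
  rcases le_or_gt (Real.pi * ‖w‖ ^ 2) S₁ with h | h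
  · rw [Real.smoothTransition.one_of_one_le]
    · nlinarith [Real.pi_pos, sq_nonneg ‖w‖]
    · rw [le_div_iff₀ (by linarith)]; linarith
  · have := mul_nonneg hS₁ (Real.smoothTransition.nonneg ((S₂ - Real.pi * ‖w‖ ^ 2) / (S₂ - S₁)))
    linarith

lemma pot_rotate (t s : ℝ) (w : CE m) :
    pot S₁ S₂ σ (t, Complex.exp (s * Complex.I) • w) = pot S₁ S₂ σ (t, w) := by
  simp [pot, norm_smul, Complex.norm_exp_ofReal_mul_I]

/-- The derivative vanishes along a curve of constancy. -/
lemma fderiv_eq_of_curve {E : Type*} [NormedAddCommGroup E] [NormedSpace ℝ E] {f : E → ℝ} {x v : E}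
    (hf : DifferentiableAt ℝ f x) {γ : ℝ → E} (h0 : γ 0 = x) (hγ : HasDerivAt γ v 0) {k : ℝ → ℝ}
    {k' : ℝ} (hk : HasDerivAt k k' 0) (he : ∀ᶠ s in nhds 0, f (γ s) = k s) :
    fderiv ℝ f x v = k' := by
  have h1 : HasDerivAt (fun s => f (γ s)) (fderiv ℝ f x v) 0 := by
    have : HasFDerivAt f (fderiv ℝ f x) (γ 0) := h0 ▸ hf.hasFDerivAt
    exact this.comp_hasDerivAt 0 hγ
  exact h1.unique (hk.congr_of_eventuallyEq he)

lemma fderiv_pot_time (hσ : 0 < σ) {t : ℝ} (ht : t ≤ σ) (w v : CE m) :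
    fderiv ℝ (pot S₁ S₂ σ) (t, w) (0, v) = 0 := by
  refine fderiv_eq_of_curve (contDiff_pot.differentiable (by simp) _)
    (γ := fun s => (t, w + s • v)) (by simp) ?_ (hasDerivAt_const 0 (0 : ℝ)) ?_
  · have := ((hasDerivAt_id (0 : ℝ)).smul_const v).const_add w
    rw [one_smul] at this
    exact (hasDerivAt_const 0 t).prodMk this
  · refine Eventually.of_forall fun s => ?_
    rw [pot, late_eq_zero hσ ht, zero_mul]

/-- The derivative of a complex rotation. -/
lemma hasDerivAt_rotate {E : Type*} [NormedAddCommGroup E] [NormedSpace ℂ E] (x : E) :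
    HasDerivAt (fun s : ℝ => Complex.exp (s * Complex.I) • x) (Complex.I • x) 0 := by
  have h1 : HasDerivAt (fun s : ℝ => (s : ℂ) * Complex.I) Complex.I 0 := by
    simpa using (Complex.ofRealCLM.hasDerivAt (x := (0 : ℝ))).mul_const Complex.I
  have h2 := h1.cexp
  simp only [Complex.ofReal_zero, zero_mul, Complex.exp_zero, one_mul] at h2
  exact h2.smul_const x

lemma fderiv_pot_rotate (t : ℝ) (w : CE m) :
    fderiv ℝ (pot S₁ S₂ σ) (t, w) (0, Complex.I • w) = 0 := by
  refine fderiv_eq_of_curve (contDiff_pot.differentiable (by simp) _)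
    (γ := fun s : ℝ => (t, Complex.exp (s * Complex.I) • w)) (by simp)
    ((hasDerivAt_const 0 t).prodMk (hasDerivAt_rotate w))
    (hasDerivAt_const 0 (pot S₁ S₂ σ (t, w))) ?_
  exact Eventually.of_forall fun s => pot_rotate t s w

end Functional

namespace Functional
open Trig

variable {m : ℕ}

lemma hasDerivWithinAt_of_integral {f g : ℝ → ℂ} {f₀ : ℂ} (hg : Continuous g)
    (h : ∀ t ∈ Icc (0 : ℝ) 1, f t = f₀ + ∫ s in (0 : ℝ)..t, g s) {t : ℝ} (ht : t ∈ Icc (0 : ℝ) 1) :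
    HasDerivWithinAt f (g t) (Icc 0 1) t := by
  have h1 : HasDerivAt (fun u => ∫ s in (0 : ℝ)..u, g s) (g t) t :=
    intervalIntegral.integral_hasDerivAt_right (hg.intervalIntegrable _ _)
      (hg.stronglyMeasurableAtFilter _ _) hg.continuousAt
  exact (h1.const_add f₀).hasDerivWithinAt.congr h (h t ht)

lemma eq_of_hasDerivWithinAt_zero {f : ℝ → ℝ} {x y : ℝ}
    (h : ∀ t ∈ Icc x y, HasDerivWithinAt f 0 (Icc x y) t) {t : ℝ} (ht : t ∈ Icc x y) :
    f t = f x := by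
  refine constant_of_derivWithin_zero (fun t ht => (h t ht).differentiableWithinAt)
    (fun t ht' => ?_) t ht
  exact (h t ⟨ht'.1, ht'.2.le⟩).derivWithin
    (uniqueDiffOn_Icc (ht'.1.trans_lt ht'.2) t ⟨ht'.1, ht'.2.le⟩)

section

variable {DG : ℝ → ℝ → U m → U m →L[ℝ] ℝ} {ρ σ r τ θ : ℝ} {a : ℝ → CE 1} {w : ℝ → CE m}

lemma IsChord.hasDerivWithinAt_fst (h : IsChord DG ρ σ r τ θ a w)
    (hD : Continuous fun t => DG τ t (cv a w t)) {t : ℝ} (ht : t ∈ Icc (0 : ℝ) 1) :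
    HasDerivWithinAt (fun s => a s 0) (-Complex.I * (grad₀ (DG τ t (cv a w t)) 0 +
      grad₁ (DG τ (1 - t) (cv a w (1 - t))) 0 + θ * a t 0)) (Icc 0 1) t := by
  have hac := h.cont_fst
  have h0 : Continuous fun t => grad₀ (DG τ t (cv a w t)) := continuous_grad₀.comp hD
  have h1 : Continuous fun t => grad₁ (DG τ (1 - t) (cv a w (1 - t))) :=
    (continuous_grad₁.comp hD).comp (f := fun t : ℝ => 1 - t) (by fun_prop)
  have := hasDerivWithinAt_of_integral (g := fun s => -Complex.I * (grad₀ (DG τ s (cv a w s)) +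
    grad₁ (DG τ (1 - s) (cv a w (1 - s))) + θ • a s) 0) (by fun_prop)
    (fun t ht => h.eq_fst t ht 0) ht
  simpa using this

lemma IsChord.hasDerivWithinAt_snd (h : IsChord DG ρ σ r τ θ a w)
    (hD : Continuous fun t => DG τ t (cv a w t)) {t : ℝ} (ht : t ∈ Icc (0 : ℝ) 1) :
    HasDerivWithinAt w (-Complex.I • grad₂ (DG τ t (cv a w t))) (Icc 0 1) t := by
  have h0 : Continuous fun t => grad₂ (DG τ t (cv a w t)) := continuous_grad₂.comp hD
  rw [hasDerivWithinAt_iff_hasFDerivWithinAt, hasFDerivWithinAt_piLp 2]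
  intro j
  have := hasDerivWithinAt_of_integral (g := fun s => -Complex.I * (grad₂ (DG τ s (cv a w s))) j)
    (by fun_prop) (fun t ht => h.eq_snd t ht j) ht
  rw [hasDerivWithinAt_iff_hasFDerivWithinAt] at this
  refine this.congr_fderiv ?_
  ext
  simp

end

lemma inner_CE_one (x y : CE 1) : (inner ℝ x y : ℝ) = inner ℝ (x 0) (y 0) := by
  rw [PiLp.inner_apply]; simp

/-- The vector of `ℂ¹` with a given coordinate. -/
def vec (z : ℂ) : CE 1 := EuclideanSpace.single 0 z

@[simp] lemma vec_apply (z : ℂ) : vec z 0 = z := by simp [vec]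

lemma vec_eta (x : CE 1) : vec (x 0) = x := by
  ext j; rw [Subsingleton.elim j 0]; simp

lemma inner_grad₀_vec (L : U m →L[ℝ] ℝ) (z : ℂ) : inner ℝ (grad₀ L 0) z = L (vec z, 0, 0) := by
  rw [← inner_grad₀, inner_CE_one, vec_apply]

lemma inner_grad₁_vec (L : U m →L[ℝ] ℝ) (z : ℂ) : inner ℝ (grad₁ L 0) z = L (0, vec z, 0) := by
  rw [← inner_grad₁, inner_CE_one, vec_apply]

end Functional

namespace Functional
open Trig

variable {m : ℕ} {H : ℝ × CE (m + 1) → ℝ} {σ c R : ℝ}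

lemma inner_gradient_slice (hH : ContDiff ℝ (⊤ : ℕ∞) H) (t : ℝ) (x v : CE (m + 1)) :
    inner ℝ (gradient (fun y => H (t, y)) x) v = fderiv ℝ H (t, x) (0, v) := by
  have h1 := (hH.differentiable (by simp) (t, x)).hasFDerivAt.comp x (hasFDerivAt_prodMk_right t x)
  rw [gradient, InnerProductSpace.toDual_symm_apply]
  have h2 : fderiv ℝ (fun y => H (t, y)) x =
    (fderiv ℝ H (t, x)).comp (ContinuousLinearMap.inr ℝ ℝ (CE (m + 1))) := h1.fderiv
  rw [h2]; rfl

lemma fderiv_liftHam_time (hH : ContDiff ℝ (⊤ : ℕ∞) H) (hc : 0 < c) {t : ℝ}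
    (h : ∀ x, H (t / σ, x) = 0) (u v : U m) : fderiv ℝ (liftHam H σ c R) (t, u) (0, v) = 0 := by
  refine fderiv_eq_of_curve ((contDiff_liftHam hH hc).differentiable (by simp) _)
    (γ := fun s => (t, u + s • v)) (by simp) ?_ (hasDerivAt_const 0 (0 : ℝ)) ?_
  · have := ((hasDerivAt_id (0 : ℝ)).smul_const v).const_add u
    rw [one_smul] at this
    exact (hasDerivAt_const 0 t).prodMk this
  · exact Eventually.of_forall fun s => liftHam_eq_zero_of_time h _

lemma hasDerivAt_rotate_neg {E : Type*} [NormedAddCommGroup E] [NormedSpace ℂ E] (x : E) :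
    HasDerivAt (fun s : ℝ => Complex.exp (-(s * Complex.I)) • x) (-(Complex.I • x)) 0 := by
  have h1 : HasDerivAt (fun s : ℝ => -((s : ℂ) * Complex.I)) (-Complex.I) 0 := by
    simpa using ((Complex.ofRealCLM.hasDerivAt (x := (0 : ℝ))).mul_const Complex.I).fun_neg
  have h2 := h1.cexp
  simp only [Complex.ofReal_zero, zero_mul, neg_zero, Complex.exp_zero, one_mul] at h2
  simpa only [neg_smul] using h2.smul_const x

lemma eq_of_inner_eq {p a : ℂ} {k : ℝ} (ha : a ≠ 0) (h1 : inner ℝ p a = (0 : ℝ))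
    (h2 : inner ℝ p (Complex.I * a) = k) : p = ((k / ‖a‖ ^ 2 : ℝ) : ℂ) * (Complex.I * a) := by
  have h0 : ‖a‖ ^ 2 ≠ 0 := pow_ne_zero 2 (norm_ne_zero_iff.2 ha)
  have h3 : ‖a‖ ^ 2 = a.re * a.re + a.im * a.im := by rw [← Complex.normSq_eq_norm_sq]; rfl
  simp only [Complex.inner, Complex.mul_re, Complex.mul_im, Complex.conj_re, Complex.conj_im,
    Complex.I_re, Complex.I_im] at h1 h2
  apply Complex.ext
  · rw [← Complex.real_smul, Complex.smul_re, smul_eq_mul]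
    simp only [Complex.mul_re, Complex.I_re, Complex.I_im]
    rw [div_mul_eq_mul_div, eq_div_iff h0, h3, ← h2]
    linear_combination a.re * h1
  · rw [← Complex.real_smul, Complex.smul_im, smul_eq_mul]
    simp only [Complex.mul_im, Complex.I_re, Complex.I_im]
    rw [div_mul_eq_mul_div, eq_div_iff h0, h3, ← h2]
    linear_combination a.im * h1

lemma fderiv_liftHam_rotate (hH : ContDiff ℝ (⊤ : ℕ∞) H) (hc : 0 < c) (t : ℝ) (a b : CE 1)
    (w : CE m) : fderiv ℝ (liftHam H σ c R) (t, a, b, w)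
      (0, Complex.I • a, -(Complex.I • b), 0) = 0 := by
  refine fderiv_eq_of_curve ((contDiff_liftHam hH hc).differentiable (by simp) _)
    (γ := fun s : ℝ => (t, Complex.exp (s * Complex.I) • a, Complex.exp (-(s * Complex.I)) • b, w))
    (by simp) ?_ (hasDerivAt_const 0 (liftHam H σ c R (t, a, b, w)))
    (Eventually.of_forall fun s => liftHam_rotate t s a b w)
  exact (hasDerivAt_const 0 t).prodMk ((hasDerivAt_rotate a).prodMk
    ((hasDerivAt_rotate_neg b).prodMk (hasDerivAt_const 0 w)))

lemma fderiv_liftHam_near_zero (hH : ContDiff ℝ (⊤ : ℕ∞) H) (hc : 0 < c)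
    (hHR : ∀ t x, R - 4 * c ≤ ‖x 0‖ ^ 2 → H (t, x) = 0) (t : ℝ) {u : U m}
    (h1 : ‖u.1 0‖ ^ 2 < 4 * c) (h2 : ‖u.1 0‖ ^ 2 + ‖u.2.1 0‖ ^ 2 = R) (v : U m) :
    fderiv ℝ (liftHam H σ c R) (t, u) (0, v) = 0 := by
  have h3 : HasDerivAt (fun s : ℝ => u + s • v) v 0 := by
    have := ((hasDerivAt_id (0 : ℝ)).smul_const v).const_add u
    rwa [one_smul] at this
  refine fderiv_eq_of_curve ((contDiff_liftHam hH hc).differentiable (by simp) _)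
    (γ := fun s => (t, u + s • v)) (by simp) ((hasDerivAt_const 0 t).prodMk h3)
    (hasDerivAt_const 0 (0 : ℝ)) ?_
  refine h3.continuousAt.eventually (p := fun v => liftHam H σ c R (t, v) = 0) ?_
  simpa using liftHam_eventually_zero hc hHR t h1 h2

lemma fderiv_liftHam_of_curve (hH : ContDiff ℝ (⊤ : ℕ∞) H) (hc : 0 < c) (t : ℝ) {u v : U m}
    (h1 : 2 * c < ‖u.1 0‖ ^ 2) (h2 : ‖u.1 0‖ ^ 2 + ‖u.2.1 0‖ ^ 2 = R) {γ : ℝ → U m}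
    (h0 : γ 0 = u) (hγ : HasDerivAt γ v 0) {δ : ℝ → ℂ × CE m} {δ' : ℂ × CE m}
    (hδ : HasDerivAt δ δ' 0) (he : ∀ s, ((‖(γ s).1 0‖⁻¹ : ℝ) •
      starRingEnd ℂ ((γ s).1 0 * (γ s).2.1 0), (γ s).2.2) = δ s) :
    fderiv ℝ (liftHam H σ c R) (t, u) (0, v) =
      σ⁻¹ * inner ℝ (gradient (fun y => H (t / σ, y)) (pack m (δ 0))) (pack m δ') := by
  refine fderiv_eq_of_curve ((contDiff_liftHam hH hc).differentiable (by simp) _)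
    (γ := fun s => (t, γ s)) (by simp [h0]) ((hasDerivAt_const 0 t).prodMk hγ)
    (k := fun s => σ⁻¹ * H (t / σ, pack m (δ s))) ?_ ?_
  · rw [inner_gradient_slice hH]
    refine HasDerivAt.const_mul _ ?_
    have h3 : HasDerivAt (fun s => pack m (δ s)) (pack m δ') 0 :=
      (pack m).hasFDerivAt.comp_hasDerivAt 0 hδ
    exact (hH.differentiable (by simp) (t / σ, pack m (δ 0))).hasFDerivAt.comp_hasDerivAt 0
      ((hasDerivAt_const 0 (t / σ)).prodMk h3)
  · refine (hγ.continuousAt.eventually (p := fun v => liftHam H σ c R (t, v) = σ⁻¹ * H (t / σ,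
      pack m ((‖v.1 0‖⁻¹ : ℝ) • starRingEnd ℂ (v.1 0 * v.2.1 0), v.2.2))) ?_).mono fun s hs => ?_
    · rw [h0]; exact liftHam_eventually_eq hc t h1 h2
    · rw [hs, he]

lemma inner_pack (x : CE (m + 1)) (ζ : ℂ) (w : CE m) :
    inner ℝ x (pack m (ζ, w)) = inner ℝ (x 0) ζ + ∑ j : Fin m, inner ℝ (x j.succ) (w j) := by
  rw [PiLp.inner_apply, Fin.sum_univ_succ]; simp

/-- The derivative of the lift in the last variables. -/
def liftD (H : ℝ × CE (m + 1) → ℝ) (σ c R t : ℝ) (u : U m) : U m →L[ℝ] ℝ :=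
  (fderiv ℝ (liftHam H σ c R) (t, u)).comp (ContinuousLinearMap.inr ℝ ℝ (U m))

lemma liftD_apply (t : ℝ) (u v : U m) :
    liftD H σ c R t u v = fderiv ℝ (liftHam H σ c R) (t, u) (0, v) := rfl

/-- The gradient of `H` at the reduced point. -/
def redGrad (H : ℝ × CE (m + 1) → ℝ) (σ t : ℝ) (u : U m) : CE (m + 1) :=
  gradient (fun y => H (t / σ, y))
    (pack m ((‖u.1 0‖⁻¹ : ℝ) • starRingEnd ℂ (u.1 0 * u.2.1 0), u.2.2))

section

variable (hH : ContDiff ℝ (⊤ : ℕ∞) H) (hc : 0 < c) (t : ℝ) {u : U m}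
    (h1 : 2 * c < ‖u.1 0‖ ^ 2) (h2 : ‖u.1 0‖ ^ 2 + ‖u.2.1 0‖ ^ 2 = R)

include hH hc h1 h2

lemma grad₂_liftD (j : Fin m) : grad₂ (liftD H σ c R t u) j = (σ⁻¹ : ℝ) * redGrad H σ t u j.succ := by
  suffices h : ∀ v : CE m, inner ℝ (grad₂ (liftD H σ c R t u)) v =
      σ⁻¹ * inner ℝ (redGrad H σ t u) (pack m (0, v)) by
    have h' : grad₂ (liftD H σ c R t u) =
        σ⁻¹ • (WithLp.toLp 2 fun j : Fin m => redGrad H σ t u j.succ : CE m) := by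
      refine ext_inner_right ℝ fun v => ?_
      rw [h, inner_pack, real_inner_smul_left, PiLp.inner_apply]; simp
    rw [h']; simp
  intro v
  rw [inner_grad₂, liftD_apply]
  have h3 : HasDerivAt (fun s : ℝ => u.2.2 + s • v) v 0 := by
    have := ((hasDerivAt_id (0 : ℝ)).smul_const v).const_add u.2.2
    rwa [one_smul] at this
  have h4 := fderiv_liftHam_of_curve (σ := σ) hH hc t h1 h2 (γ := fun s => (u.1, u.2.1, u.2.2 + s • v))
    (by simp) ((hasDerivAt_const 0 u.1).prodMk ((hasDerivAt_const 0 u.2.1).prodMk h3))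
    ((hasDerivAt_const 0 ((‖u.1 0‖⁻¹ : ℝ) • starRingEnd ℂ (u.1 0 * u.2.1 0))).prodMk h3)
    (fun s => rfl)
  rw [h4, zero_smul, add_zero, redGrad]

lemma grad₁_liftD : grad₁ (liftD H σ c R t u) 0 =
    ((σ⁻¹ * ‖u.1 0‖⁻¹ : ℝ) : ℂ) * starRingEnd ℂ (redGrad H σ t u 0 * u.1 0) := by
  refine ext_inner_right ℝ fun z => ?_
  rw [inner_grad₁_vec, liftD_apply]
  have h3 : HasDerivAt (fun s : ℝ => u.2.1 + s • vec z) (vec z) 0 := by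
    have := ((hasDerivAt_id (0 : ℝ)).smul_const (vec z)).const_add u.2.1
    rwa [one_smul] at this
  have h5 : HasDerivAt (fun s : ℝ => (‖u.1 0‖⁻¹ : ℝ) • starRingEnd ℂ (u.1 0 * u.2.1 0) +
      s • ((‖u.1 0‖⁻¹ : ℝ) • starRingEnd ℂ (u.1 0 * z)))
      ((‖u.1 0‖⁻¹ : ℝ) • starRingEnd ℂ (u.1 0 * z)) 0 := by
    have := ((hasDerivAt_id (0 : ℝ)).smul_const
      ((‖u.1 0‖⁻¹ : ℝ) • starRingEnd ℂ (u.1 0 * z))).const_add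
        ((‖u.1 0‖⁻¹ : ℝ) • starRingEnd ℂ (u.1 0 * u.2.1 0))
    rwa [one_smul] at this
  have h4 := fderiv_liftHam_of_curve (σ := σ) hH hc t h1 h2
    (γ := fun s => (u.1, u.2.1 + s • vec z, u.2.2))
    (by simp) ((hasDerivAt_const 0 u.1).prodMk (h3.prodMk (hasDerivAt_const 0 u.2.2)))
    (h5.prodMk (hasDerivAt_const 0 u.2.2))
    (fun s => by
      refine Prod.ext ?_ rfl
      simp [mul_add]
      ring)
  rw [h4, zero_smul, add_zero, ← redGrad, inner_pack]
  simp only [PiLp.zero_apply, inner_zero_right, Finset.sum_const_zero, add_zero]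
  simp only [Complex.inner]
  simp only [Complex.real_smul, Complex.mul_re, Complex.mul_im, Complex.conj_re, Complex.conj_im,
    Complex.ofReal_re, Complex.ofReal_im]
  ring

lemma grad₀_liftD : grad₀ (liftD H σ c R t u) 0 =
    -((σ⁻¹ * inner ℝ (redGrad H σ t u 0) (Complex.I * ((‖u.1 0‖⁻¹ : ℝ) •
      starRingEnd ℂ (u.1 0 * u.2.1 0))) / ‖u.1 0‖ ^ 2 : ℝ) : ℂ) * (Complex.I * u.1 0) := by
  have ha : u.1 0 ≠ 0 := fun h => by rw [h] at h1; norm_num at h1; linarith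
  set ζ := (‖u.1 0‖⁻¹ : ℝ) • starRingEnd ℂ (u.1 0 * u.2.1 0) with hζ
  rw [← Complex.ofReal_neg, ← neg_div]
  refine eq_of_inner_eq ha ?_ ?_
  · rw [inner_grad₀_vec, vec_eta, liftD_apply]
    have h3 : HasDerivAt (fun s : ℝ => Real.exp s • u.1) u.1 0 := by
      simpa using (Real.hasDerivAt_exp 0).smul_const u.1
    have h4 := fderiv_liftHam_of_curve (σ := σ) hH hc t h1 h2
      (γ := fun s => (Real.exp s • u.1, u.2.1, u.2.2)) (by simp)
      (h3.prodMk ((hasDerivAt_const 0 u.2.1).prodMk (hasDerivAt_const 0 u.2.2)))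
      ((hasDerivAt_const 0 ζ).prodMk (hasDerivAt_const 0 u.2.2)) (fun s => by
        refine Prod.ext ?_ rfl
        have he : ((Real.exp s : ℝ) : ℂ) ≠ 0 := Complex.ofReal_ne_zero.2 (Real.exp_ne_zero s)
        simp only [hζ, PiLp.smul_apply, Complex.real_smul, norm_mul,
          Complex.norm_real, Real.norm_of_nonneg (Real.exp_pos s).le, map_mul, Complex.conj_ofReal, mul_inv, Complex.ofReal_mul,
          Complex.ofReal_inv]
        field_simp)
    have h6 : pack m ((0 : ℂ), (0 : CE m)) = 0 := (pack m).map_zero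
    rw [h4, h6, inner_zero_right, mul_zero]
  · have hv : vec (Complex.I * u.1 0) = Complex.I • u.1 := by
      ext j; rw [Subsingleton.elim j 0]; simp
    rw [inner_grad₀_vec, hv, liftD_apply]
    have h5 : HasDerivAt (fun s : ℝ => Complex.exp (-(s * Complex.I)) • ζ) (-(Complex.I • ζ)) 0 :=
      hasDerivAt_rotate_neg ζ
    have h4 := fderiv_liftHam_of_curve (σ := σ) hH hc t h1 h2
      (γ := fun s : ℝ => (Complex.exp (s * Complex.I) • u.1, u.2.1, u.2.2)) (by simp)
      ((hasDerivAt_rotate u.1).prodMk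
        ((hasDerivAt_const 0 u.2.1).prodMk (hasDerivAt_const 0 u.2.2)))
      (h5.prodMk (hasDerivAt_const 0 u.2.2)) (fun s => by
        refine Prod.ext ?_ rfl
        have he : starRingEnd ℂ (Complex.exp (s * Complex.I)) = Complex.exp (-(s * Complex.I)) := by
          rw [← Complex.exp_conj]; simp
        simp only [hζ, PiLp.smul_apply, smul_eq_mul, norm_mul,
          Complex.norm_exp_ofReal_mul_I, one_mul, map_mul, he, Complex.real_smul]
        ring)
    have h7 : Complex.exp (-((0 : ℝ) * Complex.I)) • ζ = ζ := by simp
    rw [h4, h7]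
    change σ⁻¹ * inner ℝ (redGrad H σ t u) _ = _
    rw [inner_pack]
    simp
    ring

end

end Functional

namespace Functional
open Trig

variable {m : ℕ} {H : ℝ × CE (m + 1) → ℝ} {σ c R S₁ S₂ : ℝ}

lemma inner_neg_I_smul {l : ℕ} (x y : CE l) :
    inner ℝ x (-Complex.I • y) = inner ℝ y (Complex.I • x) := by
  simp only [PiLp.inner_apply, PiLp.smul_apply, smul_eq_mul, Complex.inner]
  refine Finset.sum_congr rfl fun j _ => ?_
  simp
  ring

lemma lagrD_early (hσ : 0 < σ) (τ : ℝ) {t : ℝ} (ht : t ≤ σ) (u : U m) :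
    lagrD (liftHam H σ c R) (pot S₁ S₂ σ) τ t u = liftD H σ c R t u := by
  ext v <;> simp [lagrD_apply, liftD_apply, fderiv_pot_time hσ ht]

section late

variable (hH : ContDiff ℝ (⊤ : ℕ∞) H) (hc : 0 < c) (hσ : 0 < σ)
  (hH1 : ∀ t x, 1 ≤ t → H (t, x) = 0) (τ : ℝ) {t : ℝ} (ht : σ ≤ t) (u : U m)

include hH hc hσ hH1 ht

lemma lagrD_late (v : U m) : lagrD (liftHam H σ c R) (pot S₁ S₂ σ) τ t u v =
    -(τ * fderiv ℝ (pot S₁ S₂ σ) (t, u.2.2) (0, v.2.2)) := by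
  rw [lagrD_apply, fderiv_liftHam_time hH hc fun x => hH1 _ _ ((one_le_div hσ).2 ht), zero_sub]

lemma grad₀_late : grad₀ (lagrD (liftHam H σ c R) (pot S₁ S₂ σ) τ t u) = 0 := by
  refine ext_inner_right ℝ fun v => ?_
  rw [inner_grad₀, lagrD_late hH hc hσ hH1 τ ht]
  simp [Prod.mk_zero_zero]

lemma grad₁_late : grad₁ (lagrD (liftHam H σ c R) (pot S₁ S₂ σ) τ t u) = 0 := by
  refine ext_inner_right ℝ fun v => ?_
  rw [inner_grad₁, lagrD_late hH hc hσ hH1 τ ht]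
  simp [Prod.mk_zero_zero]

lemma inner_grad₂_late : inner ℝ (grad₂ (lagrD (liftHam H σ c R) (pot S₁ S₂ σ) τ t u))
    (Complex.I • u.2.2) = 0 := by
  rw [inner_grad₂, lagrD_late hH hc hσ hH1 τ ht, fderiv_pot_rotate]
  simp

end late

/-- A complex curve rotating with constant speed has constant modulus. -/
lemma hasDerivWithinAt_norm_sq_rotate {A : ℝ → ℂ} {s : Set ℝ} {t θ : ℝ} {p : ℂ}
    (h : HasDerivWithinAt A (-Complex.I * (p + θ * A t)) s t) :
    HasDerivWithinAt (fun t => ‖A t‖ ^ 2) (2 * inner ℝ p (Complex.I * A t)) s t := by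
  refine h.norm_sq.congr_deriv ?_
  simp only [Complex.inner]
  simp
  ring

/-- The derivative of the reduced coordinate along a chord. -/
lemma hasDerivWithinAt_reduced {A B : ℝ → ℂ} {s : Set ℝ} {t θ k : ℝ} {h : ℂ}
    (hA0 : A t ≠ 0) (hA : HasDerivWithinAt A (-Complex.I * (-((k * inner ℝ h (Complex.I *
      ((‖A t‖⁻¹ : ℝ) • starRingEnd ℂ (A t * B t))) / ‖A t‖ ^ 2 : ℝ) : ℂ) * (Complex.I * A t) +
        θ * A t)) s t)
    (hB : HasDerivWithinAt B (Complex.I * (((k * ‖A t‖⁻¹ : ℝ) : ℂ) * starRingEnd ℂ (h * A t) +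
        θ * B t)) s t) :
    HasDerivWithinAt (fun t => (‖A t‖⁻¹ : ℝ) • starRingEnd ℂ (A t * B t)) (-Complex.I * (k * h))
      s t := by
  set Q := inner ℝ h (Complex.I * ((‖A t‖⁻¹ : ℝ) • starRingEnd ℂ (A t * B t))) with hQ
  have hn : ‖A t‖ ≠ 0 := norm_ne_zero_iff.2 hA0
  have h1 := hasDerivWithinAt_norm_sq_rotate hA
  have h2 : HasDerivWithinAt (fun t => ‖A t‖⁻¹) (k * Q / ‖A t‖ ^ 3) s t := by
    have h3 := (h1.sqrt (pow_ne_zero 2 hn)).fun_inv (by rw [Real.sqrt_sq (norm_nonneg _)]; exact hn)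
    simp only [Real.sqrt_sq (norm_nonneg _)] at h3
    refine h3.congr_deriv ?_
    have e1 : inner ℝ (-((k * Q / ‖A t‖ ^ 2 : ℝ) : ℂ) * (Complex.I * A t)) (Complex.I * A t) =
        -(k * Q) := by
      rw [← Complex.ofReal_neg, ← Complex.real_smul, real_inner_smul_left,
        real_inner_self_eq_norm_sq, norm_mul, Complex.norm_I, one_mul]
      field_simp
    rw [e1]
    field_simp
  have h4 := (Complex.conjCLE.hasFDerivAt (x := A t * B t)).comp_hasDerivWithinAt t (hA.mul hB)
  refine (h2.smul h4).congr_deriv ?_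
  have hn' : (‖A t‖ : ℂ) ≠ 0 := Complex.ofReal_ne_zero.2 hn
  have e2 : starRingEnd ℂ (A t) * A t = (‖A t‖ : ℂ) ^ 2 := Complex.conj_mul' _
  simp only [ContinuousLinearEquiv.coe_coe, Function.comp_apply, Complex.conjCLE_apply,
    Pi.mul_apply, map_div₀, map_inv₀, map_pow, Complex.real_smul, map_add, map_mul, map_neg, Complex.conj_conj, Complex.conj_ofReal,
    Complex.conj_I, Complex.ofReal_div, Complex.ofReal_mul, Complex.ofReal_inv, Complex.ofReal_pow]
  field_simp
  linear_combination (-(‖A t‖ : ℂ) * Complex.I * k * h) * e2 +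
    (starRingEnd ℂ (A t) * starRingEnd ℂ (B t) * k * Q) * Complex.I_mul_I

end Functional

namespace Functional
open Trig

lemma norm_sq_add_norm_sq_reflect {A p q : ℝ → ℂ} {σ θ ρ : ℝ} (hσ : 0 < σ) (hσ' : σ < 1 / 2)
    (hAc : Continuous A)
    (hA : ∀ t ∈ Icc 0 σ, HasDerivWithinAt A (-Complex.I * (p t + θ * A t)) (Icc 0 σ) t)
    (hB : ∀ t ∈ Icc 0 σ, HasDerivWithinAt (fun s => A (1 - s))
      (Complex.I * (q t + θ * A (1 - t))) (Icc 0 σ) t)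
    (hmid : ∀ t ∈ Icc σ (1 - σ), HasDerivWithinAt A (-Complex.I * (θ * A t)) (Icc σ (1 - σ)) t)
    (hpq : ∀ t ∈ Icc 0 σ, (inner ℝ (p t) (Complex.I * A t) : ℝ) =
      inner ℝ (q t) (Complex.I * A (1 - t)))
    (hρ : ∫ t in (0 : ℝ)..1, ‖A t‖ ^ 2 = ρ ^ 2) :
    ‖A σ‖ ^ 2 = ρ ^ 2 ∧ ‖A (1 - σ)‖ ^ 2 = ρ ^ 2 ∧
      ∀ t ∈ Icc 0 σ, ‖A t‖ ^ 2 + ‖A (1 - t)‖ ^ 2 = 2 * ρ ^ 2 := by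
  have hconst : ∀ t ∈ Icc σ (1 - σ), ‖A t‖ ^ 2 = ‖A σ‖ ^ 2 := fun t ht =>
    eq_of_hasDerivWithinAt_zero (f := fun t => ‖A t‖ ^ 2) (fun s hs => by
      simpa using hasDerivWithinAt_norm_sq_rotate (p := 0) (by simpa using hmid s hs)) ht
  have hN : ∀ t ∈ Icc 0 σ, HasDerivWithinAt (fun t => ‖A t‖ ^ 2 + ‖A (1 - t)‖ ^ 2) 0 (Icc 0 σ) t := by
    intro t ht
    have h1 := hasDerivWithinAt_norm_sq_rotate (hA t ht)
    have h2 := hasDerivWithinAt_norm_sq_rotate (A := fun s => A (1 - s)) (p := -q t) (θ := -θ)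
      (by convert hB t ht using 1; push_cast; ring)
    refine (h1.fun_add h2).congr_deriv ?_
    rw [hpq t ht, inner_neg_left]; ring
  have e1 : ‖A (1 - σ)‖ ^ 2 = ‖A σ‖ ^ 2 := hconst _ ⟨by linarith, le_rfl⟩
  have hN' : ∀ t ∈ Icc 0 σ, ‖A t‖ ^ 2 + ‖A (1 - t)‖ ^ 2 = 2 * ‖A σ‖ ^ 2 := fun t ht => by
    have h1 := eq_of_hasDerivWithinAt_zero hN ht
    have h2 := eq_of_hasDerivWithinAt_zero hN (right_mem_Icc.2 hσ.le)
    linarith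
  have hall : ∀ t ∈ Icc (0 : ℝ) 1, ‖A t‖ ^ 2 + ‖A (1 - t)‖ ^ 2 = 2 * ‖A σ‖ ^ 2 := fun t ht => by
    rcases le_total t σ with h | h
    · exact hN' t ⟨ht.1, h⟩
    rcases le_total t (1 - σ) with h' | h'
    · rw [hconst t ⟨h, h'⟩, hconst (1 - t) ⟨by linarith, by linarith⟩]; ring
    · have := hN' (1 - t) ⟨by linarith [ht.2], by linarith⟩
      rw [sub_sub_cancel] at this
      linarith
  have h2 : ∫ t in (0 : ℝ)..1, (‖A t‖ ^ 2 + ‖A (1 - t)‖ ^ 2) = 2 * ρ ^ 2 := by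
    rw [intervalIntegral.integral_add (Continuous.intervalIntegrable (by fun_prop) _ _)
      (Continuous.intervalIntegrable (by fun_prop) _ _),
      intervalIntegral.integral_comp_sub_left (fun t => ‖A t‖ ^ 2) 1, sub_self, sub_zero, hρ]
    ring
  have h3 : ∫ t in (0 : ℝ)..1, (‖A t‖ ^ 2 + ‖A (1 - t)‖ ^ 2) = 2 * ‖A σ‖ ^ 2 := by
    rw [intervalIntegral.integral_congr (g := fun _ => 2 * ‖A σ‖ ^ 2) fun t ht => ?_]
    · simp
    · rw [uIcc_of_le zero_le_one] at ht
      exact hall t ht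
  have h4 : ‖A σ‖ ^ 2 = ρ ^ 2 := by linarith
  exact ⟨h4, e1.trans h4, fun t ht => (hN' t ht).trans (by rw [h4])⟩

/-- A quantity which is constant as long as it is small, and large at the end, stays large. -/
lemma le_of_deriv_zero_of_small {f f' : ℝ → ℝ} {σ c : ℝ} (hσ : 0 ≤ σ) (hc : 0 < c)
    (hf : ∀ t ∈ Icc 0 σ, HasDerivWithinAt f (f' t) (Icc 0 σ) t)
    (h0 : ∀ t ∈ Icc 0 σ, f t < 4 * c → f' t = 0) (h1 : 3 * c ≤ f σ) {t : ℝ} (ht : t ∈ Icc 0 σ) :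
    3 * c ≤ f t := by
  have hs : ContDiff ℝ (⊤ : ℕ∞) Real.smoothTransition := Real.smoothTransition.contDiff
  have hk : ∀ t ∈ Icc 0 σ,
      HasDerivWithinAt (fun t => Real.smoothTransition (f t / c - 2)) 0 (Icc 0 σ) t := by
    intro t ht
    rcases lt_or_ge (f t) (4 * c) with h | h
    · have h2 := ((hf t ht).div_const c).sub_const 2
      rw [h0 t ht h, zero_div] at h2
      have h3 := (hs.differentiable (by simp) (f t / c - 2)).hasDerivAt.comp_hasDerivWithinAt t h2
      rwa [mul_zero] at h3
    · have h2 : ∀ᶠ s in nhdsWithin t (Icc 0 σ), 3 * c < f s :=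
        (hf t ht).continuousWithinAt.eventually_const_lt (by linarith)
      have h3 : ∀ x, 3 * c ≤ x → Real.smoothTransition (x / c - 2) = 1 := fun x hx =>
        Real.smoothTransition.one_of_one_le (by rw [le_sub_iff_add_le, le_div_iff₀ hc]; linarith)
      refine (hasDerivWithinAt_const t (Icc 0 σ) (1 : ℝ)).congr_of_eventuallyEq
        (h2.mono fun s hs => h3 _ hs.le) (h3 _ (by linarith))
  have h2 := eq_of_hasDerivWithinAt_zero hk ht
  have h3 := eq_of_hasDerivWithinAt_zero hk (right_mem_Icc.2 hσ)
  have h4 : Real.smoothTransition (f σ / c - 2) = 1 :=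
    Real.smoothTransition.one_of_one_le (by rw [le_sub_iff_add_le, le_div_iff₀ hc]; linarith)
  have h5 := Real.smoothTransition.eq_one_iff_one_le.1 (h2.trans (h3.symm.trans h4))
  rw [le_sub_iff_add_le, le_div_iff₀ hc] at h5
  linarith

end Functional

namespace Functional
open Trig

variable {m : ℕ} {H : ℝ × CE (m + 1) → ℝ} {σ c R S₁ S₂ ρ r τ θ : ℝ} {a : ℝ → CE 1} {w : ℝ → CE m}

lemma IsChord.continuous_grad (h : IsChord (lagrD (liftHam H σ c R) (pot S₁ S₂ σ)) ρ σ r τ θ a w)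
    (hH : ContDiff ℝ (⊤ : ℕ∞) H) (hHc : HasCompactSupport H) (hc : 0 < c) (hσ : 0 < σ)
    (hS : S₁ < S₂) :
    Continuous fun t => lagrD (liftHam H σ c R) (pot S₁ S₂ σ) τ t (cv a w t) := by
  obtain ⟨C, hG, -⟩ := exists_tame (contDiff_liftHam (R := R) hH hc)
    (hasCompactSupport_liftHam hHc hσ) contDiff_pot (hasCompactSupport_pot hS hσ) liftHam_neg
  have h1 := h.cont_fst
  have h2 := h.cont_snd
  exact hG.contD.comp (f := fun t => (τ, t, cv a w t)) (by unfold cv; fun_prop)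

section

variable (h : IsChord (lagrD (liftHam H σ c R) (pot S₁ S₂ σ)) ρ σ r τ θ a w)
  (hH : ContDiff ℝ (⊤ : ℕ∞) H) (hHc : HasCompactSupport H) (hc : 0 < c) (hσ : 0 < σ)
  (hσ' : σ < 1 / 2) (hS : S₁ < S₂) (hH1 : ∀ t x, 1 ≤ t → H (t, x) = 0)

include h hH hHc hc hσ hσ' hS hH1

lemma IsChord.hasDerivWithinAt_early {t : ℝ} (ht : t ∈ Icc 0 σ) :
    HasDerivWithinAt (fun s => a s 0) (-Complex.I * (grad₀ (liftD H σ c R t (cv a w t)) 0 +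
      θ * a t 0)) (Icc 0 σ) t := by
  have h1 := h.hasDerivWithinAt_fst (h.continuous_grad hH hHc hc hσ hS)
    (show t ∈ Icc (0 : ℝ) 1 from ⟨ht.1, by linarith [ht.2]⟩)
  rw [lagrD_early hσ τ ht.2, grad₁_late hH hc hσ hH1 τ (by linarith [ht.2])] at h1
  refine (h1.mono (Icc_subset_Icc_right (by linarith))).congr_deriv ?_
  simp

lemma IsChord.hasDerivWithinAt_reflect {t : ℝ} (ht : t ∈ Icc 0 σ) :
    HasDerivWithinAt (fun s => a (1 - s) 0) (Complex.I * (grad₁ (liftD H σ c R t (cv a w t)) 0 +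
      θ * a (1 - t) 0)) (Icc 0 σ) t := by
  have h1 := h.hasDerivWithinAt_fst (h.continuous_grad hH hHc hc hσ hS)
    (show 1 - t ∈ Icc (0 : ℝ) 1 from ⟨by linarith [ht.2], by linarith [ht.1]⟩)
  rw [sub_sub_cancel, lagrD_early hσ τ ht.2, grad₀_late hH hc hσ hH1 τ (by linarith [ht.2])] at h1
  have h2 : HasDerivWithinAt (fun s : ℝ => 1 - s) (-1) (Icc 0 σ) t :=
    ((hasDerivAt_id t).const_sub 1).hasDerivWithinAt
  refine (h1.scomp t h2 fun s hs => ⟨by linarith [hs.2], by linarith [hs.1]⟩).congr_deriv ?_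
  simp

lemma IsChord.hasDerivWithinAt_middle {t : ℝ} (ht : t ∈ Icc σ (1 - σ)) :
    HasDerivWithinAt (fun s => a s 0) (-Complex.I * (θ * a t 0)) (Icc σ (1 - σ)) t := by
  have h1 := h.hasDerivWithinAt_fst (h.continuous_grad hH hHc hc hσ hS)
    (show t ∈ Icc (0 : ℝ) 1 from ⟨by linarith [ht.1], by linarith [ht.2]⟩)
  rw [grad₀_late hH hc hσ hH1 τ ht.1, grad₁_late hH hc hσ hH1 τ (by linarith [ht.2])] at h1
  refine (h1.mono (Icc_subset_Icc hσ.le (by linarith))).congr_deriv ?_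
  simp

lemma IsChord.norm_fst : ‖a σ 0‖ ^ 2 = ρ ^ 2 ∧ ‖a (1 - σ) 0‖ ^ 2 = ρ ^ 2 ∧
    ∀ t ∈ Icc 0 σ, ‖a t 0‖ ^ 2 + ‖a (1 - t) 0‖ ^ 2 = 2 * ρ ^ 2 := by
  have hac := h.cont_fst
  refine norm_sq_add_norm_sq_reflect (A := fun t => a t 0) hσ hσ' (by fun_prop)
    (fun t ht => h.hasDerivWithinAt_early hH hHc hc hσ hσ' hS hH1 ht)
    (fun t ht => h.hasDerivWithinAt_reflect hH hHc hc hσ hσ' hS hH1 ht)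
    (fun t ht => h.hasDerivWithinAt_middle hH hHc hc hσ hσ' hS hH1 ht) (fun t _ => ?_) ?_
  · have h1 := fderiv_liftHam_rotate (R := R) (σ := σ) hH hc t (a t) (a (1 - t)) (w t)
    set L := liftD H σ c R t (cv a w t) with hL
    have h2 : L (Complex.I • a t, -(Complex.I • a (1 - t)), 0) = 0 := h1
    have h3 : L (Complex.I • a t, -(Complex.I • a (1 - t)), 0) =
        L (Complex.I • a t, 0, 0) - L (0, Complex.I • a (1 - t), 0) := by
      rw [← map_sub]; simp
    rw [h3, ← inner_grad₀, ← inner_grad₁, inner_CE_one, inner_CE_one, sub_eq_zero] at h2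
    simpa using h2
  · rw [← h.mass]; simp [norm_CE_one]

lemma IsChord.le_norm_fst (hHR : ∀ t x, R - 4 * c ≤ ‖x 0‖ ^ 2 → H (t, x) = 0) (hρ : 2 * ρ ^ 2 = R)
    (hcR : 6 * c ≤ R) {t : ℝ} (ht : t ∈ Icc 0 σ) : 3 * c ≤ ‖a t 0‖ ^ 2 := by
  obtain ⟨h1, -, h2⟩ := h.norm_fst hH hHc hc hσ hσ' hS hH1
  refine le_of_deriv_zero_of_small (f := fun t => ‖a t 0‖ ^ 2) hσ.le hc (fun t ht =>
    hasDerivWithinAt_norm_sq_rotate (h.hasDerivWithinAt_early hH hHc hc hσ hσ' hS hH1 ht))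
    (fun t ht hlt => ?_) (by dsimp only; linarith) ht
  have h3 : grad₀ (liftD H σ c R t (cv a w t)) = 0 := by
    refine ext_inner_right ℝ fun v => ?_
    rw [inner_grad₀, liftD_apply, inner_zero_left]
    exact fderiv_liftHam_near_zero hH hc hHR t hlt ((h2 t ht).trans hρ) _
  rw [h3]; simp

/-- The trajectory carried by a chord. -/
lemma IsChord.hasDerivWithinAt_pack (hHR : ∀ t x, R - 4 * c ≤ ‖x 0‖ ^ 2 → H (t, x) = 0)
    (hρ : 2 * ρ ^ 2 = R) (hcR : 6 * c ≤ R) {t : ℝ} (ht : t ∈ Icc 0 σ) :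
    HasDerivWithinAt (fun s => pack m ((‖a s 0‖⁻¹ : ℝ) • starRingEnd ℂ (a s 0 * a (1 - s) 0), w s))
      ((σ⁻¹ : ℝ) • (-Complex.I • gradient (fun y => H (t / σ, y))
        (pack m ((‖a t 0‖⁻¹ : ℝ) • starRingEnd ℂ (a t 0 * a (1 - t) 0), w t)))) (Icc 0 σ) t := by
  have h1 := h.hasDerivWithinAt_early hH hHc hc hσ hσ' hS hH1 ht
  have h2 := h.hasDerivWithinAt_reflect hH hHc hc hσ hσ' hS hH1 ht
  have h3 := h.le_norm_fst hH hHc hc hσ hσ' hS hH1 hHR hρ hcR ht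
  have h4 : 2 * c < ‖(cv a w t).1 0‖ ^ 2 := by
    change 2 * c < ‖a t 0‖ ^ 2
    linarith
  have h5 : ‖(cv a w t).1 0‖ ^ 2 + ‖(cv a w t).2.1 0‖ ^ 2 = R :=
    ((h.norm_fst hH hHc hc hσ hσ' hS hH1).2.2 t ht).trans hρ
  have ha : a t 0 ≠ 0 := fun h0 => by rw [h0] at h3; norm_num at h3; linarith
  rw [grad₀_liftD hH hc t h4 h5] at h1
  rw [grad₁_liftD hH hc t h4 h5] at h2
  have h6 := hasDerivWithinAt_reduced (A := fun s => a s 0) (B := fun s => a (1 - s) 0) ha h1 h2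
  have h7 := (h.hasDerivWithinAt_snd (h.continuous_grad hH hHc hc hσ hS)
    (show t ∈ Icc (0 : ℝ) 1 from ⟨ht.1, by linarith [ht.2]⟩)).mono
    (Icc_subset_Icc_right (by linarith : σ ≤ 1))
  rw [lagrD_early hσ τ ht.2] at h7
  refine ((pack m).hasFDerivAt.comp_hasDerivWithinAt t (h6.prodMk h7)).congr_deriv ?_
  ext j
  refine Fin.cases ?_ (fun j => ?_) j
  · rw [pack_zero_apply]
    simp [redGrad, cv]
    ring
  · rw [pack_succ]
    simp only [PiLp.smul_apply, grad₂_liftD hH hc t h4 h5]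
    simp [redGrad, cv]
    ring

lemma IsChord.norm_snd {t : ℝ} (ht : t ∈ Icc σ 1) : ‖w t‖ ^ 2 = ‖w σ‖ ^ 2 := by
  refine eq_of_hasDerivWithinAt_zero (f := fun t => ‖w t‖ ^ 2) (fun s hs => ?_) ht
  have h7 := (h.hasDerivWithinAt_snd (h.continuous_grad hH hHc hc hσ hS)
    (show s ∈ Icc (0 : ℝ) 1 from ⟨hσ.le.trans hs.1, hs.2⟩)).mono (Icc_subset_Icc_left hσ.le)
  refine h7.norm_sq.congr_deriv ?_
  have := inner_grad₂_late (S₁ := S₁) (S₂ := S₂) (R := R) hH hc hσ hH1 τ hs.1 (cv a w s)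
  rw [inner_neg_I_smul, mul_eq_zero]
  exact Or.inr this

/-- A chord produces a trajectory starting and ending in the polydisk. -/
theorem IsChord.exists_trajectory (hHR : ∀ t x, R - 4 * c ≤ ‖x 0‖ ^ 2 → H (t, x) = 0)
    (hρ : 2 * ρ ^ 2 = R) (hcR : 6 * c ≤ R) :
    ∃ y : ℝ → CE (m + 1), (∀ t ∈ Icc (0 : ℝ) 1, HasDerivWithinAt y
      (-Complex.I • gradient (fun x => H (t, x)) (y t)) (Icc 0 1) t) ∧
      ∀ t ∈ ({0, 1} : Set ℝ), ‖y t 0‖ ^ 2 = ρ ^ 2 ∧ ∀ j : Fin m, ‖y t j.succ‖ ≤ r := by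
  obtain ⟨h1, h2, h3⟩ := h.norm_fst hH hHc hc hσ hσ' hS hH1
  have hle : ∀ t ∈ Icc 0 σ, 3 * c ≤ ‖a t 0‖ ^ 2 := fun t ht =>
    h.le_norm_fst hH hHc hc hσ hσ' hS hH1 hHR hρ hcR ht
  have hζ : ∀ t ∈ Icc 0 σ,
      ‖(‖a t 0‖⁻¹ : ℝ) • starRingEnd ℂ (a t 0 * a (1 - t) 0)‖ = ‖a (1 - t) 0‖ := fun t ht => by
    have := hle t ht
    rw [← red_eq hc (by linarith), norm_red hc (by linarith)]
  have hw : ∀ t ∈ Icc σ 1, ‖w t‖ ≤ r := fun t ht => by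
    obtain ⟨s, hs, hsr⟩ := h.hit
    have e : ‖w t‖ ^ 2 = ‖w s‖ ^ 2 := by
      rw [h.norm_snd hH hHc hc hσ hσ' hS hH1 ht, h.norm_snd hH hHc hc hσ hσ' hS hH1 hs]
    rwa [(sq_eq_sq₀ (norm_nonneg _) (norm_nonneg _)).1 e]
  refine ⟨fun t => pack m ((‖a (σ * t) 0‖⁻¹ : ℝ) •
    starRingEnd ℂ (a (σ * t) 0 * a (1 - σ * t) 0), w (σ * t)), fun t ht => ?_, ?_⟩
  · have ht' : ∀ s ∈ Icc (0 : ℝ) 1, σ * s ∈ Icc 0 σ := fun s hs =>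
      ⟨mul_nonneg hσ.le hs.1, mul_le_of_le_one_right hσ.le hs.2⟩
    have h4 := h.hasDerivWithinAt_pack hH hHc hc hσ hσ' hS hH1 hHR hρ hcR (ht' t ht)
    have h5 : HasDerivWithinAt (fun s => σ * s) σ (Icc 0 1) t := by
      simpa using ((hasDerivAt_id t).const_mul σ).hasDerivWithinAt
    refine (h4.scomp t h5 ht').congr_deriv ?_
    rw [smul_smul, mul_inv_cancel₀ hσ.ne', one_smul, mul_div_cancel_left₀ _ hσ.ne']
  · have key : ∀ t ∈ Icc 0 σ, ‖a (1 - t) 0‖ ^ 2 = ρ ^ 2 → ‖w t‖ ≤ r →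
        ‖pack m ((‖a t 0‖⁻¹ : ℝ) • starRingEnd ℂ (a t 0 * a (1 - t) 0), w t) 0‖ ^ 2 = ρ ^ 2 ∧
        ∀ j : Fin m, ‖pack m ((‖a t 0‖⁻¹ : ℝ) • starRingEnd ℂ (a t 0 * a (1 - t) 0), w t) j.succ‖ ≤
          r := fun t ht hn hr =>
      ⟨by rw [pack_zero_apply, hζ t ht, hn],
        fun j => by rw [pack_succ]; exact (PiLp.norm_apply_le _ _).trans hr⟩
    rintro t (rfl | rfl)
    · have e := h3 0 (left_mem_Icc.2 hσ.le)
      have := key 0 (left_mem_Icc.2 hσ.le) (by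
        rw [sub_zero, ← h.closed_fst] at e ⊢
        linarith) (by
        rw [h.closed_snd]; exact hw 1 ⟨by linarith, le_rfl⟩)
      simpa only [mul_zero] using this
    · have := key σ (right_mem_Icc.2 hσ.le) h2 (hw σ ⟨le_rfl, by linarith⟩)
      simpa only [mul_one] using this

end

end Functional

namespace Functional
open Trig

section

variable {E : Type*} [NormedAddCommGroup E] [NormedSpace ℝ E] {H : ℝ × E → ℝ}

lemma exists_mem_Icc (hH : ContDiff ℝ (⊤ : ℕ∞) H) (hHc : HasCompactSupport H) :
    ∃ C, ∀ p, H p ∈ Icc (-C) C := by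
  obtain ⟨C, hC⟩ := hHc.exists_bound_of_continuous hH.continuous
  exact ⟨C, fun p => abs_le.1 (hC p)⟩

lemma iInf_mem_Icc (hH : ContDiff ℝ (⊤ : ℕ∞) H) (hHc : HasCompactSupport H) (t : ℝ) (x : E) :
    H (t, x) ∈ Icc (⨅ x, H (t, x)) (⨆ x, H (t, x)) := by
  obtain ⟨C, hC⟩ := exists_mem_Icc hH hHc
  exact ⟨ciInf_le ⟨-C, by rintro _ ⟨x, rfl⟩; exact (hC _).1⟩ x,
    le_ciSup (f := fun x => H (t, x)) ⟨C, by rintro _ ⟨x, rfl⟩; exact (hC _).2⟩ x⟩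

lemma exists_le_add_mul_dist (hH : ContDiff ℝ (⊤ : ℕ∞) H) (hHc : HasCompactSupport H) :
    ∃ K : NNReal, ∀ s t x, H (s, x) ≤ H (t, x) + K * dist s t := by
  obtain ⟨K, hK⟩ := hH.lipschitzWith_of_hasCompactSupport hHc (by simp)
  refine ⟨K, fun s t x => ?_⟩
  have h1 := hK.dist_le_mul (s, x) (t, x)
  rw [dist_prod_same_right, Real.dist_eq] at h1
  linarith [le_abs_self (H (s, x) - H (t, x))]

lemma continuous_iSup_slice (hH : ContDiff ℝ (⊤ : ℕ∞) H) (hHc : HasCompactSupport H) :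
    Continuous fun t => ⨆ x, H (t, x) := by
  obtain ⟨K, hK⟩ := exists_le_add_mul_dist hH hHc
  refine (LipschitzWith.of_le_add_mul K fun s t => ciSup_le fun x => ?_).continuous
  linarith [hK s t x, (iInf_mem_Icc hH hHc t x).2]

lemma continuous_iInf_slice (hH : ContDiff ℝ (⊤ : ℕ∞) H) (hHc : HasCompactSupport H) :
    Continuous fun t => ⨅ x, H (t, x) := by
  obtain ⟨K, hK⟩ := exists_le_add_mul_dist hH hHc
  refine (LipschitzWith.of_le_add_mul K fun s t => ?_).continuous
  rw [← sub_le_iff_le_add]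
  refine le_ciInf fun x => ?_
  linarith [hK s t x, (iInf_mem_Icc hH hHc s x).1]

end

lemma integral_rescale {f : ℝ → ℝ} (hf : Continuous f) (h1 : ∀ t, 1 ≤ t → f t = 0) {σ : ℝ}
    (hσ : 0 < σ) (hσ1 : σ ≤ 1) :
    ∫ t in (0 : ℝ)..1, σ⁻¹ * f (t / σ) = ∫ t in (0 : ℝ)..1, f t := by
  rw [intervalIntegral.integral_const_mul, intervalIntegral.integral_comp_div f hσ.ne', zero_div,
    smul_eq_mul, inv_mul_cancel_left₀ hσ.ne',
    ← intervalIntegral.integral_add_adjacent_intervals (b := 1) (hf.intervalIntegrable _ _)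
    (hf.intervalIntegrable _ _), add_eq_left]
  have h2 : (1 : ℝ) ≤ 1 / σ := by rwa [one_le_div hσ]
  rw [intervalIntegral.integral_congr (g := fun _ => 0) fun t ht => ?_]
  · simp
  · rw [uIcc_of_le h2] at ht
    exact h1 t ht.1

variable {m : ℕ} {H : ℝ × CE (m + 1) → ℝ} {σ c R S₁ S₂ r : ℝ}

/-- The oscillation is bounded below unless a trajectory joins two points of the polydisk. -/
theorem mul_le_integral_oscillation (hH : ContDiff ℝ (⊤ : ℕ∞) H) (hHc : HasCompactSupport H)
    (hH1 : ∀ t x, 1 ≤ t → H (t, x) = 0) (hm : 0 < m) (hc : 0 < c) (hcR : 6 * c ≤ R)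
    (hHR : ∀ t x, R - 4 * c ≤ ‖x 0‖ ^ 2 → H (t, x) = 0) (hσ : 0 < σ) (hσ' : σ < 1 / 2)
    (hS₁ : 0 ≤ S₁) (hS : S₁ < S₂)
    (hno : ∀ y : ℝ → CE (m + 1), (∀ t ∈ Icc (0 : ℝ) 1, HasDerivWithinAt y
      (-Complex.I • gradient (fun x => H (t, x)) (y t)) (Icc 0 1) t) →
      ¬∀ t ∈ ({0, 1} : Set ℝ), Real.pi * ‖y t 0‖ ^ 2 = Real.pi * R / 2 ∧
        ∀ j : Fin m, Real.pi * ‖y t j.succ‖ ^ 2 ≤ S₂) :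
    S₁ * (1 - 2 * σ) ≤
      (∫ t in (0 : ℝ)..1, ⨆ x, H (t, x)) - ∫ t in (0 : ℝ)..1, ⨅ x, H (t, x) := by
  have hR : 0 < R := by linarith
  have hsup := continuous_iSup_slice hH hHc
  have hinf := continuous_iInf_slice hH hHc
  have hz : ∀ t, H (t, pack m ((√R : ℝ), 0)) = 0 := fun t => hHR t _ (by
    rw [pack_zero_apply, Complex.norm_real, Real.norm_of_nonneg (Real.sqrt_nonneg _),
      Real.sq_sqrt hR.le]
    linarith)
  have hlo0 : ∀ t, ⨅ x, H (t, x) ≤ 0 := fun t =>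
    (iInf_mem_Icc hH hHc t _).1.trans_eq (hz t)
  have hhi0 : ∀ t, 0 ≤ ⨆ x, H (t, x) := fun t =>
    (hz t).symm.trans_le (iInf_mem_Icc hH hHc t _).2
  have hmem : ∀ t (u : U m), liftHam H σ c R (t, u) ∈
      Icc (σ⁻¹ * ⨅ x, H (t / σ, x)) (σ⁻¹ * ⨆ x, H (t / σ, x)) := fun t u =>
    liftHam_mem hσ (iInf_mem_Icc hH hHc _) (hlo0 _) (hhi0 _) u
  have hS₂ : 0 ≤ S₂ / Real.pi := div_nonneg (by linarith) Real.pi_pos.le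
  have hρ : √(R / 2) ^ 2 = R / 2 := Real.sq_sqrt (by linarith)
  have h1 := lower_bound (F := liftHam H σ c R) (B := pot S₁ S₂ σ) (ρ := √(R / 2)) (σ := σ)
    (r := √(S₂ / Real.pi)) (lo := fun t => σ⁻¹ * ⨅ x, H (t / σ, x))
    (hi := fun t => σ⁻¹ * ⨆ x, H (t / σ, x)) (β := late σ) (S := S₁) (contDiff_liftHam hH hc)
    (hasCompactSupport_liftHam hHc hσ) contDiff_pot (hasCompactSupport_pot hS hσ) liftHam_neg hm
    (Real.sqrt_pos.2 (by linarith)) hσ.le (fun t ht w h => ⟨⟨(mem_of_pot_ne_zero hσ h).le, ht.2⟩,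
      Real.le_sqrt_of_sq_le (by
        rw [le_div_iff₀ Real.pi_pos, mul_comm]
        exact (norm_sq_lt_of_pot_ne_zero hS h).le)⟩)
    (continuous_const.mul (hinf.comp (f := fun t => t / σ) (by fun_prop)))
    (continuous_const.mul (hsup.comp (f := fun t => t / σ) (by fun_prop)))
    (fun t u => (hmem t u).1) (fun t u => (hmem t u).2) (contDiff_late σ).continuous
    (late_le_one σ) (le_pot hS₁ hS) (fun τ θ a w h => by
      obtain ⟨y, hy, hy'⟩ := h.exists_trajectory hH hHc hc hσ hσ' hS hH1 hHR (by rw [hρ]; ring) hcR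
      refine hno y hy fun t ht => ⟨by rw [(hy' t ht).1, hρ]; ring, fun j => ?_⟩
      have h2 := pow_le_pow_left₀ (norm_nonneg _) ((hy' t ht).2 j) 2
      rw [Real.sq_sqrt hS₂, le_div_iff₀ Real.pi_pos] at h2
      linarith)
  rw [integral_rescale hsup (fun t ht => by simp [hH1 t _ ht]) hσ (by linarith),
    integral_rescale hinf (fun t ht => by simp [hH1 t _ ht]) hσ (by linarith)] at h1
  exact (mul_le_mul_of_nonneg_left (integral_late_ge hσ hσ') hS₁).trans h1

lemma exists_lipschitzWith_gradient (hH : ContDiff ℝ (⊤ : ℕ∞) H) (hHc : HasCompactSupport H) :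
    ∃ K : NNReal, ∀ t, LipschitzWith K fun x => -Complex.I • gradient (fun y => H (t, y)) x := by
  obtain ⟨K, hK⟩ := (hH.fderiv_right (m := (⊤ : ℕ∞)) (by simp)).lipschitzWith_of_hasCompactSupport
    (hHc.fderiv ℝ) (by simp)
  refine ⟨K, fun t => LipschitzWith.of_dist_le_mul fun x y => ?_⟩
  rw [dist_eq_norm, ← smul_sub, norm_smul, norm_neg, Complex.norm_I, one_mul]
  set g := gradient (fun y => H (t, y)) x - gradient (fun y => H (t, y)) y with hg
  have h1 : ‖g‖ * ‖g‖ ≤ K * dist x y * ‖g‖ := by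
    rw [← real_inner_self_eq_norm_mul_norm]
    nth_rewrite 1 [hg]
    rw [inner_sub_left, inner_gradient_slice hH, inner_gradient_slice hH,
      ← sub_apply]
    refine (Real.le_norm_self _).trans ((ContinuousLinearMap.le_opNorm _ _).trans ?_)
    have h2 := hK.dist_le_mul (t, x) (t, y)
    rw [dist_prod_same_left, dist_eq_norm] at h2
    refine mul_le_mul h2 ?_ (norm_nonneg _) (by positivity)
    simp [Prod.norm_mk]
  rcases (norm_nonneg g).eq_or_lt with h | h
  · rw [← h]; positivity
  · exact le_of_mul_le_mul_right h1 h

lemma eq_flow_of_trajectory {H : ℝ → CE (m + 1) → ℝ} {φ : ℝ → CE (m + 1) ≃ CE (m + 1)}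
    (hφ : IsHamFlow H φ) (hH : ContDiff ℝ (⊤ : ℕ∞) (Function.uncurry H))
    (hHc : HasCompactSupport (Function.uncurry H)) {y : ℝ → CE (m + 1)}
    (hy : ∀ t ∈ Icc (0 : ℝ) 1, HasDerivWithinAt y
      (-Complex.I • gradient (fun x => H t x) (y t)) (Icc 0 1) t) : y 1 = φ 1 (y 0) := by
  obtain ⟨K, hK⟩ := exists_lipschitzWith_gradient hH hHc
  refine ODE_solution_unique (v := fun t x => -Complex.I • gradient (fun y => H t y) x) hK
    (fun t ht => (hy t ht).continuousWithinAt) (fun t ht => (hy t ⟨ht.1, ht.2.le⟩).mono_of_mem_nhdsWithin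
      (Icc_mem_nhdsGE_of_mem ht)) (g := fun t => φ t (y 0))
    (fun t _ => (hφ.isFlow t (y 0)).continuousAt.continuousWithinAt)
    (fun t _ => (hφ.isFlow t (y 0)).hasDerivWithinAt) (hφ.init _).symm
    (right_mem_Icc.2 zero_le_one)

lemma eq_zero_of_tsupport_subset {E : Type*} [TopologicalSpace E] {H : ℝ × E → ℝ}
    (hH : Continuous H) (h : tsupport H ⊆ Icc (0 : ℝ) 1 ×ˢ univ) {t : ℝ} (ht : 1 ≤ t) (x : E) :
    H (t, x) = 0 := by
  have h1 : ∀ s ∈ Ioi (1 : ℝ), H (s, x) = 0 := fun s hs => by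
    by_contra hne
    exact absurd (h (subset_tsupport _ hne)).1.2 (not_le.2 hs)
  have h2 : IsClosed {s : ℝ | H (s, x) = 0} :=
    isClosed_eq (hH.comp (f := fun s : ℝ => (s, x)) (by fun_prop)) continuous_const
  have h3 : closure (Ioi (1 : ℝ)) ⊆ {s : ℝ | H (s, x) = 0} := h2.closure_subset_iff.2 h1
  rw [closure_Ioi] at h3
  exact h3 ht

lemma exists_lt_of_tsupport_subset {R : ℝ} (hHc : HasCompactSupport H)
    (hR : 0 < R) (h : ∀ p ∈ tsupport H, ‖p.2 0‖ ^ 2 < R) :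
    ∃ c, 0 < c ∧ 6 * c ≤ R ∧ ∀ t x, R - 4 * c ≤ ‖x 0‖ ^ 2 → H (t, x) = 0 := by
  obtain ⟨M, hM, hM'⟩ : ∃ M < R, ∀ p ∈ tsupport H, ‖p.2 0‖ ^ 2 ≤ M := by
    rcases (tsupport H).eq_empty_or_nonempty with h0 | h0
    · exact ⟨0, hR, by simp [h0]⟩
    · obtain ⟨q, hq, hq'⟩ := hHc.isCompact.exists_isMaxOn h0
        (f := fun p : ℝ × CE (m + 1) => ‖p.2 0‖ ^ 2) (by fun_prop)
      exact ⟨_, h q hq, fun p hp => hq' hp⟩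
  refine ⟨min ((R - M) / 8) (R / 6), lt_min (by linarith) (by linarith), ?_, fun t x hx => ?_⟩
  · linarith [min_le_right ((R - M) / 8) (R / 6)]
  · by_contra hne
    have := hM' _ (subset_tsupport _ hne)
    dsimp only at this
    linarith [min_le_left ((R - M) / 8) (R / 6)]

end Functional

open Functional

/-- Theorem 1.2: the displacement energy of the polydisk
`D(1,S,…,S)` inside the cylinder `Z_{1,n−1}(1+ε)` is at least `S`: every compactly supported
Hamiltonian `H` on `[0,1] × Z` whose time-one map displaces `D(1,S,…,S)` from its closure
has Hofer norm `‖H‖ ≥ S`. -/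
theorem displacement_energy_polydisk {n : ℕ} (hn : 2 ≤ n) (S ε : ℝ)
    (hS : 1 < S) (hε0 : 0 < ε) (hε1 : ε < 1)
    (D Z : Set (CE n))
    (hD : D = {z : CE n | ∀ j : Fin n,
      ((j : ℕ) = 0 → Real.pi * ‖z j‖ ^ 2 < 1) ∧ ((j : ℕ) ≠ 0 → Real.pi * ‖z j‖ ^ 2 < S)})
    (hZ : Z = {z : CE n | ∀ j : Fin n, (j : ℕ) = 0 → Real.pi * ‖z j‖ ^ 2 < 1 + ε})
    (H : ℝ → CE n → ℝ) (φ : ℝ → CE n ≃ CE n)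
    (hHsmooth : ContDiff ℝ (⊤ : ℕ∞) (Function.uncurry H))
    (hHsupp : HasCompactSupport (Function.uncurry H))
    (hsupp : tsupport (Function.uncurry H) ⊆ Set.Icc (0:ℝ) 1 ×ˢ Z)
    (hφ : IsHamFlow H φ)
    (hdisp : (fun x => φ 1 x) '' D ∩ closure D = ∅) :
    S ≤ ∫ t in (0:ℝ)..1, ((⨆ x : CE n, H t x) - ⨅ x : CE n, H t x) := by
  obtain ⟨m, rfl⟩ : ∃ m, n = m + 1 := ⟨n - 1, by omega⟩
  have hπ := Real.pi_pos
  have hπR : Real.pi * ((1 + ε) / Real.pi) = 1 + ε := mul_div_cancel₀ _ hπ.ne'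
  have hH1 : ∀ t x, 1 ≤ t → Function.uncurry H (t, x) = 0 := fun t x ht =>
    eq_zero_of_tsupport_subset hHsmooth.continuous
      (hsupp.trans (prod_mono_right (subset_univ _))) ht x
  obtain ⟨c, hc, hcR, hHR⟩ := exists_lt_of_tsupport_subset (R := (1 + ε) / Real.pi) hHsupp
    (by positivity) (fun p hp => by
      have h1 := (hsupp hp).2
      rw [hZ] at h1
      rw [lt_div_iff₀ hπ, mul_comm]
      exact h1 0 rfl)
  have hsup := continuous_iSup_slice hHsmooth hHsupp
  have hinf := continuous_iInf_slice hHsmooth hHsupp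
  simp only [Function.uncurry_apply_pair] at hsup hinf
  rw [intervalIntegral.integral_sub (hsup.intervalIntegrable _ _) (hinf.intervalIntegrable _ _)]
  set I := (∫ t in (0 : ℝ)..1, ⨆ x, H t x) - ∫ t in (0 : ℝ)..1, ⨅ x, H t x with hI
  have key : ∀ S₁ S₂ σ : ℝ, 0 ≤ S₁ → S₁ < S₂ → S₂ < S → 0 < σ → σ < 1 / 2 →
      S₁ * (1 - 2 * σ) ≤ I := by
    intro S₁ S₂ σ h1 h2 h3 h4 h5
    refine mul_le_integral_oscillation hHsmooth hHsupp hH1 (by omega) hc hcR hHR h4 h5 h1 h2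
      fun y hy hy' => ?_
    have hmem : ∀ t ∈ ({0, 1} : Set ℝ), y t ∈ D := fun t ht => by
      rw [hD]
      refine Fin.cases ⟨fun _ => ?_, fun h => absurd rfl h⟩ fun j =>
        ⟨fun h => absurd h (by simp), fun _ => ((hy' t ht).2 j).trans_lt h3⟩
      rw [(hy' t ht).1, hπR]
      linarith
    have h6 : y 1 ∈ (fun x => φ 1 x) '' D ∩ closure D :=
      ⟨⟨y 0, hmem 0 (by simp), (eq_flow_of_trajectory hφ hHsmooth hHsupp hy).symm⟩,
        subset_closure (hmem 1 (by simp))⟩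
    rw [hdisp] at h6
    exact h6
  by_contra! hlt
  obtain ⟨S₁, h1, h2⟩ := exists_between (max_lt hlt (by linarith : (0 : ℝ) < S))
  obtain ⟨S₂, h3, h4⟩ := exists_between h2
  obtain ⟨h5, h6⟩ := max_lt_iff.1 h1
  have h7 : 0 < (S₁ - I) / (4 * S₁) := div_pos (by linarith) (by linarith)
  obtain ⟨σ, h8, h9⟩ := exists_between (lt_min h7 (by norm_num : (0 : ℝ) < 1 / 2))
  obtain ⟨h10, h11⟩ := lt_min_iff.1 h9
  have h12 := key S₁ S₂ σ h6.le h3 h4 h8 h11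
  rw [lt_div_iff₀ (by linarith)] at h10
  linarith

end
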